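/- (Banach envelope of H^p(ℂ_+), dense-subspace form) Let 0 < p < 1 and α = 1/p - 2. Let B = {f ∈ H^p(ℂ_+) : ‖f‖_{H^p(ℂ_+)} ≤ 1}, regarded as a subset of the complex vector space of functions ℂ_+ → ℂ, and let μ be the Minkowski functional (gauge) of the convex hull of B. Then there exist constants c, C > 0 such that for every f ∈ H^p(ℂ_+): c·μ(f) ≤ ∫_{ℂ_+} |f(x+iy)| y^α dx dy ≤ C·μ(f). -/

import Mathlib

open MeasureTheory Real Complex
open scoped ENNReal NNReal

namespace HardyEnv
open Filter Topology Set

lemma one_add_re_sq_le (z : ℂ) : 1 + z.re ^ 2 ≤ 1 + ‖z‖ ^ 2 := by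
  rw [Complex.sq_norm, Complex.normSq_apply]; nlinarith [sq_nonneg z.im]

lemma inv_bound (z : ℂ) : (1 + ‖z‖ ^ 2)⁻¹ ≤ (1 + z.re ^ 2)⁻¹ := by
  apply inv_anti₀ (by positivity) (one_add_re_sq_le z)

lemma continuous_line (a : ℝ) : Continuous (fun x : ℝ => (x : ℂ) + a * I) := by fun_prop

/-- integrability on lines -/
lemma line_integrable {Φ : ℂ → ℂ} {a C : ℝ} {S : Set ℂ} (hd : ContinuousOn Φ S)
    (hS : ∀ x : ℝ, (x : ℂ) + a * I ∈ S)
    (hb : ∀ z ∈ S, ‖Φ z‖ ≤ C * (1 + ‖z‖ ^ 2)⁻¹) :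
    Integrable (fun x : ℝ => Φ (x + a * I)) := by
  have hC : 0 ≤ C := by
    have := (norm_nonneg _).trans (hb _ (hS 0))
    by_contra h
    push Not at h
    have h2 : 0 < (1 + ‖((0:ℝ) : ℂ) + a * I‖ ^ 2)⁻¹ := by positivity
    nlinarith
  refine Integrable.mono' (integrable_inv_one_add_sq.const_mul C) ?_ ?_
  · exact (hd.comp_continuous (continuous_line a) hS).aestronglyMeasurable
  · filter_upwards with x
    refine (hb _ (hS x)).trans ?_
    have := inv_bound ((x : ℂ) + a * I)
    simp only [add_re, ofReal_re, mul_re, I_re, mul_zero, ofReal_im, I_im, mul_one, sub_self,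
      add_zero] at this
    gcongr

lemma contour_shift {Φ : ℂ → ℂ} {a b C : ℝ} (hab : a ≤ b)
    (hd : DifferentiableOn ℂ Φ {z | a ≤ z.im ∧ z.im ≤ b})
    (hb : ∀ z : ℂ, a ≤ z.im → z.im ≤ b → ‖Φ z‖ ≤ C * (1 + ‖z‖ ^ 2)⁻¹) :
    ∫ x : ℝ, Φ (x + a * I) = ∫ x : ℝ, Φ (x + b * I) := by
  have hmema : ∀ x : ℝ, (x : ℂ) + a * I ∈ {z : ℂ | a ≤ z.im ∧ z.im ≤ b} := by
    intro x; simp [hab]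
  have hmemb : ∀ x : ℝ, (x : ℂ) + b * I ∈ {z : ℂ | a ≤ z.im ∧ z.im ≤ b} := by
    intro x; simp [hab]
  have hb' : ∀ z ∈ {z : ℂ | a ≤ z.im ∧ z.im ≤ b}, ‖Φ z‖ ≤ C * (1 + ‖z‖ ^ 2)⁻¹ :=
    fun z hz => hb z hz.1 hz.2
  have ia := line_integrable hd.continuousOn hmema hb'
  have ib := line_integrable hd.continuousOn hmemb hb'
  have hC : 0 ≤ C := by
    have := (norm_nonneg _).trans (hb' _ (hmema 0))
    by_contra h
    push Not at h
    have h2 : 0 < (1 + ‖((0:ℝ) : ℂ) + a * I‖ ^ 2)⁻¹ := by positivity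
    nlinarith
  have ta := intervalIntegral_tendsto_integral ia tendsto_neg_atTop_atBot tendsto_id
  have tb := intervalIntegral_tendsto_integral ib tendsto_neg_atTop_atBot tendsto_id
  have hside : ∀ s : ℝ → ℝ, (∀ R, s R ^ 2 = R ^ 2) →
      Tendsto (fun R : ℝ => I • ∫ y : ℝ in a..b, Φ (s R + y * I)) atTop (𝓝 0) := by
    intro s hs
    rw [tendsto_zero_iff_norm_tendsto_zero]
    have hlim : Tendsto (fun R : ℝ => C * (1 + R ^ 2)⁻¹ * |b - a|) atTop (𝓝 0) := by
      have : Tendsto (fun R : ℝ => (1 + R ^ 2)⁻¹) atTop (𝓝 0) := by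
        apply Tendsto.inv_tendsto_atTop
        apply tendsto_atTop_add_const_left
        exact tendsto_pow_atTop (by norm_num)
      simpa using (this.const_mul C).mul_const |b - a|
    refine squeeze_zero (fun _ => norm_nonneg _) (fun R => ?_) hlim
    rw [norm_smul, norm_I, one_mul]
    apply intervalIntegral.norm_integral_le_of_norm_le_const
    intro y hy
    rw [uIoc_of_le hab] at hy
    have h1 := hb ((s R : ℂ) + y * I) (by simpa using hy.1.le) (by simpa using hy.2)
    refine h1.trans ?_
    have := inv_bound ((s R : ℂ) + y * I)
    simp only [add_re, ofReal_re, mul_re, I_re, mul_zero, ofReal_im, I_im, mul_one, sub_self,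
      add_zero, hs] at this
    gcongr
  have t1 := hside (fun R => R) (fun _ => rfl)
  have t2 := hside (fun R => -R) (fun R => by ring)
  have key : ∀ R : ℝ, (∫ x in (-R)..(id R), Φ (x + a * I)) - (∫ x in (-R)..(id R), Φ (x + b * I))
      + I • (∫ y : ℝ in a..b, Φ ((R : ℝ) + y * I))
      - I • (∫ y : ℝ in a..b, Φ (((-R : ℝ) : ℂ) + y * I)) = 0 := by
    intro R
    have := Complex.integral_boundary_rect_eq_zero_of_differentiableOn Φ (⟨-R, a⟩ : ℂ) (⟨R, b⟩ : ℂ)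
      (hd.mono ?_)
    · simpa using this
    · intro z hz
      rw [mem_reProdIm] at hz
      have := hz.2
      simp only [uIcc_of_le hab, mem_Icc] at this
      exact this
  have tt := ((ta.sub tb).add t1).sub t2
  have : (∫ x : ℝ, Φ (x + a * I)) - (∫ x : ℝ, Φ (x + b * I)) + 0 - 0 = 0 := by
    refine tendsto_nhds_unique tt ?_
    refine tendsto_const_nhds.congr (fun R => (key R).symm)
  simpa [sub_eq_zero] using this

lemma contour_zero {Φ : ℂ → ℂ} {C : ℝ}
    (hd : DifferentiableOn ℂ Φ {z | 0 ≤ z.im})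
    (hb : ∀ z : ℂ, 0 ≤ z.im → ‖Φ z‖ ≤ C * (1 + ‖z‖ ^ 2)⁻¹) :
    ∫ x : ℝ, Φ x = 0 := by
  have hC : 0 ≤ C := by
    have := (norm_nonneg _).trans (hb 0 (by simp))
    simpa using this
  have hc : ∀ b : ℝ, 0 ≤ b → ∫ x : ℝ, Φ (x + b * I) = ∫ x : ℝ, Φ x := by
    intro b hb0
    have := contour_shift (Φ := Φ) (C := C) hb0 (hd.mono (fun z hz => hz.1)) (fun z h1 _ => hb z h1)
    rw [← this]; simp
  have t : Tendsto (fun b : ℝ => ∫ x : ℝ, Φ (x + b * I)) atTop (𝓝 (∫ x : ℝ, (0:ℂ))) := by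
    apply tendsto_integral_filter_of_dominated_convergence (fun x : ℝ => C * (1 + x ^ 2)⁻¹)
    · filter_upwards [eventually_ge_atTop 0] with b hb0
      exact (hd.continuousOn.comp_continuous (continuous_line b)
        (fun x => by simpa using hb0)).aestronglyMeasurable
    · filter_upwards [eventually_ge_atTop 0] with b hb0
      filter_upwards with x
      refine (hb _ (by simpa using hb0)).trans ?_
      have := inv_bound ((x : ℂ) + b * I)
      simp only [add_re, ofReal_re, mul_re, I_re, mul_zero, ofReal_im, I_im, mul_one, sub_self,
        add_zero] at this
      gcongr
    · exact integrable_inv_one_add_sq.const_mul C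
    · filter_upwards with x
      rw [tendsto_zero_iff_norm_tendsto_zero]
      have hlim : Tendsto (fun b : ℝ => C * (1 + b ^ 2)⁻¹) atTop (𝓝 0) := by
        have : Tendsto (fun R : ℝ => (1 + R ^ 2)⁻¹) atTop (𝓝 0) := by
          apply Tendsto.inv_tendsto_atTop
          apply tendsto_atTop_add_const_left
          exact tendsto_pow_atTop (by norm_num)
        simpa using (this.const_mul C)
      refine squeeze_zero' (Eventually.of_forall (fun _ => norm_nonneg _)) ?_ hlim
      filter_upwards [eventually_ge_atTop 0] with b hb0
      refine (hb _ (by simpa using hb0)).trans ?_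
      gcongr
      have := Complex.im_le_norm ((x : ℂ) + b * I)
      simpa using this
  simp only [integral_zero] at t
  refine tendsto_nhds_unique ?_ t
  apply tendsto_const_nhds.congr'
  filter_upwards [eventually_ge_atTop 0] with b hb0
  exact (hc b hb0).symm

/-- Poisson kernel -/
noncomputable def pk (y s : ℝ) : ℝ := π⁻¹ * (y / (s ^ 2 + y ^ 2))

lemma pk_nonneg {y : ℝ} (hy : 0 < y) (s : ℝ) : 0 ≤ pk y s := by unfold pk; positivity
lemma pk_pos {y : ℝ} (hy : 0 < y) (s : ℝ) : 0 < pk y s := by unfold pk; positivity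

lemma pk_neg (y s : ℝ) : pk y (-s) = pk y s := by unfold pk; simp

lemma pk_sub_comm (y s t : ℝ) : pk y (s - t) = pk y (t - s) := by rw [← pk_neg]; simp

lemma pk_eq {y : ℝ} (hy : 0 < y) (s : ℝ) : pk y s = π⁻¹ * y⁻¹ * (1 + (s / y) ^ 2)⁻¹ := by
  unfold pk; field_simp; ring

lemma continuous_pk {y : ℝ} (hy : 0 < y) : Continuous (pk y) := by
  unfold pk
  refine continuous_const.mul (continuous_const.div (by fun_prop) (fun s => by positivity))

lemma pk_le {y : ℝ} (hy : 0 < y) (s : ℝ) : pk y s ≤ 1 / y := by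
  rw [pk_eq hy]
  have h1 : (1 + (s / y) ^ 2)⁻¹ ≤ 1 := inv_le_one_of_one_le₀ (by nlinarith [sq_nonneg (s / y)])
  have h2 : π⁻¹ ≤ 1 := inv_le_one_of_one_le₀ (by linarith [pi_gt_three])
  have h3 : (0:ℝ) < y⁻¹ := by positivity
  have h4 : (0:ℝ) < π⁻¹ := by positivity
  calc π⁻¹ * y⁻¹ * (1 + (s / y) ^ 2)⁻¹ ≤ 1 * y⁻¹ * 1 := by gcongr
    _ = 1 / y := by simp

lemma integrable_pk {y : ℝ} (hy : 0 < y) : Integrable (pk y) := by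
  have : pk y = fun s => π⁻¹ * y⁻¹ * (1 + (s / y) ^ 2)⁻¹ := funext (pk_eq hy)
  rw [this]
  exact (integrable_inv_one_add_sq.comp_div hy.ne').const_mul _

lemma integral_pk {y : ℝ} (hy : 0 < y) : ∫ s, pk y s = 1 := by
  have : pk y = fun s => π⁻¹ * y⁻¹ * (1 + (s / y) ^ 2)⁻¹ := funext (pk_eq hy)
  rw [this, integral_const_mul, Measure.integral_comp_div (fun x : ℝ => (1 + x ^ 2)⁻¹) y,
    integral_univ_inv_one_add_sq, abs_of_pos hy, smul_eq_mul]
  field_simp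

lemma integral_pk_sub {y : ℝ} (hy : 0 < y) (x : ℝ) : ∫ t, pk y (x - t) = 1 := by
  rw [integral_sub_left_eq_self (fun s => pk y s) volume x, integral_pk hy]

lemma integrable_pk_sub {y : ℝ} (hy : 0 < y) (x : ℝ) : Integrable (fun t => pk y (x - t)) :=
  (integrable_pk hy).comp_sub_left x

lemma lintegral_pk_sub {y : ℝ} (hy : 0 < y) (x : ℝ) :
    ∫⁻ t, ENNReal.ofReal (pk y (x - t)) = 1 := by
  rw [← ofReal_integral_eq_lintegral_ofReal (integrable_pk_sub hy x)
    (Eventually.of_forall fun t => pk_nonneg hy _), integral_pk_sub hy, ENNReal.ofReal_one]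

lemma lintegral_pk_sub' {y : ℝ} (hy : 0 < y) (x : ℝ) :
    ∫⁻ t, ENNReal.ofReal (pk y (t - x)) = 1 := by
  rw [← lintegral_pk_sub hy x]
  simp_rw [pk_sub_comm y x]

lemma one_add_norm_le {z w : ℂ} {r : ℝ} (hr : 0 < r) (h : r ≤ ‖z - w‖) :
    1 + ‖z‖ ≤ ‖z - w‖ * (1 + (1 + ‖w‖) / r) := by
  have h1 : ‖z‖ ≤ ‖z - w‖ + ‖w‖ := by simpa using norm_add_le (z - w) w
  have h2 : 1 + ‖w‖ ≤ ‖z - w‖ * ((1 + ‖w‖) / r) := by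
    rw [mul_div_assoc', le_div_iff₀ hr]
    have := norm_nonneg w
    nlinarith
  nlinarith

lemma pk_complex (y s : ℝ) (hy : 0 < y) :
    ((pk y s : ℝ) : ℂ) = (π : ℂ)⁻¹ * y / (((s : ℂ) - y * I) * ((s : ℂ) + y * I)) := by
  have h0 : ((s : ℂ) ^ 2 + (y : ℂ) ^ 2) ≠ 0 := by
    have : (s ^ 2 + y ^ 2 : ℝ) ≠ 0 := by positivity
    exact_mod_cast this
  have : (((s : ℂ) - y * I) * ((s : ℂ) + y * I)) = (s : ℂ) ^ 2 + (y : ℂ) ^ 2 := by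
    ring_nf; rw [I_sq]; ring
  rw [this]
  unfold pk
  push_cast
  rw [mul_div_assoc]

/-- Poisson formula for a function holomorphic near the closed upper half plane and bounded. -/
lemma poisson0 {h : ℂ → ℂ} {a M : ℝ} (ha : 0 < a) (hd : DifferentiableOn ℂ h {z | -a < z.im})
    (hM : ∀ z : ℂ, 0 ≤ z.im → ‖h z‖ ≤ M) (x y : ℝ) (hy : 0 < y) :
    h (x + y * I) = ∫ t : ℝ, (pk y (x - t) : ℂ) * h t := by
  set Z : ℂ := x + y * I with hZ
  set Zb : ℂ := x - y * I with hZb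
  have hM0 : 0 ≤ M := (norm_nonneg _).trans (hM 0 (by simp))
  have hZim : Z.im = y := by simp [hZ]
  have hZbim : Zb.im = -y := by simp [hZb]
  set U : Set ℂ := {z | -a < z.im}
  have hU : IsOpen U := isOpen_lt continuous_const Complex.continuous_im
  have hZU : Z ∈ U := by show -a < Z.im; rw [hZim]; linarith
  have hds : DifferentiableOn ℂ (dslope h Z) U :=
    (Complex.differentiableOn_dslope (hU.mem_nhds hZU)).2 hd
  let Φ : ℂ → ℂ := fun z => dslope h Z z / (z - Zb)
  have hne : ∀ z : ℂ, 0 ≤ z.im → y ≤ ‖z - Zb‖ := by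
    intro z hz
    refine le_trans ?_ (Complex.abs_im_le_norm _)
    rw [sub_im, hZbim]
    refine le_trans ?_ (le_abs_self _)
    linarith
  have hΦd : DifferentiableOn ℂ Φ {z | 0 ≤ z.im} := by
    refine DifferentiableOn.div (hds.mono (fun z hz => ?_)) (by fun_prop) ?_
    · have : 0 ≤ z.im := hz
      show -a < z.im; linarith
    · intro z hz h0
      have := hne z hz
      rw [h0] at this; simp at this; linarith
  -- bound of dslope
  obtain ⟨K, hK⟩ : ∃ K, ∀ z ∈ Metric.closedBall Z (y/2), ‖dslope h Z z‖ ≤ K := by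
    apply (isCompact_closedBall Z (y/2)).exists_bound_of_continuousOn
    apply hds.continuousOn.mono
    intro z hz
    rw [Metric.mem_closedBall, Complex.dist_eq] at hz
    have h1 := (Complex.abs_im_le_norm (z - Z)).trans hz
    rw [sub_im, hZim] at h1
    have := abs_le.1 h1
    show -a < z.im; linarith
  have hK0 : 0 ≤ K := (norm_nonneg _).trans (hK Z (by simp; linarith))
  set A := 1 + (1 + ‖Z‖) / (y/2) with hA
  set A' := 1 + (1 + ‖Zb‖) / y with hA'
  have hA0 : 0 < A := by positivity
  have hA0' : 0 < A' := by positivity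
  set D := K * (1 + ‖Z‖ + y/2) + 2 * M * A with hD
  have hds_b : ∀ z : ℂ, 0 ≤ z.im → ‖dslope h Z z‖ * (1 + ‖z‖) ≤ D := by
    intro z hz
    by_cases hc : ‖z - Z‖ ≤ y / 2
    · have h1 := hK z (by rwa [Metric.mem_closedBall, Complex.dist_eq])
      have h2 : ‖z‖ ≤ ‖z - Z‖ + ‖Z‖ := by simpa using norm_add_le (z - Z) Z
      have h3 : ‖dslope h Z z‖ * (1 + ‖z‖) ≤ K * (1 + ‖Z‖ + y/2) := by
        have h4 : 1 + ‖z‖ ≤ 1 + ‖Z‖ + y/2 := by linarith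
        gcongr
      have : 0 ≤ 2 * M * A := by positivity
      linarith
    · push Not at hc
      have hzZ : z ≠ Z := by
        rintro rfl; simp at hc; linarith
      have h1 := one_add_norm_le (by linarith : 0 < y / 2) hc.le
      rw [dslope_of_ne _ hzZ, slope_def_field, norm_div]
      have hpos : 0 < ‖z - Z‖ := by linarith
      have h2 : ‖h z - h Z‖ ≤ 2 * M := by
        refine (norm_sub_le _ _).trans ?_
        have := hM z hz
        have := hM Z (by rw [hZim]; exact hy.le)
        linarith
      have h3 : ‖h z - h Z‖ / ‖z - Z‖ * (1 + ‖z‖) ≤ 2 * M / ‖z - Z‖ * (‖z - Z‖ * A) := by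
        gcongr
      have h4 : 2 * M / ‖z - Z‖ * (‖z - Z‖ * A) = 2 * M * A := by field_simp
      have : 0 ≤ K * (1 + ‖Z‖ + y/2) := by positivity
      linarith
  have hzero := contour_zero (Φ := Φ) (C := D * A') hΦd (by
    intro z hz
    have h1 := hds_b z hz
    have h2 := one_add_norm_le hy (hne z hz)
    have hpos : 0 < ‖z - Zb‖ := lt_of_lt_of_le hy (hne z hz)
    have hD0 : 0 ≤ D := le_trans (by positivity) h1
    have hz0 := norm_nonneg z
    rw [← div_eq_mul_inv, le_div_iff₀ (by positivity)]
    simp only [Φ, norm_div]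
    calc ‖dslope h Z z‖ / ‖z - Zb‖ * (1 + ‖z‖ ^ 2)
        ≤ ‖dslope h Z z‖ / ‖z - Zb‖ * ((1 + ‖z‖) * (1 + ‖z‖)) := by
          gcongr; nlinarith
      _ = (‖dslope h Z z‖ * (1 + ‖z‖)) * ((1 + ‖z‖) / ‖z - Zb‖) := by field_simp
      _ ≤ D * A' := by
          gcongr
          rw [div_le_iff₀ hpos]; linarith)
  have hpt : ∀ t : ℝ, (pk y (x - t) : ℂ) * h t = (pk y (x - t) : ℂ) * h Z + (π : ℂ)⁻¹ * y * Φ t := by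
    intro t
    have htZ : (t : ℂ) ≠ Z := by
      intro h0
      have := congrArg Complex.im h0
      rw [hZim] at this; simp at this; linarith
    have htZb : (t : ℂ) - Zb ≠ 0 := by
      intro h0
      have := hne t (by simp)
      rw [h0] at this; simp at this; linarith
    have htZ' : (t : ℂ) - Z ≠ 0 := sub_ne_zero.2 htZ
    simp only [Φ]
    rw [dslope_of_ne _ htZ, slope_def_field, pk_complex _ _ hy]
    have e1 : ((x - t : ℝ) : ℂ) - y * I = -((t : ℂ) - Zb) := by rw [hZb]; push_cast; ring
    have e2 : ((x - t : ℝ) : ℂ) + y * I = -((t : ℂ) - Z) := by rw [hZ]; push_cast; ring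
    rw [e1, e2]
    field_simp
    ring
  simp_rw [hpt]
  have i1 : Integrable (fun t : ℝ => (pk y (x - t) : ℂ) * h Z) :=
    ((integrable_pk_sub hy x).ofReal).mul_const _
  have i2 : Integrable (fun t : ℝ => (π : ℂ)⁻¹ * y * Φ t) := by
    have hsplit : (fun t : ℝ => (π : ℂ)⁻¹ * y * Φ t) =
        fun t : ℝ => (pk y (x - t) : ℂ) * h t - (pk y (x - t) : ℂ) * h Z := by
      funext t; rw [hpt]; ring
    rw [hsplit]
    refine Integrable.sub ?_ i1
    refine ((integrable_pk_sub hy x).ofReal (𝕜 := ℂ)).mul_bdd (c := M) ?_ ?_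
    · have : ContinuousOn h {z | 0 ≤ z.im} := hd.continuousOn.mono (fun z hz => by
        have : 0 ≤ z.im := hz
        show -a < z.im; linarith)
      exact (this.comp_continuous Complex.continuous_ofReal (fun t => by simp)).aestronglyMeasurable
    · filter_upwards with t
      exact hM _ (by simp)
  rw [integral_add i1 i2, integral_const_mul, hzero, integral_mul_const, integral_complex_ofReal,
    integral_pk_sub hy]
  simp

/-- Poisson formula between lines. -/
lemma poisson {h : ℂ → ℂ} (hd : DifferentiableOn ℂ h {z | 0 < z.im})
    (hM : ∀ a : ℝ, 0 < a → ∃ M, ∀ z : ℂ, a ≤ z.im → ‖h z‖ ≤ M) (x a y : ℝ) (ha : 0 < a)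
    (hy : 0 < y) :
    h (x + (a + y : ℝ) * I) = ∫ t : ℝ, (pk y (x - t) : ℂ) * h (t + a * I) := by
  obtain ⟨M, hM⟩ := hM a ha
  have := poisson0 (h := fun z => h (z + a * I)) (M := M) ha ?_ ?_ x y hy
  · rw [← this]; congr 1; push_cast; ring
  · refine hd.comp (by fun_prop) ?_
    intro z hz
    have : -a < z.im := hz
    show 0 < (z + a * I).im
    simp; linarith
  · intro z hz
    apply hM
    simpa using hz

end HardyEnv

open MeasureTheory Real Complex
open scoped ENNReal NNReal

namespace HardyEnv
open Filter Topology Set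

lemma circle_submean {f : ℂ → ℂ} {c : ℂ} {R p : ℝ} (hR : 0 < R) (hp : 0 < p)
    (hf : AnalyticOnNhd ℂ f (Metric.closedBall c R)) :
    ‖f c‖ ^ p ≤ circleAverage (fun z => ‖f z‖ ^ p) c R := by
  have hcont : ContinuousOn (fun z => ‖f z‖ ^ p) (Metric.closedBall c R) :=
    (hf.continuousOn.norm).rpow_const (fun _ _ => Or.inr hp.le)
  by_cases hfc : f c = 0
  · rw [hfc, norm_zero, Real.zero_rpow hp.ne']
    apply circleAverage_nonneg_of_nonneg
    intro x _; positivity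
  have ha : 0 < ‖f c‖ := norm_pos_iff.2 hfc
  set a := ‖f c‖ with ha'
  have hJ : Real.log a ≤ circleAverage (fun z => Real.log ‖f z‖) c R := by
    have h1 := AnalyticOnNhd.circleAverage_log_norm (f := f) (c := c) hR.ne'
      (by rwa [abs_of_pos hR]) hfc
    rw [h1]
    have : 0 ≤ ∑ᶠ u, (MeromorphicOn.divisor f (Metric.closedBall c |R|) u : ℝ) * Real.log (R * ‖c - u‖⁻¹) := by
      apply finsum_nonneg
      intro u
      by_cases hu : u ∈ Metric.closedBall c |R|
      · apply mul_nonneg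
        · have := MeromorphicOn.AnalyticOnNhd.divisor_nonneg (U := Metric.closedBall c |R|) (f := f) (by rwa [abs_of_pos hR])
          exact_mod_cast this u
        · by_cases hcu : c = u
          · subst hcu; simp
          have hpos : 0 < ‖c - u‖ := norm_pos_iff.2 (sub_ne_zero.2 hcu)
          apply Real.log_nonneg
          rw [← div_eq_mul_inv, one_le_div hpos]
          rw [Metric.mem_closedBall, Complex.dist_eq, norm_sub_rev, abs_of_pos hR] at hu
          exact hu
      · rw [Function.locallyFinsuppWithin.apply_eq_zero_of_notMem _ hu]; simp
    linarith
  -- modify on the zeros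
  have hcod : (fun z => if f z = 0 then Real.log a - 1 / p else Real.log ‖f z‖) =ᶠ[codiscreteWithin
      (Metric.sphere c |R|)] (fun z => Real.log ‖f z‖) := by
    have h1 : f ⁻¹' {0}ᶜ ∈ codiscreteWithin (Metric.closedBall c R) :=
      hf.preimage_zero_mem_codiscreteWithin (x := c) hfc (by simp [hR.le])
        ((convex_closedBall c R).isConnected ⟨c, by simp [hR.le]⟩)
    have h2 : f ⁻¹' {0}ᶜ ∈ codiscreteWithin (Metric.sphere c |R|) :=
      codiscreteWithin_mono (by rw [abs_of_pos hR]; exact Metric.sphere_subset_closedBall) h1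
    filter_upwards [h2] with z hz
    have : f z ≠ 0 := hz
    simp [this]
  have hInteg : CircleIntegrable (fun z => Real.log ‖f z‖) c R :=
    MeromorphicOn.circleIntegrable_log_norm (fun z hz => (hf z (by
      rw [abs_of_pos hR] at hz; exact Metric.sphere_subset_closedBall hz)).meromorphicAt)
  have hInteg' := hInteg.congr_codiscreteWithin hcod.symm
  rw [← circleAverage_congr_codiscreteWithin hcod hR.ne'] at hJ
  have hcI : CircleIntegrable (fun z => ‖f z‖ ^ p) c R :=
    (hcont.mono Metric.sphere_subset_closedBall).circleIntegrable hR.le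
  have hmono : circleAverage (fun z => if f z = 0 then Real.log a - 1 / p else Real.log ‖f z‖) c R
      ≤ circleAverage (fun z => (p * a ^ p)⁻¹ • ‖f z‖ ^ p + (Real.log a - 1 / p)) c R := by
    apply circleAverage_mono hInteg'
    · exact (hcI.const_smul).add (circleIntegrable_const _ _ _)
    · intro z _
      by_cases hz : f z = 0
      · simp only [hz, if_true, norm_zero, Real.zero_rpow hp.ne']; simp
      · simp only [hz, if_false]
        have hz' : 0 < ‖f z‖ := norm_pos_iff.2 hz
        have h1 : Real.log (‖f z‖ ^ p / a ^ p) ≤ ‖f z‖ ^ p / a ^ p - 1 :=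
          Real.log_le_sub_one_of_pos (by positivity)
        rw [Real.log_div (by positivity) (by positivity), Real.log_rpow hz', Real.log_rpow ha] at h1
        have h2 : (p * a ^ p)⁻¹ • ‖f z‖ ^ p = (‖f z‖ ^ p / a ^ p) / p := by
          rw [smul_eq_mul]; field_simp
        rw [h2]
        have h3 : Real.log ‖f z‖ = (p * Real.log ‖f z‖ - p * Real.log a) / p + Real.log a := by
          field_simp; ring
        rw [h3]
        have h4 : (p * Real.log ‖f z‖ - p * Real.log a) / p ≤ (‖f z‖ ^ p / a ^ p - 1) / p := by
          gcongr
        have h5 : (‖f z‖ ^ p / a ^ p - 1) / p = (‖f z‖ ^ p / a ^ p) / p - 1 / p := by ring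
        linarith
  have hI2 : CircleIntegrable (fun z => (p * a ^ p)⁻¹ • ‖f z‖ ^ p) c R := hcI.const_smul
  rw [circleAverage_fun_add hI2 (circleIntegrable_const _ _ _), circleAverage_fun_smul,
    circleAverage_const, smul_eq_mul] at hmono
  have h6 := hJ.trans hmono
  have h7 : 1 / p ≤ (p * a ^ p)⁻¹ * circleAverage (fun z => ‖f z‖ ^ p) c R := by linarith
  have hap : 0 < a ^ p := by positivity
  rw [inv_mul_eq_div, div_le_div_iff₀ hp (by positivity)] at h7
  nlinarith

lemma lint_complex {F : ℂ → ℝ≥0∞} (hF : Measurable F) :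
    ∫⁻ z, F z = ∫⁻ y : ℝ, ∫⁻ x : ℝ, F (x + y * I) := by
  rw [← (volume_preserving_equiv_real_prod.symm).lintegral_comp_emb
    measurableEquivRealProd.symm.measurableEmbedding]
  rw [Measure.volume_eq_prod, lintegral_prod_symm _ (by
    exact (hF.comp measurableEquivRealProd.symm.measurable).aemeasurable)]
  refine lintegral_congr fun y => lintegral_congr fun x => ?_
  congr 1
  apply Complex.ext <;> simp [measurableEquivRealProd_symm_apply]

lemma disc_submean {f : ℂ → ℂ} {c : ℂ} {R p : ℝ} (hR : 0 < R) (hp : 0 < p)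
    (hf : AnalyticOnNhd ℂ f (Metric.closedBall c R)) :
    ‖f c‖ₑ ^ p * ENNReal.ofReal (π * R ^ 2) ≤ ∫⁻ z in Metric.ball c R, ‖f z‖ₑ ^ p := by
  classical
  set g : ℂ → ℂ := (Metric.ball c R).indicator f with hg
  have hgm : Measurable g := by
    rw [hg, ← Set.piecewise_eq_indicator]
    exact (hf.continuousOn.mono Metric.ball_subset_closedBall).measurable_piecewise
      continuousOn_const measurableSet_ball
  have e1 : ∫⁻ z in Metric.ball c R, ‖f z‖ₑ ^ p = ∫⁻ z, ‖g (c + z)‖ₑ ^ p := by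
    rw [lintegral_add_left_eq_self (fun z => ‖g z‖ₑ ^ p) c, ← lintegral_indicator measurableSet_ball]
    refine lintegral_congr fun z => ?_
    by_cases hz : z ∈ Metric.ball c R
    · simp [hg, hz]
    · simp [hg, hz, hp]
  rw [e1, ← Complex.lintegral_comp_polarCoord_symm, polarCoord_target, Measure.volume_eq_prod,
    ← Measure.prod_restrict, lintegral_prod _ (by
      apply Measurable.aemeasurable
      simp only [smul_eq_mul]
      apply Measurable.mul
      · fun_prop
      · refine (Measurable.enorm (hgm.comp ?_)).pow_const p
        refine measurable_const.add ?_
        have : (Complex.polarCoord.symm : ℝ × ℝ → ℂ) =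
          fun x : ℝ × ℝ => (x.1 * (Real.cos x.2 + Real.sin x.2 * I) : ℂ) := by
          funext x; rw [Complex.polarCoord_symm_apply]
        rw [this]
        fun_prop)]
  have hin : ∀ r ∈ Ioo 0 R, ENNReal.ofReal r * (ENNReal.ofReal (2 * π) * ‖f c‖ₑ ^ p) ≤
      ∫⁻ θ in Ioo (-π) π, ENNReal.ofReal r • ‖g (c + Complex.polarCoord.symm (r, θ))‖ₑ ^ p := by
    intro r hr
    have hsub : Metric.closedBall c r ⊆ Metric.ball c R := Metric.closedBall_subset_ball hr.2
    have hcont : ContinuousOn f (Metric.closedBall c r) :=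
      hf.continuousOn.mono (hsub.trans Metric.ball_subset_closedBall)
    have hmem : ∀ θ : ℝ, circleMap c r θ ∈ Metric.closedBall c r := fun θ =>
      circleMap_mem_closedBall c hr.1.le θ
    have h1 : ∀ θ : ℝ, ENNReal.ofReal r • ‖g (c + Complex.polarCoord.symm (r, θ))‖ₑ ^ p
        = ENNReal.ofReal r * ENNReal.ofReal (‖f (circleMap c r θ)‖ ^ p) := by
      intro θ
      have : c + Complex.polarCoord.symm (r, θ) = circleMap c r θ := by
        rw [Complex.polarCoord_symm_apply, circleMap]
        simp [Complex.exp_mul_I]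
      rw [this, hg, indicator_of_mem (hsub (hmem θ)), smul_eq_mul,
        ← ENNReal.ofReal_rpow_of_nonneg (norm_nonneg _) hp.le, ofReal_norm]
    simp_rw [h1]
    have hcm : Continuous (fun θ : ℝ => ‖f (circleMap c r θ)‖ ^ p) := by
      refine Continuous.rpow_const ?_ (fun _ => Or.inr hp.le)
      exact (hcont.comp_continuous (continuous_circleMap c r) hmem).norm
    rw [lintegral_const_mul _ hcm.measurable.ennreal_ofReal]
    gcongr
    rw [← ofReal_integral_eq_lintegral_ofReal]
    · have h2 := circle_submean hr.1 hp (hf.mono (hsub.trans Metric.ball_subset_closedBall))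
      rw [circleAverage_eq_integral_add (-π),
        intervalIntegral.integral_comp_add_right (fun θ => ‖f (circleMap c r θ)‖ ^ p)] at h2
      rw [← ofReal_norm, ENNReal.ofReal_rpow_of_nonneg (norm_nonneg _) hp.le,
        ← ENNReal.ofReal_mul (by positivity)]
      apply ENNReal.ofReal_le_ofReal
      rw [← integral_Ioc_eq_integral_Ioo, ← intervalIntegral.integral_of_le (by linarith [pi_pos])]
      rw [smul_eq_mul, inv_mul_eq_div, le_div_iff₀ (by positivity)] at h2
      have e : (0 + -π) = -π := by ring
      have e' : (2 * π + -π) = π := by ring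
      rw [e, e'] at h2
      linarith
    · exact (hcm.integrableOn_Icc).mono_set Ioo_subset_Icc_self
    · filter_upwards with θ; positivity
  calc ‖f c‖ₑ ^ p * ENNReal.ofReal (π * R ^ 2)
      = ∫⁻ r in Ioo 0 R, ENNReal.ofReal r * (ENNReal.ofReal (2 * π) * ‖f c‖ₑ ^ p) := by
        rw [lintegral_mul_const _ (by fun_prop), ← ofReal_integral_eq_lintegral_ofReal]
        · rw [← integral_Ioc_eq_integral_Ioo, ← intervalIntegral.integral_of_le hR.le, integral_id,
            ← mul_assoc, ← ENNReal.ofReal_mul (by have := sq_nonneg R; linarith), mul_comm]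
          congr 2; ring
        · exact (continuous_id.integrableOn_Icc).mono_set Ioo_subset_Icc_self
        · filter_upwards [ae_restrict_mem measurableSet_Ioo] with r hr using hr.1.le
    _ ≤ ∫⁻ r in Ioo 0 R, ∫⁻ θ in Ioo (-π) π,
          ENNReal.ofReal r • ‖g (c + Complex.polarCoord.symm (r, θ))‖ₑ ^ p :=
        setLIntegral_mono' measurableSet_Ioo hin
    _ ≤ _ := lintegral_mono_set Ioo_subset_Ioi_self

/-- Bound of `Hᵖ` quasi-norm. -/
def Hle (p : ℝ) (f : ℂ → ℂ) (M : ℝ≥0∞) : Prop :=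
  ∀ y : ℝ, 0 < y → ∫⁻ x : ℝ, ‖f (x + y * I)‖ₑ ^ p ≤ M

abbrev UH : Set ℂ := {z : ℂ | 0 < z.im}

lemma isOpen_UH : IsOpen UH := isOpen_lt continuous_const Complex.continuous_im

lemma measurable_ind {f : ℂ → ℂ} (hd : DifferentiableOn ℂ f UH) : Measurable (UH.indicator f) := by
  classical
  rw [← Set.piecewise_eq_indicator]
  exact hd.continuousOn.measurable_piecewise continuousOn_const isOpen_UH.measurableSet

lemma pt_bound {f : ℂ → ℂ} {p : ℝ} {M : ℝ≥0∞} (hp : 0 < p) (hd : DifferentiableOn ℂ f UH)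
    (hM : Hle p f M) {z : ℂ} (hz : 0 < z.im) :
    ‖f z‖ₑ ^ p ≤ ENNReal.ofReal (4 / (π * z.im)) * M := by
  set y := z.im with hy
  have hsub : Metric.closedBall z (y / 2) ⊆ {w : ℂ | y / 2 ≤ w.im ∧ w.im ≤ 3 * y / 2} := by
    intro w hw
    rw [Metric.mem_closedBall, Complex.dist_eq] at hw
    have h1 := abs_le.1 ((Complex.abs_im_le_norm (w - z)).trans hw)
    rw [sub_im, ← hy] at h1
    constructor <;> linarith [h1.1, h1.2]
  have han : AnalyticOnNhd ℂ f (Metric.closedBall z (y / 2)) := by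
    refine (hd.analyticOnNhd isOpen_UH).mono (fun w hw => ?_)
    have := (hsub hw).1
    show 0 < w.im
    linarith
  have h1 := disc_submean (by linarith : 0 < y / 2) hp han
  have h2 : ∫⁻ w in Metric.ball z (y / 2), ‖f w‖ₑ ^ p ≤ ENNReal.ofReal y * M := by
    have hS : MeasurableSet {w : ℂ | y / 2 ≤ w.im ∧ w.im ≤ 3 * y / 2} :=
      (measurableSet_le measurable_const Complex.measurable_im).inter
        (measurableSet_le Complex.measurable_im measurable_const)
    have hm : Measurable (fun w : ℂ => ({w : ℂ | y / 2 ≤ w.im ∧ w.im ≤ 3 * y / 2}).indicator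
        (fun w => ‖UH.indicator f w‖ₑ ^ p) w) :=
      (((measurable_ind hd).enorm).pow_const p).indicator hS
    calc ∫⁻ w in Metric.ball z (y / 2), ‖f w‖ₑ ^ p
        ≤ ∫⁻ w in {w : ℂ | y / 2 ≤ w.im ∧ w.im ≤ 3 * y / 2}, ‖f w‖ₑ ^ p :=
          lintegral_mono_set (Metric.ball_subset_closedBall.trans hsub)
      _ = ∫⁻ w, ({w : ℂ | y / 2 ≤ w.im ∧ w.im ≤ 3 * y / 2}).indicator
            (fun w => ‖UH.indicator f w‖ₑ ^ p) w := by
          rw [← lintegral_indicator hS]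
          refine lintegral_congr fun w => ?_
          by_cases hw : w ∈ {w : ℂ | y / 2 ≤ w.im ∧ w.im ≤ 3 * y / 2}
          · have : w ∈ UH := by
              have := hw.1
              show 0 < w.im; linarith
            simp only [indicator_of_mem hw, indicator_of_mem this]
          · simp only [indicator_of_notMem hw]
      _ = ∫⁻ v : ℝ, ∫⁻ x : ℝ, ({w : ℂ | y / 2 ≤ w.im ∧ w.im ≤ 3 * y / 2}).indicator
            (fun w => ‖UH.indicator f w‖ₑ ^ p) (x + v * I) := lint_complex hm
      _ ≤ ∫⁻ v : ℝ, (Icc (y / 2) (3 * y / 2)).indicator (fun _ => M) v := by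
          refine lintegral_mono fun v => ?_
          by_cases hv : v ∈ Icc (y / 2) (3 * y / 2)
          · rw [indicator_of_mem hv]
            have hv0 : 0 < v := by linarith [hv.1]
            refine le_trans (lintegral_mono fun x => ?_) (hM v hv0)
            have h3 : (x : ℂ) + v * I ∈ {w : ℂ | y / 2 ≤ w.im ∧ w.im ≤ 3 * y / 2} := by
              simpa using hv
            have h4 : (x : ℂ) + v * I ∈ UH := by simpa using hv0
            rw [indicator_of_mem h3, indicator_of_mem h4]
          · rw [indicator_of_notMem hv]
            refine le_of_eq ?_
            rw [lintegral_eq_zero_iff' ]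
            · filter_upwards with x
              have h3 : (x : ℂ) + v * I ∉ {w : ℂ | y / 2 ≤ w.im ∧ w.im ≤ 3 * y / 2} := by
                simpa using hv
              rw [indicator_of_notMem h3]; rfl
            · exact (hm.comp (by fun_prop : Measurable (fun x : ℝ => (x : ℂ) + v * I))).aemeasurable
      _ = ENNReal.ofReal y * M := by
          rw [lintegral_indicator measurableSet_Icc, setLIntegral_const, Real.volume_Icc, mul_comm]
          congr 2; ring
  have h3 := h1.trans h2
  have hpos : 0 < π * (y / 2) ^ 2 := by positivity
  have h4 : ‖f z‖ₑ ^ p = ‖f z‖ₑ ^ p * ENNReal.ofReal (π * (y / 2) ^ 2) * ENNReal.ofReal ((π * (y / 2) ^ 2)⁻¹) := by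
    rw [mul_assoc, ← ENNReal.ofReal_mul hpos.le, mul_inv_cancel₀ hpos.ne', ENNReal.ofReal_one, mul_one]
  rw [h4]
  calc _ ≤ ENNReal.ofReal y * M * ENNReal.ofReal ((π * (y / 2) ^ 2)⁻¹) := by gcongr
    _ = ENNReal.ofReal (4 / (π * y)) * M := by
      rw [mul_right_comm, ← ENNReal.ofReal_mul hz.le]
      congr 2; field_simp; norm_num

lemma bdd_of_Hle {f : ℂ → ℂ} {p : ℝ} {M : ℝ≥0∞} (hp : 0 < p) (hd : DifferentiableOn ℂ f UH)
    (hM : Hle p f M) (hMt : M ≠ ⊤) (a : ℝ) (ha : 0 < a) : ∃ K, ∀ z : ℂ, a ≤ z.im → ‖f z‖ ≤ K := by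
  set B : ℝ≥0∞ := (ENNReal.ofReal (4 / (π * a)) * M) ^ (1 / p) with hB
  have hBt : B ≠ ⊤ := by
    apply ENNReal.rpow_ne_top_of_nonneg (by positivity)
    exact ENNReal.mul_ne_top ENNReal.ofReal_ne_top hMt
  refine ⟨B.toReal, fun z hz => ?_⟩
  have h1 := pt_bound hp hd hM (lt_of_lt_of_le ha hz)
  have h2 : ‖f z‖ₑ ^ p ≤ ENNReal.ofReal (4 / (π * a)) * M := by
    refine h1.trans ?_
    gcongr
  have h3 : ‖f z‖ₑ ≤ B := by
    rw [hB, one_div, ENNReal.le_rpow_inv_iff hp]; exact h2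
  rw [← toReal_enorm]
  exact ENNReal.toReal_mono hBt h3

end HardyEnv

open MeasureTheory Real Complex
open scoped ENNReal NNReal

namespace HardyEnv
open Filter Topology Set

/-- Poisson integral of a nonnegative function. -/
noncomputable def PE (y : ℝ) (h : ℝ → ℝ≥0∞) (x : ℝ) : ℝ≥0∞ :=
  ∫⁻ t, ENNReal.ofReal (pk y (x - t)) * h t

lemma meas_pk {y : ℝ} (hy : 0 < y) : Measurable (fun s => ENNReal.ofReal (pk y s)) :=
  (continuous_pk hy).measurable.ennreal_ofReal

lemma meas_pk_sub {y : ℝ} (hy : 0 < y) (x : ℝ) : Measurable (fun t => ENNReal.ofReal (pk y (x - t))) :=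
  (meas_pk hy).comp (measurable_const.sub measurable_id)

lemma PE_rpow_le {y : ℝ} (hy : 0 < y) {h : ℝ → ℝ≥0∞} (hm : Measurable h) {q : ℝ} (hq : 1 ≤ q) (x : ℝ) :
    (PE y h x) ^ q ≤ PE y (fun t => h t ^ q) x := by
  have hq0 : 0 < q := by linarith
  have hq1 : q⁻¹ ≤ 1 := inv_le_one_of_one_le₀ hq
  have h1 := ENNReal.lintegral_mul_norm_pow_le (μ := volume)
    (f := fun t => ENNReal.ofReal (pk y (x - t)))
    (g := fun t => ENNReal.ofReal (pk y (x - t)) * h t ^ q)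
    (meas_pk_sub hy x).aemeasurable ((meas_pk_sub hy x).mul (hm.pow_const q)).aemeasurable
    (p := 1 - q⁻¹) (q := q⁻¹) (by linarith) (by positivity) (by ring)
  rw [lintegral_pk_sub hy, ENNReal.one_rpow, one_mul] at h1
  have h2 : PE y h x ≤ (PE y (fun t => h t ^ q) x) ^ q⁻¹ := by
    refine le_trans (le_of_eq ?_) h1
    refine lintegral_congr fun t => ?_
    rw [ENNReal.mul_rpow_of_nonneg _ _ (by positivity), ← mul_assoc,
      ← ENNReal.rpow_add_of_nonneg _ _ (by linarith) (by positivity), ← ENNReal.rpow_mul,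
      mul_inv_cancel₀ hq0.ne', ENNReal.rpow_one]
    simp
  rwa [ENNReal.le_rpow_inv_iff hq0] at h2

lemma meas_PE_aux {y : ℝ} (hy : 0 < y) {h : ℝ → ℝ≥0∞} (hm : Measurable h) :
    Measurable (fun z : ℝ × ℝ => ENNReal.ofReal (pk y (z.1 - z.2)) * h z.2) :=
  ((meas_pk hy).comp (measurable_fst.sub measurable_snd)).mul (hm.comp measurable_snd)

lemma lintegral_PE {y : ℝ} (hy : 0 < y) {h : ℝ → ℝ≥0∞} (hm : Measurable h) :
    ∫⁻ x, PE y h x = ∫⁻ t, h t := by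
  unfold PE
  rw [lintegral_lintegral_swap (meas_PE_aux hy hm).aemeasurable]
  refine lintegral_congr fun t => ?_
  rw [lintegral_mul_const _ (by exact (meas_pk hy).comp (measurable_id.sub measurable_const)),
    lintegral_pk_sub' hy, one_mul]

lemma lintegral_PE_rpow_le {y : ℝ} (hy : 0 < y) {h : ℝ → ℝ≥0∞} (hm : Measurable h) {q : ℝ} (hq : 1 ≤ q) :
    ∫⁻ x, (PE y h x) ^ q ≤ ∫⁻ t, h t ^ q := by
  rw [← lintegral_PE hy (hm.pow_const q)]
  exact lintegral_mono fun x => PE_rpow_le hy hm hq x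

lemma PE_le {y : ℝ} (hy : 0 < y) {h : ℝ → ℝ≥0∞} (x : ℝ) :
    PE y h x ≤ ENNReal.ofReal (1 / y) * ∫⁻ t, h t := by
  rw [← lintegral_const_mul' _ _ ENNReal.ofReal_ne_top]
  refine lintegral_mono fun t => ?_
  gcongr
  exact pk_le hy _

lemma meas_PE {y : ℝ} (hy : 0 < y) {h : ℝ → ℝ≥0∞} (hm : Measurable h) : Measurable (PE y h) :=
  (meas_PE_aux hy hm).lintegral_prod_right'

lemma lint_rpow_low {b T : ℝ} (hb : -1 < b) (hT : 0 ≤ T) :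
    ∫⁻ y in Ioc 0 T, ENNReal.ofReal (y ^ b) = ENNReal.ofReal (T ^ (b + 1) / (b + 1)) := by
  rw [← ofReal_integral_eq_lintegral_ofReal]
  · rw [← intervalIntegral.integral_of_le hT, integral_rpow (Or.inl hb),
      Real.zero_rpow (by linarith), sub_zero]
  · exact (intervalIntegrable_iff_integrableOn_Ioc_of_le hT).1 (intervalIntegral.intervalIntegrable_rpow' hb)
  · filter_upwards [ae_restrict_mem measurableSet_Ioc] with y hy
    exact Real.rpow_nonneg hy.1.le _

lemma lint_rpow_high {b T : ℝ} (hb : b < -1) (hT : 0 < T) :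
    ∫⁻ y in Ioi T, ENNReal.ofReal (y ^ b) = ENNReal.ofReal (-T ^ (b + 1) / (b + 1)) := by
  rw [← ofReal_integral_eq_lintegral_ofReal (integrableOn_Ioi_rpow_of_lt hb hT),
    integral_Ioi_rpow_of_lt hb hT]
  filter_upwards [ae_restrict_mem measurableSet_Ioi] with y hy
  exact Real.rpow_nonneg (hT.trans hy).le _

lemma upper_aux {q : ℝ} (hq : 2 < q) {u : ℝ → ℝ} (hu : Measurable u) (hu0 : ∀ t, 0 ≤ u t)
    (h1 : ∫⁻ t, ENNReal.ofReal (u t) ^ (2:ℝ) ≤ 1) :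
    ∫⁻ y in Ioi (0:ℝ), (∫⁻ x, (PE y (fun t => ENNReal.ofReal (u t)) x) ^ q) *
      ENNReal.ofReal (y ^ (q / 2 - 2)) ≤ 2 ^ (q - 1) * ENNReal.ofReal (1 / (q / 2 - 1) + 2) := by
  set E : ℝ → ℝ≥0∞ := fun t => ENNReal.ofReal (u t) with hE
  have hEm : Measurable E := hu.ennreal_ofReal
  set S : Set (ℝ × ℝ) := {z | u z.2 ^ 2 * z.1 ≤ 1} with hS
  have hSm : MeasurableSet S :=
    measurableSet_le (((hu.comp measurable_snd).pow_const 2).mul measurable_fst) measurable_const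
  set A : ℝ → ℝ → ℝ≥0∞ := fun y t => S.indicator (fun z => E z.2) (y, t) with hA
  set D : ℝ → ℝ → ℝ≥0∞ := fun y t => Sᶜ.indicator (fun z => E z.2) (y, t) with hD
  have hA2 : Measurable (Function.uncurry A) := (hEm.comp measurable_snd).indicator hSm
  have hD2 : Measurable (Function.uncurry D) := (hEm.comp measurable_snd).indicator hSm.compl
  have hAm : ∀ y, Measurable (A y) := fun y => hA2.comp (measurable_const.prodMk measurable_id)
  have hDm : ∀ y, Measurable (D y) := fun y => hD2.comp (measurable_const.prodMk measurable_id)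
  have hsum : ∀ y t, E t = A y t + D y t := by
    intro y t
    by_cases h : (y, t) ∈ S <;> simp [hA, hD, h]
  have hsup : ∀ y : ℝ, 0 < y → ∀ x, PE y (D y) x ≤ ENNReal.ofReal (y ^ (-(1/2) : ℝ)) := by
    intro y hy x
    have e1 : PE y (D y) x ≤ PE y E x := by
      unfold PE
      refine lintegral_mono fun t => ?_
      have := hsum y t
      gcongr
      rw [this]; exact le_add_self
    refine e1.trans ?_
    have e2 : (PE y E x) ^ (2:ℝ) ≤ ENNReal.ofReal (1 / y) := by
      refine (PE_rpow_le hy hEm (by norm_num) x).trans ((PE_le hy x).trans ?_)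
      calc _ ≤ ENNReal.ofReal (1 / y) * 1 := by gcongr
        _ = _ := mul_one _
    have e3 : ENNReal.ofReal (y ^ (-(1/2) : ℝ)) = (ENNReal.ofReal (1 / y)) ^ ((2:ℝ)⁻¹) := by
      rw [ENNReal.ofReal_rpow_of_pos (by positivity)]
      congr 1
      rw [Real.rpow_neg hy.le, one_div y, Real.inv_rpow hy.le]; norm_num
    rw [e3, ENNReal.le_rpow_inv_iff (by norm_num)]
    exact e2
  have hpt : ∀ y ∈ Ioi (0:ℝ), (∫⁻ x, (PE y E x) ^ q) * ENNReal.ofReal (y ^ (q / 2 - 2)) ≤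
      2 ^ (q - 1) * ∫⁻ t, (A y t ^ q * ENNReal.ofReal (y ^ (q / 2 - 2)) +
        D y t * ENNReal.ofReal (y ^ (-(3/2) : ℝ))) := by
    intro y hy
    have hy : 0 < y := hy
    have e0 : ∀ x, PE y E x = PE y (A y) x + PE y (D y) x := by
      intro x
      unfold PE
      rw [← lintegral_add_left (by exact (meas_pk_sub hy x).mul (hAm y))]
      refine lintegral_congr fun t => ?_
      rw [hsum y t, mul_add]
    have e1 : ∫⁻ x, (PE y E x) ^ q ≤ 2 ^ (q - 1) * (∫⁻ t, A y t ^ q +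
        ENNReal.ofReal (y ^ (-((q-1)/2) : ℝ)) * D y t) := by
      rw [lintegral_add_left ((hAm y).pow_const q), lintegral_const_mul _ (hDm y)]
      calc ∫⁻ x, (PE y E x) ^ q ≤ ∫⁻ x, 2 ^ (q - 1) * (PE y (A y) x ^ q +
            ENNReal.ofReal (y ^ (-((q-1)/2) : ℝ)) * PE y (D y) x) := by
            refine lintegral_mono fun x => ?_
            rw [e0]
            refine (ENNReal.rpow_add_le_mul_rpow_add_rpow _ _ (by linarith)).trans ?_
            gcongr
            have : PE y (D y) x ^ q = PE y (D y) x ^ (q - 1) * PE y (D y) x := by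
              nth_rewrite 3 [← ENNReal.rpow_one (PE y (D y) x)]
              rw [← ENNReal.rpow_add_of_nonneg _ _ (by linarith) (by norm_num)]
              congr 1; ring
            rw [this]
            gcongr
            refine (ENNReal.rpow_le_rpow (hsup y hy x) (by linarith : 0 ≤ q - 1)).trans (le_of_eq ?_)
            rw [ENNReal.ofReal_rpow_of_pos (by positivity), ← Real.rpow_mul hy.le]
            congr 2; ring
        _ = 2 ^ (q - 1) * ((∫⁻ x, PE y (A y) x ^ q) +
            ENNReal.ofReal (y ^ (-((q-1)/2) : ℝ)) * ∫⁻ x, PE y (D y) x) := by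
            rw [lintegral_const_mul, lintegral_add_left ((meas_PE hy (hAm y)).pow_const q),
              lintegral_const_mul _ (meas_PE hy (hDm y))]
            exact ((meas_PE hy (hAm y)).pow_const q).add ((meas_PE hy (hDm y)).const_mul _)
        _ ≤ _ := by
            rw [lintegral_PE hy (hDm y)]
            have := lintegral_PE_rpow_le hy (hAm y) (q := q) (by linarith)
            gcongr 2 ^ (q - 1) * (?_ + _)
    calc _ ≤ 2 ^ (q - 1) * (∫⁻ t, A y t ^ q +
        ENNReal.ofReal (y ^ (-((q-1)/2) : ℝ)) * D y t) * ENNReal.ofReal (y ^ (q / 2 - 2)) := by gcongr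
      _ = _ := by
        rw [mul_assoc, ← lintegral_mul_const' _ _ ENNReal.ofReal_ne_top]
        congr 1
        refine lintegral_congr fun t => ?_
        rw [add_mul]
        congr 1
        rw [mul_right_comm, ← ENNReal.ofReal_mul (by positivity), ← Real.rpow_add hy, mul_comm]
        congr 3; ring
  have hfin : ∀ t, ∫⁻ y in Ioi (0:ℝ), (A y t ^ q * ENNReal.ofReal (y ^ (q / 2 - 2)) +
        D y t * ENNReal.ofReal (y ^ (-(3/2) : ℝ))) ≤
        ENNReal.ofReal (1 / (q / 2 - 1) + 2) * E t ^ (2:ℝ) := by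
    intro t
    by_cases hut : u t = 0
    · have : E t = 0 := by simp [hE, hut]
      have hA0 : ∀ y, A y t = 0 := fun y => by
        have := hsum y t; simp_all
      have hD0 : ∀ y, D y t = 0 := fun y => by
        have := hsum y t; simp_all
      simp [hA0, hD0, ENNReal.zero_rpow_of_pos (by linarith : 0 < q)]
    have hut : 0 < u t := lt_of_le_of_ne (hu0 t) (Ne.symm hut)
    set T : ℝ := (u t ^ 2)⁻¹ with hT
    have hT0 : 0 < T := by positivity
    have hmem : ∀ y, (y, t) ∈ S ↔ y ≤ T := by
      intro y
      simp only [hS, mem_ofPred_eq, hT]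
      rw [← one_div, le_div_iff₀ (by positivity), mul_comm]
    have hm1 : Measurable (fun y : ℝ => A y t ^ q * ENNReal.ofReal (y ^ (q / 2 - 2))) :=
      ((hA2.comp (measurable_id.prodMk measurable_const)).pow_const q).mul
        (measurable_id.pow_const _).ennreal_ofReal
    rw [lintegral_add_left hm1]
    have i1 : ∫⁻ y in Ioi (0:ℝ), A y t ^ q * ENNReal.ofReal (y ^ (q / 2 - 2)) =
        E t ^ q * ∫⁻ y in Ioc 0 T, ENNReal.ofReal (y ^ (q / 2 - 2)) := by
      rw [← lintegral_const_mul _ (by fun_prop),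
        ← lintegral_indicator measurableSet_Ioi, ← lintegral_indicator measurableSet_Ioc]
      refine lintegral_congr fun y => ?_
      by_cases h0 : 0 < y
      · by_cases h2 : y ≤ T
        · simp [indicator, h0, h2, hA, hmem]
        · simp [indicator, h0, h2, hA, hmem, ENNReal.zero_rpow_of_pos (by linarith : 0 < q)]
      · simp [indicator, h0]
    have i2 : ∫⁻ y in Ioi (0:ℝ), D y t * ENNReal.ofReal (y ^ (-(3/2) : ℝ)) =
        E t * ∫⁻ y in Ioi T, ENNReal.ofReal (y ^ (-(3/2) : ℝ)) := by
      rw [← lintegral_const_mul _ (by fun_prop),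
        ← lintegral_indicator measurableSet_Ioi, ← lintegral_indicator measurableSet_Ioi]
      refine lintegral_congr fun y => ?_
      by_cases h0 : 0 < y
      · by_cases h2 : y ≤ T
        · simp [indicator, h0, h2, hD, hmem, not_lt.2 h2]
        · simp [indicator, h0, h2, hD, hmem, not_le.1 h2]
      · have : ¬ T < y := by linarith
        simp [indicator, h0, this]
    rw [i1, i2, lint_rpow_low (by linarith) hT0.le, lint_rpow_high (by norm_num) hT0]
    simp only [hE]
    rw [ENNReal.ofReal_rpow_of_pos hut, ENNReal.ofReal_rpow_of_pos hut, ← ENNReal.ofReal_mul (by positivity),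
      ← ENNReal.ofReal_mul hut.le, ← ENNReal.ofReal_mul (by
        have : 0 < q / 2 - 1 := by linarith
        positivity), ← ENNReal.ofReal_add]
    · apply ENNReal.ofReal_le_ofReal
      have j1 : T ^ (q / 2 - 2 + 1) = u t ^ (2 - q) := by
        rw [hT, ← Real.rpow_natCast, ← Real.rpow_neg hut.le, ← Real.rpow_mul hut.le]
        congr 1; push_cast; ring
      have j2 : T ^ (-(3/2) + 1 : ℝ) = u t := by
        rw [hT, ← Real.rpow_natCast, ← Real.rpow_neg hut.le, ← Real.rpow_mul hut.le]
        norm_num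
      rw [j1, j2]
      have j3 : u t ^ q * u t ^ (2 - q) = u t ^ (2:ℝ) := by
        rw [← Real.rpow_add hut]; congr 1; ring
      have j4 : u t * u t = u t ^ (2:ℝ) := by rw [Real.rpow_two]; ring
      rw [mul_div_assoc', j3, ← j4]
      apply le_of_eq; ring
    · have : 0 < q / 2 - 2 + 1 := by linarith
      positivity
    · have : (-T ^ (-(3/2) + 1 : ℝ) / (-(3/2) + 1)) = 2 * T ^ (-(3/2) + 1 : ℝ) := by ring
      rw [this]; positivity
  calc _ ≤ ∫⁻ y in Ioi (0:ℝ), 2 ^ (q - 1) * ∫⁻ t, (A y t ^ q * ENNReal.ofReal (y ^ (q / 2 - 2)) +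
        D y t * ENNReal.ofReal (y ^ (-(3/2) : ℝ))) := setLIntegral_mono' measurableSet_Ioi hpt
    _ = 2 ^ (q - 1) * ∫⁻ t, ∫⁻ y in Ioi (0:ℝ), (A y t ^ q * ENNReal.ofReal (y ^ (q / 2 - 2)) +
        D y t * ENNReal.ofReal (y ^ (-(3/2) : ℝ))) := by
      rw [lintegral_const_mul' _ _ (ENNReal.rpow_ne_top_of_nonneg (by linarith) (by norm_num)),
        lintegral_lintegral_swap]
      apply Measurable.aemeasurable
      exact (((hA2).pow_const q).mul (measurable_fst.pow_const _).ennreal_ofReal).add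
        (hD2.mul (measurable_fst.pow_const _).ennreal_ofReal)
    _ ≤ 2 ^ (q - 1) * ∫⁻ t, ENNReal.ofReal (1 / (q / 2 - 1) + 2) * E t ^ (2:ℝ) := by
      gcongr with t
      exact hfin t
    _ ≤ _ := by
      rw [lintegral_const_mul _ (hEm.pow_const _)]
      gcongr
      calc _ ≤ ENNReal.ofReal (1 / (q / 2 - 1) + 2) * 1 := by gcongr
        _ = _ := mul_one _

end HardyEnv

open MeasureTheory Real Complex
open scoped ENNReal NNReal

namespace HardyEnv
open Filter Topology Set

lemma phi_im {ζ : ℂ} (h : ζ ≠ -1) (x y : ℝ) :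
    ((x : ℂ) + y * I * ((1 - ζ) / (1 + ζ))).im = y * ((1 - ‖ζ‖ ^ 2) / ‖1 + ζ‖ ^ 2) := by
  have h1 : (1 + ζ) ≠ 0 := fun h0 => h (by linear_combination h0)
  have h2 : normSq (1 + ζ) ≠ 0 := by rwa [Ne, normSq_eq_zero]
  have h3 : ((1 - ζ) / (1 + ζ)).re = (1 - ‖ζ‖ ^ 2) / ‖1 + ζ‖ ^ 2 := by
    rw [Complex.sq_norm, Complex.sq_norm, div_re]
    rw [← add_div]
    congr 1
    simp [normSq_apply]; ring
  rw [← h3]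
  simp [mul_im, mul_re]

lemma phi_bdry {t : ℝ} (x y : ℝ) :
    ((x : ℂ) + y * I * ((1 - circleMap 0 1 (2 * Real.arctan t)) / (1 + circleMap 0 1 (2 * Real.arctan t))))
      = ((x + y * t : ℝ) : ℂ) := by
  have hc : (1 + (t:ℂ) * I) ≠ 0 := by
    intro h; have := congrArg Complex.re h; simp at this
  have hc' : (1 - (t:ℂ) * I) ≠ 0 := by
    intro h; have := congrArg Complex.re h; simp at this
  have hcos : Real.cos (2 * Real.arctan t) = (1 - t ^ 2) / (1 + t ^ 2) := by
    rw [Real.cos_two_mul, Real.cos_sq_arctan]; field_simp; ring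
  have hsin : Real.sin (2 * Real.arctan t) = 2 * t / (1 + t ^ 2) := by
    rw [Real.sin_two_mul, Real.sin_arctan, Real.cos_arctan]
    have : 0 < 1 + t ^ 2 := by positivity
    have h2 : Real.sqrt (1 + t ^ 2) * Real.sqrt (1 + t ^ 2) = 1 + t ^ 2 := Real.mul_self_sqrt this.le
    have h3 : 0 < Real.sqrt (1 + t ^ 2) := Real.sqrt_pos.2 this
    calc _ = 2 * t / (Real.sqrt (1 + t ^ 2) * Real.sqrt (1 + t ^ 2)) := by field_simp
      _ = _ := by rw [h2]
  have h : circleMap 0 1 (2 * Real.arctan t) = (1 + t * I) / (1 - t * I) := by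
    rw [circleMap, exp_mul_I, ← ofReal_cos, ← ofReal_sin, hcos, hsin]
    have h3 : (1 + (t:ℂ) ^ 2) = (1 + t * I) * (1 - t * I) := by ring_nf; rw [I_sq]; ring
    push_cast
    rw [h3]
    field_simp
    ring_nf
    simp only [I_sq]
    ring
  rw [h]
  have h4 : (1 - (1 + (t:ℂ) * I) / (1 - t * I)) / (1 + (1 + (t:ℂ) * I) / (1 - t * I)) = - (t * I) := by
    have : (1 + (1 + (t:ℂ) * I) / (1 - t * I)) = 2 / (1 - t * I) := by field_simp; ring
    rw [this]; field_simp; ring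
  rw [h4]
  push_cast
  ring_nf; rw [I_sq]; ring

lemma majorant0 {g : ℂ → ℂ} {ε K r : ℝ} (hε : 0 < ε) (hr : 0 < r)
    (hd : DifferentiableOn ℂ g {z | -ε < z.im}) (hK : ∀ z : ℂ, 0 ≤ z.im → ‖g z‖ ≤ K)
    (x y : ℝ) (hy : 0 < y) :
    ‖g (x + y * I)‖ ^ r ≤ ∫ t : ℝ, pk y (x - t) * ‖g t‖ ^ r := by
  have hK0 : 0 ≤ K := (norm_nonneg _).trans (hK 0 (by simp))
  have hopen : IsOpen {z : ℂ | -ε < z.im} := isOpen_lt continuous_const Complex.continuous_im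
  set φ : ℂ → ℂ := fun ζ => (x : ℂ) + y * I * ((1 - ζ) / (1 + ζ)) with hφ
  have hφim : ∀ ζ : ℂ, ‖ζ‖ ≤ 1 → ζ ≠ -1 → 0 ≤ (φ ζ).im := by
    intro ζ h1 h2
    rw [hφ]; simp only
    rw [phi_im h2]
    have : 0 ≤ 1 - ‖ζ‖ ^ 2 := by nlinarith [norm_nonneg ζ]
    positivity
  have hφd : ∀ ζ : ℂ, ζ ≠ -1 → DifferentiableAt ℂ φ ζ := by
    intro ζ h
    have h1 : (1 + ζ) ≠ 0 := fun h0 => h (by linear_combination h0)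
    rw [hφ]; fun_prop (disch := assumption)
  have hgφ : ∀ ζ : ℂ, ‖ζ‖ ≤ 1 → ζ ≠ -1 → DifferentiableAt ℂ (fun ζ => g (φ ζ)) ζ := by
    intro ζ h1 h2
    have h3 := hφim ζ h1 h2
    have : (φ ζ) ∈ {z : ℂ | -ε < z.im} := by show -ε < _; linarith
    exact (hd.differentiableAt (hopen.mem_nhds this)).comp ζ (hφd ζ h2)
  have hne : ∀ ζ : ℂ, ‖ζ‖ < 1 → ζ ≠ -1 := by
    rintro ζ h rfl; simp at h
  set R : ℕ → ℝ := fun n => 1 - 1 / ((n : ℝ) + 2) with hR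
  have hR0 : ∀ n, 0 < R n := by
    intro n
    have : 1 / ((n : ℝ) + 2) < 1 := by
      rw [div_lt_one (by positivity)]; have : (0:ℝ) ≤ n := by positivity
      linarith
    simp only [hR]; linarith
  have hR1 : ∀ n, R n < 1 := by
    intro n
    have : 0 < 1 / ((n : ℝ) + 2) := by positivity
    simp only [hR]; linarith
  have hRlim : Tendsto R atTop (𝓝 1) := by
    have : Tendsto (fun n : ℕ => 1 - 1 / ((n : ℝ) + 2)) atTop (𝓝 (1 - 0)) := by
      refine tendsto_const_nhds.sub ?_
      simp_rw [one_div]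
      exact tendsto_inv_atTop_zero.comp (tendsto_atTop_add_const_right _ _ tendsto_natCast_atTop_atTop)
    rw [sub_zero] at this
    exact this
  have hsub : ∀ n, ‖g (x + y * I)‖ ^ r ≤ (2 * π)⁻¹ * ∫ θ in Ioo (-π) π, ‖g (φ (circleMap 0 (R n) θ))‖ ^ r := by
    intro n
    have h1 := circle_submean (f := fun ζ => g (φ ζ)) (c := 0) (hR0 n) hr (by
      have hdo : DifferentiableOn ℂ (fun ζ => g (φ ζ)) (Metric.ball 0 1) := by
        intro ζ hζ
        rw [mem_ball_zero_iff] at hζ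
        exact (hgφ ζ hζ.le (hne ζ hζ)).differentiableWithinAt
      exact (hdo.analyticOnNhd Metric.isOpen_ball).mono (Metric.closedBall_subset_ball (hR1 n)))
    rw [circleAverage_eq_integral_add (-π),
        intervalIntegral.integral_comp_add_right (fun θ => ‖g (φ (circleMap 0 (R n) θ))‖ ^ r)] at h1
    have e : (0 + -π) = -π := by ring
    have e' : (2 * π + -π) = π := by ring
    rw [e, e', intervalIntegral.integral_of_le (by linarith [pi_pos]), integral_Ioc_eq_integral_Ioo] at h1
    have e3 : φ 0 = x + y * I := by simp [hφ]
    simpa only [e3, smul_eq_mul] using h1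
  have hbd : ∀ ζ : ℂ, ‖ζ‖ ≤ 1 → ζ ≠ -1 → ‖g (φ ζ)‖ ^ r ≤ K ^ r := fun ζ h1 h2 =>
    Real.rpow_le_rpow (norm_nonneg _) (hK _ (hφim ζ h1 h2)) hr.le
  have hcm1 : ∀ θ ∈ Ioo (-π) π, circleMap 0 1 θ ≠ -1 := by
    intro θ hθ h
    rw [circleMap] at h
    have h2 : Complex.exp (θ * I) = -1 := by simpa using h
    have h3 := congrArg Complex.arg h2
    rw [Complex.arg_exp_mul_I, (toIocMod_eq_self Real.two_pi_pos).2 ⟨hθ.1, by linarith [hθ.2]⟩, Complex.arg_neg_one] at h3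
    linarith [hθ.2]
  have hlim : Tendsto (fun n => ∫ θ in Ioo (-π) π, ‖g (φ (circleMap 0 (R n) θ))‖ ^ r) atTop
      (𝓝 (∫ θ in Ioo (-π) π, ‖g (φ (circleMap 0 1 θ))‖ ^ r)) := by
    refine tendsto_integral_of_dominated_convergence (fun _ => K ^ r) ?_ ?_ ?_ ?_
    · intro n
      apply Continuous.aestronglyMeasurable
      refine Continuous.rpow_const (Continuous.norm ?_) (fun _ => Or.inr hr.le)
      rw [continuous_iff_continuousAt]
      intro θ
      have : ‖circleMap 0 (R n) θ‖ < 1 := by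
        rw [norm_circleMap_zero, abs_of_pos (hR0 n)]; exact hR1 n
      exact ContinuousAt.comp (f := circleMap 0 (R n)) (g := fun ζ => g (φ ζ)) (hgφ _ this.le (hne _ this)).continuousAt
        (continuous_circleMap 0 (R n)).continuousAt
    · exact integrable_const _
    · intro n
      filter_upwards with θ
      have : ‖circleMap 0 (R n) θ‖ < 1 := by
        rw [norm_circleMap_zero, abs_of_pos (hR0 n)]; exact hR1 n
      rw [Real.norm_of_nonneg (by positivity)]
      exact hbd _ this.le (hne _ this)
    · filter_upwards [ae_restrict_mem measurableSet_Ioo] with θ hθ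
      have h1 : ContinuousAt (fun ζ => ‖g (φ ζ)‖ ^ r) (circleMap 0 1 θ) :=
        ((hgφ _ (by simp) (hcm1 θ hθ)).continuousAt.norm).rpow_const (Or.inr hr.le)
      refine h1.tendsto.comp ?_
      have : Tendsto (fun n => (0:ℂ) + (R n : ℂ) * Complex.exp (θ * I)) atTop
        (𝓝 (0 + ((1:ℝ):ℂ) * Complex.exp (θ * I))) := by
        refine tendsto_const_nhds.add (Tendsto.mul_const _ ?_)
        exact (continuous_ofReal.tendsto 1).comp hRlim
      exact this
  have hfin := ge_of_tendsto (hlim.const_mul (2 * π)⁻¹) (Eventually.of_forall hsub)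
  refine hfin.trans (le_of_eq ?_)
  have himg : (fun t => 2 * Real.arctan t) '' univ = Ioo (-π) π := by
    ext θ; constructor
    · rintro ⟨t, -, rfl⟩
      have h1 := Real.neg_pi_div_two_lt_arctan t
      have h2 := Real.arctan_lt_pi_div_two t
      constructor <;> simp only <;> linarith
    · intro h
      refine ⟨Real.tan (θ / 2), mem_univ _, ?_⟩
      simp only
      rw [Real.arctan_tan (by linarith [h.1]) (by linarith [h.2])]; ring
  rw [← himg, integral_image_eq_integral_abs_deriv_smul (f' := fun t => 2 * (1 / (1 + t ^ 2))) MeasurableSet.univ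
    (fun t _ => ((Real.hasDerivAt_arctan t).const_mul 2).hasDerivWithinAt)
    (fun a _ b _ h => Real.arctan_injective (by simpa using h))]
  simp only [Measure.restrict_univ]
  have hgt : ∀ t : ℝ, g (φ (circleMap 0 1 (2 * Real.arctan t))) = g ((x + y * t : ℝ) : ℂ) := by
    intro t; rw [hφ]; simp only; rw [phi_bdry]
  simp_rw [hgt]
  have e1 : ∫ t : ℝ, pk y (x - t) * ‖g t‖ ^ r = ∫ t : ℝ, pk y t * ‖g ((x + t : ℝ) : ℂ)‖ ^ r := by
    rw [← integral_add_left_eq_self (fun t : ℝ => pk y (x - t) * ‖g t‖ ^ r) x]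
    congr 1; ext t
    rw [← pk_neg y t]; congr 2; ring
  have e2 : ∫ t : ℝ, pk y t * ‖g ((x + t : ℝ) : ℂ)‖ ^ r = y * ∫ t : ℝ, pk y (y * t) * ‖g ((x + y * t : ℝ) : ℂ)‖ ^ r := by
    rw [Measure.integral_comp_mul_left (fun t => pk y t * ‖g ((x + t : ℝ) : ℂ)‖ ^ r) y, smul_eq_mul, abs_of_pos (by positivity)]
    field_simp
  rw [e1, e2, ← integral_const_mul, ← integral_const_mul]
  congr 1; ext t
  rw [abs_of_nonneg (by positivity), smul_eq_mul, pk_eq hy]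
  field_simp

end HardyEnv

open MeasureTheory Real Complex
open scoped ENNReal NNReal

namespace HardyEnv
open Filter Topology Set

lemma weak_limit {H : Type*} [NormedAddCommGroup H] [InnerProductSpace ℝ H] [CompleteSpace H]
    (v : ℕ → H) (R : ℝ) (hv : ∀ n, ‖v n‖ ≤ R) :
    ∃ w : H, ‖w‖ ≤ R ∧ ∀ k : H, Tendsto (fun n => inner ℝ (v n) k) (hyperfilter ℕ) (𝓝 (inner ℝ w k)) := by
  have hc := WeakDual.isCompact_closedBall (𝕜 := ℝ) (E := H) 0 R
  set φ : ℕ → WeakDual ℝ H := fun n => StrongDual.toWeakDual (InnerProductSpace.toDual ℝ H (v n)) with hφ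
  have hmem : ∀ n, φ n ∈ WeakDual.toStrongDual ⁻¹' Metric.closedBall (0 : StrongDual ℝ H) R := by
    intro n
    rw [mem_preimage, mem_closedBall_zero_iff]
    show ‖InnerProductSpace.toDual ℝ H (v n)‖ ≤ R
    rw [LinearIsometryEquiv.norm_map]; exact hv n
  obtain ⟨ψ, hψ, hlim⟩ := hc.ultrafilter_le_nhds' ((hyperfilter ℕ).map φ)
    (by
      rw [Ultrafilter.mem_map]
      exact Filter.univ_mem' hmem)
  refine ⟨(InnerProductSpace.toDual ℝ H).symm (WeakDual.toStrongDual ψ), ?_, fun k => ?_⟩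
  · rw [LinearIsometryEquiv.norm_map]
    rwa [mem_preimage, mem_closedBall_zero_iff] at hψ
  · have h1 : Tendsto φ (hyperfilter ℕ) (𝓝 ψ) := hlim
    have h2 := ((WeakDual.eval_continuous k).tendsto ψ).comp h1
    rw [InnerProductSpace.toDual_symm_apply]
    refine h2.congr fun n => ?_
    simp [hφ]

lemma memLp_pk {y : ℝ} (hy : 0 < y) (x : ℝ) : MemLp (fun t => pk y (x - t)) 2 volume := by
  have hc : Continuous (fun t => pk y (x - t)) := (continuous_pk hy).comp (by fun_prop)
  rw [memLp_two_iff_integrable_sq hc.aestronglyMeasurable]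
  refine Integrable.mono' ((integrable_pk_sub hy x).const_mul (1 / y)) (hc.pow 2).aestronglyMeasurable ?_
  filter_upwards with t
  rw [Real.norm_of_nonneg (sq_nonneg _), sq]
  exact mul_le_mul_of_nonneg_right (pk_le hy _) (pk_nonneg hy _)

lemma majorant {f : ℂ → ℂ} {p : ℝ} {M : ℝ≥0∞} (hp : 0 < p) (hd : DifferentiableOn ℂ f UH)
    (hM : Hle p f M) (hMt : M ≠ ⊤) :
    ∃ u : ℝ → ℝ, Measurable u ∧ (∀ t, 0 ≤ u t) ∧ (∫⁻ t, ENNReal.ofReal (u t) ^ (2:ℝ) ≤ M) ∧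
      ∀ x y : ℝ, 0 < y → ‖f (x + y * I)‖ ^ (p / 2) ≤ ∫ t, pk y (x - t) * u t := by
  have hε : ∀ n : ℕ, 0 < 1 / ((n:ℝ) + 1) := fun n => by positivity
  set ε : ℕ → ℝ := fun n => 1 / ((n:ℝ) + 1) with hεd
  set un : ℕ → ℝ → ℝ := fun n t => ‖f (t + ε n * I)‖ ^ (p / 2) with hun
  have hr : 0 < p / 2 := by positivity
  have huc : ∀ n, Continuous (un n) := by
    intro n
    refine Continuous.rpow_const (Continuous.norm ?_) (fun _ => Or.inr hr.le)
    refine hd.continuousOn.comp_continuous (by fun_prop) (fun t => ?_)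
    show 0 < ((t:ℂ) + ε n * I).im
    have : ((t:ℂ) + ε n * I).im = ε n := by simp
    rw [this]; exact hε n
  have hsq : ∀ n t, ‖un n t‖ₑ ^ (2:ℝ) = ‖f (t + ε n * I)‖ₑ ^ p := by
    intro n t
    rw [hun]; simp only
    rw [Real.enorm_eq_ofReal (by positivity), ← ENNReal.ofReal_rpow_of_nonneg (norm_nonneg _) hr.le,
      ofReal_norm, ← ENNReal.rpow_mul]
    congr 1; ring
  have hnorm : ∀ n, eLpNorm (un n) 2 volume ≤ M ^ ((2:ℝ)⁻¹) := by
    intro n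
    rw [eLpNorm_eq_lintegral_rpow_enorm_toReal (by norm_num) (by norm_num)]
    simp only [ENNReal.toReal_ofNat, one_div]
    gcongr
    simp_rw [hsq]
    exact hM _ (hε n)
  have hMt' : M ^ ((2:ℝ)⁻¹) ≠ ⊤ := ENNReal.rpow_ne_top_of_nonneg (by norm_num) hMt
  have hmem : ∀ n, MemLp (un n) 2 volume := fun n =>
    ⟨(huc n).aestronglyMeasurable, (hnorm n).trans_lt (lt_top_iff_ne_top.2 hMt')⟩
  obtain ⟨w, hw, hlim⟩ := weak_limit (fun n => (hmem n).toLp (un n)) (M ^ ((2:ℝ)⁻¹)).toReal (by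
    intro n
    rw [Lp.norm_toLp]
    exact ENNReal.toReal_mono hMt' (hnorm n))
  set u : ℝ → ℝ := fun t => |w t| with hu
  have hwm : Measurable w := (Lp.stronglyMeasurable w).measurable
  refine ⟨u, ?_, fun t => abs_nonneg _, ?_, fun x y hy => ?_⟩
  · exact (hwm.norm : Measurable fun t => ‖w t‖)
  · have h1 : eLpNorm w 2 volume ≤ M ^ ((2:ℝ)⁻¹) := by
      rw [Lp.norm_def] at hw
      exact (ENNReal.toReal_le_toReal (Lp.eLpNorm_ne_top w) hMt').1 hw
    rw [eLpNorm_eq_lintegral_rpow_enorm_toReal (by norm_num) (by norm_num)] at h1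
    simp only [ENNReal.toReal_ofNat, one_div] at h1
    rw [ENNReal.rpow_le_rpow_iff (by norm_num)] at h1
    refine le_trans (le_of_eq ?_) h1
    refine lintegral_congr fun t => ?_
    rw [hu]; simp only
    rw [← Real.norm_eq_abs, ofReal_norm]
  · have hk := memLp_pk hy x
    have h1 := hlim (hk.toLp _)
    have inn : ∀ v : Lp ℝ 2 (volume : Measure ℝ), inner ℝ v (hk.toLp _) = ∫ t, pk y (x - t) * v t := by
      intro v
      rw [L2.inner_def]
      refine integral_congr_ae ?_
      filter_upwards [hk.coeFn_toLp] with t ht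
      rw [ht]; simp
    simp_rw [inn] at h1
    have h2 : ∀ n, ‖f (x + (ε n + y : ℝ) * I)‖ ^ (p / 2) ≤ ∫ t, pk y (x - t) * ((hmem n).toLp (un n)) t := by
      intro n
      obtain ⟨K, hK⟩ := bdd_of_Hle hp hd hM hMt (ε n) (hε n)
      have h3 := majorant0 (g := fun z => f (z + ε n * I)) (ε := ε n) (K := K) (hε n) hr (by
        refine hd.comp (by fun_prop) ?_
        intro z hz
        have hz : -ε n < z.im := hz
        show 0 < (z + ε n * I).im
        simp; linarith) (by
        intro z hz
        apply hK
        simpa using hz) x y hy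
      have e : (x : ℂ) + (ε n + y : ℝ) * I = x + y * I + ε n * I := by push_cast; ring
      rw [e]
      refine h3.trans (le_of_eq ?_)
      refine integral_congr_ae ?_
      filter_upwards [(hmem n).coeFn_toLp] with t ht
      rw [ht]
    have h4 : Tendsto (fun n => ‖f (x + (ε n + y : ℝ) * I)‖ ^ (p / 2)) (hyperfilter ℕ)
        (𝓝 (‖f (x + y * I)‖ ^ (p / 2))) := by
      have hz : (x : ℂ) + y * I ∈ UH := by simpa using hy
      have hca : ContinuousAt (fun z => ‖f z‖ ^ (p / 2)) (x + y * I) :=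
        ((hd.differentiableAt (isOpen_UH.mem_nhds hz)).continuousAt.norm).rpow_const (Or.inr hr.le)
      refine hca.tendsto.comp ?_
      have h5 : Tendsto ε atTop (𝓝 0) := tendsto_one_div_add_atTop_nhds_zero_nat
      have h6 : Tendsto (fun n => (x:ℂ) + (ε n + y : ℝ) * I) atTop (𝓝 (x + ((0 + y : ℝ):ℂ) * I)) := by
        refine tendsto_const_nhds.add (Tendsto.mul_const _ ?_)
        exact (continuous_ofReal.tendsto _).comp (h5.add_const y)
      rw [zero_add] at h6
      exact h6.mono_left (Nat.hyperfilter_le_atTop)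
    have h7 := le_of_tendsto_of_tendsto' h4 h1 h2
    refine h7.trans ?_
    have hInteg : ∀ v : ℝ → ℝ, MemLp v 2 volume → Integrable (fun t => pk y (x - t) * v t) := by
      intro v hv
      exact hk.integrable_mul hv
    refine integral_mono (hInteg _ (Lp.memLp w)) (hInteg _ (Lp.memLp w).abs) (fun t => ?_)
    exact mul_le_mul_of_nonneg_left (le_abs_self _) (pk_nonneg hy _)

end HardyEnv

open MeasureTheory Real Complex
open scoped ENNReal NNReal

namespace HardyEnv
open Filter Topology Set
open scoped Pointwise

lemma majorant_PE {f : ℂ → ℂ} {p : ℝ} (hp : 0 < p) {u : ℝ → ℝ} (hum : Measurable u) (hu0 : ∀ t, 0 ≤ u t)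
    (hmaj : ∀ x y : ℝ, 0 < y → ‖f (x + y * I)‖ ^ (p / 2) ≤ ∫ t, pk y (x - t) * u t) (x y : ℝ) (hy : 0 < y) :
    ‖f (x + y * I)‖ₑ ≤ (PE y (fun t => ENNReal.ofReal (u t)) x) ^ (2 / p) := by
  have h1 := hmaj x y hy
  rw [integral_eq_lintegral_of_nonneg_ae (Eventually.of_forall fun t => mul_nonneg (pk_nonneg hy _) (hu0 t))
    (by exact (((continuous_pk hy).measurable.comp (measurable_const.sub measurable_id)).mul hum).aestronglyMeasurable)] at h1
  have h2 := ENNReal.ofReal_le_ofReal h1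
  have h3 := h2.trans ENNReal.ofReal_toReal_le
  rw [← ENNReal.ofReal_rpow_of_nonneg (norm_nonneg _) (by positivity), ofReal_norm] at h3
  have e : (2 / p) = (p / 2)⁻¹ := by rw [inv_div]
  rw [e, ENNReal.le_rpow_inv_iff (by positivity)]
  refine h3.trans (le_of_eq ?_)
  refine lintegral_congr fun t => ?_
  rw [ENNReal.ofReal_mul (pk_nonneg hy _)]

/-- the weighted area integral -/
noncomputable def NA (p : ℝ) (f : ℂ → ℂ) : ℝ≥0∞ :=
  ∫⁻ z in UH, ‖f z‖ₑ * ENNReal.ofReal (z.im ^ (1 / p - 2))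

lemma NA_eq {f : ℂ → ℂ} (p : ℝ) (hd : DifferentiableOn ℂ f UH) :
    NA p f = ∫⁻ y in Ioi (0:ℝ), (∫⁻ x : ℝ, ‖f (x + y * I)‖ₑ) * ENNReal.ofReal (y ^ (1 / p - 2)) := by
  unfold NA
  rw [← lintegral_indicator isOpen_UH.measurableSet]
  have hm : Measurable (fun z => UH.indicator (fun z => ‖UH.indicator f z‖ₑ * ENNReal.ofReal (z.im ^ (1 / p - 2))) z) := by
    refine Measurable.indicator ?_ isOpen_UH.measurableSet
    exact ((measurable_ind hd).enorm).mul (Complex.measurable_im.pow_const _).ennreal_ofReal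
  have e : ∀ z, UH.indicator (fun z => ‖f z‖ₑ * ENNReal.ofReal (z.im ^ (1 / p - 2))) z =
      UH.indicator (fun z => ‖UH.indicator f z‖ₑ * ENNReal.ofReal (z.im ^ (1 / p - 2))) z := by
    intro z
    by_cases hz : z ∈ UH
    · simp only [indicator_of_mem hz]
    · simp only [indicator_of_notMem hz]
  simp_rw [e]
  rw [lint_complex hm, ← lintegral_indicator measurableSet_Ioi]
  refine lintegral_congr fun y => ?_
  by_cases hy : 0 < y
  · rw [indicator_of_mem (by exact hy), ← lintegral_mul_const' _ _ ENNReal.ofReal_ne_top]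
    refine lintegral_congr fun x => ?_
    have hz : (x : ℂ) + y * I ∈ UH := by simpa using hy
    rw [indicator_of_mem hz, indicator_of_mem hz]
    simp
  · rw [indicator_of_notMem (by exact hy)]
    rw [← lintegral_zero (μ := (volume : Measure ℝ))]
    refine lintegral_congr fun x => ?_
    have hz : (x : ℂ) + y * I ∉ UH := by simpa using hy
    rw [indicator_of_notMem hz]

lemma NA_le_of_Hle {p : ℝ} (hp0 : 0 < p) (hp1 : p < 1) {f : ℂ → ℂ} (hd : DifferentiableOn ℂ f UH)
    (hM : Hle p f 1) : NA p f ≤ 2 ^ (2 / p - 1) * ENNReal.ofReal (1 / (2 / p / 2 - 1) + 2) := by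
  obtain ⟨u, hum, hu0, hu2, hmaj⟩ := majorant hp0 hd hM (by norm_num)
  have hq : 2 < 2 / p := by rw [lt_div_iff₀ hp0]; linarith
  refine le_trans ?_ (upper_aux hq hum hu0 hu2)
  rw [NA_eq p hd]
  refine setLIntegral_mono' measurableSet_Ioi fun y hy => ?_
  have e : 2 / p / 2 - 2 = 1 / p - 2 := by ring
  rw [e]
  gcongr with x
  exact majorant_PE hp0 hum hu0 hmaj x y hy

lemma NA_add_le {p : ℝ} {f g : ℂ → ℂ} (hd : DifferentiableOn ℂ f UH) :
    NA p (f + g) ≤ NA p f + NA p g := by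
  unfold NA
  rw [← lintegral_add_left']
  · refine lintegral_mono fun z => ?_
    rw [← add_mul]
    gcongr
    exact enorm_add_le _ _
  · exact (hd.continuousOn.aemeasurable isOpen_UH.measurableSet).enorm.mul
      (Complex.measurable_im.pow_const _).ennreal_ofReal.aemeasurable

lemma NA_smul {p : ℝ} {f : ℂ → ℂ} (r : ℝ) : NA p (r • f) = ‖r‖ₑ * NA p f := by
  unfold NA
  rw [← lintegral_const_mul' _ _ enorm_ne_top]
  refine lintegral_congr fun z => ?_
  rw [Pi.smul_apply, enorm_smul, mul_assoc]

/-- the unit ball -/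
def BB (p : ℝ) : Set (ℂ → ℂ) := {f | DifferentiableOn ℂ f UH ∧ Hle p f 1}

lemma NA_hull {p : ℝ} {C : ℝ≥0∞} (hC : ∀ f ∈ BB p, NA p f ≤ C) :
    ∀ f ∈ convexHull ℝ (BB p), DifferentiableOn ℂ f UH ∧ NA p f ≤ C := by
  have hconv : Convex ℝ {f : ℂ → ℂ | DifferentiableOn ℂ f UH ∧ NA p f ≤ C} := by
    intro f hf g hg a b ha hb hab
    refine ⟨(hf.1.const_smul a).add (hg.1.const_smul b), ?_⟩
    refine (NA_add_le (hf.1.const_smul a)).trans ?_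
    rw [NA_smul, NA_smul, Real.enorm_eq_ofReal ha, Real.enorm_eq_ofReal hb]
    calc _ ≤ ENNReal.ofReal a * C + ENNReal.ofReal b * C := by
          gcongr
          · exact hf.2
          · exact hg.2
      _ = C := by rw [← add_mul, ← ENNReal.ofReal_add ha hb, hab, ENNReal.ofReal_one, one_mul]
  exact fun f hf => convexHull_min (fun g hg => show _ ∧ _ from ⟨hg.1, hC g hg⟩) hconv hf

lemma Hle_smul {p : ℝ} (hp : 0 < p) {f : ℂ → ℂ} {M : ℝ≥0∞} (h : Hle p f M) (c : ℂ) :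
    Hle p (c • f) (‖c‖ₑ ^ p * M) := by
  intro y hy
  have := h y hy
  calc _ = ∫⁻ x : ℝ, ‖c‖ₑ ^ p * ‖f (x + y * I)‖ₑ ^ p := by
        refine lintegral_congr fun x => ?_
        rw [Pi.smul_apply, enorm_smul, ENNReal.mul_rpow_of_nonneg _ _ hp.le]
    _ = ‖c‖ₑ ^ p * ∫⁻ x : ℝ, ‖f (x + y * I)‖ₑ ^ p :=
        lintegral_const_mul' _ _ (ENNReal.rpow_ne_top_of_nonneg hp.le enorm_ne_top)
    _ ≤ _ := by gcongr

lemma Hle.mono {p : ℝ} {f : ℂ → ℂ} {M M' : ℝ≥0∞} (h : Hle p f M) (hM : M ≤ M') : Hle p f M' :=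
  fun y hy => (h y hy).trans hM

lemma mem_smul_BB {p : ℝ} (hp : 0 < p) {f : ℂ → ℂ} (hd : DifferentiableOn ℂ f UH) {r : ℝ} (hr : 0 < r)
    (h : Hle p f (ENNReal.ofReal (r ^ p))) : f ∈ r • BB p := by
  refine ⟨((r⁻¹ : ℝ) : ℂ) • f, ⟨hd.const_smul _, ?_⟩, ?_⟩
  · refine (Hle_smul hp h _).mono ?_
    rw [← ofReal_norm, ENNReal.ofReal_rpow_of_nonneg (norm_nonneg _) hp.le, ← ENNReal.ofReal_mul (by positivity),
      Complex.norm_real, Real.norm_of_nonneg (by positivity), Real.inv_rpow hr.le, inv_mul_cancel₀ (by positivity)]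
    simp
  · ext z
    simp [hr.ne']

lemma mem_smul_BB' {p : ℝ} (hp : 0 < p) {f : ℂ → ℂ} (hd : DifferentiableOn ℂ f UH) {M : ℝ≥0∞} (hM : M ≠ ⊤)
    (h : Hle p f M) : ∃ r : ℝ, 0 < r ∧ f ∈ r • BB p := by
  have hpos : 0 < (M.toReal + 1) := by positivity
  refine ⟨(M.toReal + 1) ^ p⁻¹, by positivity, mem_smul_BB hp hd (by positivity) (h.mono ?_)⟩
  rw [← Real.rpow_mul hpos.le, inv_mul_cancel₀ hp.ne', Real.rpow_one, ← ENNReal.ofReal_toReal hM]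
  apply ENNReal.ofReal_le_ofReal
  rw [ENNReal.toReal_ofReal (by positivity)]; linarith

lemma upper_gauge {p : ℝ} (hp : 0 < p) {C : ℝ} (hC0 : 0 ≤ C) (hC : ∀ f ∈ BB p, NA p f ≤ ENNReal.ofReal C)
    {f : ℂ → ℂ} (hd : DifferentiableOn ℂ f UH) {M : ℝ≥0∞} (hM : M ≠ ⊤)
    (h : Hle p f M) : NA p f ≤ ENNReal.ofReal (C * gauge (convexHull ℝ (BB p)) f) := by
  obtain ⟨r0, hr0, hmem0⟩ := mem_smul_BB' hp hd hM h
  have hne : {r ∈ Ioi (0:ℝ) | f ∈ r • convexHull ℝ (BB p)}.Nonempty :=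
    ⟨r0, hr0, smul_set_mono (subset_convexHull ℝ _) hmem0⟩
  have key : ∀ δ : ℝ, 0 < δ → NA p f ≤ ENNReal.ofReal (C * (gauge (convexHull ℝ (BB p)) f + δ)) := by
    intro δ hδ
    obtain ⟨r, ⟨hr, hfr⟩, hlt⟩ := exists_lt_of_csInf_lt hne (lt_add_of_pos_right (sInf _) hδ)
    obtain ⟨g, hg, rfl⟩ := hfr
    have h1 := (NA_hull hC g hg).2
    simp only
    rw [NA_smul, Real.enorm_eq_ofReal (le_of_lt hr)]
    calc _ ≤ ENNReal.ofReal r * ENNReal.ofReal C := by gcongr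
      _ = ENNReal.ofReal (C * r) := by rw [← ENNReal.ofReal_mul (le_of_lt hr), mul_comm]
      _ ≤ _ := by
        apply ENNReal.ofReal_le_ofReal
        apply mul_le_mul_of_nonneg_left _ hC0
        exact hlt.le
  have hlim : Tendsto (fun δ : ℝ => ENNReal.ofReal (C * (gauge (convexHull ℝ (BB p)) f + δ))) (𝓝[>] 0)
      (𝓝 (ENNReal.ofReal (C * (gauge (convexHull ℝ (BB p)) f + 0)))) := by
    apply Tendsto.mono_left _ nhdsWithin_le_nhds
    have : Continuous (fun δ : ℝ => ENNReal.ofReal (C * (gauge (convexHull ℝ (BB p)) f + δ))) := 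
      ENNReal.continuous_ofReal.comp (by fun_prop)
    exact this.tendsto 0
  rw [add_zero] at hlim
  refine ge_of_tendsto hlim ?_
  filter_upwards [self_mem_nhdsWithin] with δ hδ using key δ hδ

end HardyEnv

open MeasureTheory Real Complex
open scoped ENNReal NNReal

namespace HardyEnv
open Filter Topology Set

/-- Cauchy transform -/
noncomputable def CT (v : ℝ → ℝ) (z : ℂ) : ℂ := ∫ t : ℝ, (π * I : ℂ)⁻¹ * ((t : ℂ) - z)⁻¹ * v t

lemma im_le_norm_sub (t : ℝ) (z : ℂ) : |z.im| ≤ ‖(t : ℂ) - z‖ := by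
  have := Complex.abs_im_le_norm ((t : ℂ) - z)
  simpa using this

lemma sub_ne_zero_UH {z : ℂ} (hz : 0 < z.im) (t : ℝ) : (t : ℂ) - z ≠ 0 := by
  intro h
  have := im_le_norm_sub t z
  rw [h, norm_zero, abs_of_pos hz] at this
  linarith

lemma normsq_sub (t : ℝ) (z : ℂ) : ‖(t : ℂ) - z‖ ^ 2 = (z.re - t) ^ 2 + z.im ^ 2 := by
  rw [Complex.sq_norm, normSq_apply]; simp; ring

lemma normsq_inv (t : ℝ) {z : ℂ} (hz : 0 < z.im) :
    (‖(t : ℂ) - z‖ ^ 2)⁻¹ = π / z.im * pk z.im (z.re - t) := by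
  rw [normsq_sub, pk]; field_simp

lemma cont_ck {z : ℂ} (hz : 0 < z.im) :
    Continuous (fun t : ℝ => (π * I : ℂ)⁻¹ * ((t : ℂ) - z)⁻¹) := by
  refine continuous_const.mul (Continuous.inv₀ (by fun_prop) (fun t => sub_ne_zero_UH hz t))

lemma memLp_ck {z : ℂ} (hz : 0 < z.im) :
    MemLp (fun t : ℝ => (π * I : ℂ)⁻¹ * ((t : ℂ) - z)⁻¹) 2 volume := by
  rw [memLp_two_iff_integrable_sq_norm (cont_ck hz).aestronglyMeasurable]
  have : (fun t : ℝ => ‖(π * I : ℂ)⁻¹ * ((t : ℂ) - z)⁻¹‖ ^ 2) =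
      fun t : ℝ => (π⁻¹ ^ 2 * (π / z.im)) * pk z.im (z.re - t) := by
    ext t
    rw [norm_mul, mul_pow, norm_inv, norm_inv, inv_pow, inv_pow, normsq_inv t hz]
    simp; ring
  rw [this]
  exact (integrable_pk_sub hz _).const_mul _

lemma memLp_ofReal {v : ℝ → ℝ} (hv : MemLp v 2 volume) : MemLp (fun t => (v t : ℂ)) 2 volume := hv.ofReal

lemma int_ck {v : ℝ → ℝ} (hv : MemLp v 2 volume) {z : ℂ} (hz : 0 < z.im) :
    Integrable (fun t : ℝ => (π * I : ℂ)⁻¹ * ((t : ℂ) - z)⁻¹ * v t) :=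
  (memLp_ck hz).integrable_mul (memLp_ofReal hv)

lemma CT_re {v : ℝ → ℝ} (hv : MemLp v 2 volume) {z : ℂ} (hz : 0 < z.im) :
    (CT v z).re = ∫ t, pk z.im (z.re - t) * v t := by
  unfold CT
  rw [← RCLike.re_eq_complex_re, ← integral_re (int_ck hv hz)]
  refine integral_congr_ae (Eventually.of_forall fun t => ?_)
  simp only [RCLike.re_eq_complex_re]
  rw [re_mul_ofReal]
  congr 1
  rw [mul_inv, inv_I, pk]
  have h2 : normSq ((t:ℂ) - z) = (z.re - t) ^ 2 + z.im ^ 2 := by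
    rw [← Complex.sq_norm, normsq_sub]
  have h3 : (π : ℂ)⁻¹ = ((π⁻¹ : ℝ) : ℂ) := by push_cast; rfl
  rw [h3, mul_assoc, re_ofReal_mul]
  congr 1
  simp [h2]

lemma CT_diff {v : ℝ → ℝ} (hv : MemLp v 2 volume) : DifferentiableOn ℂ (CT v) UH := by
  intro z0 hz0
  have hy0 : 0 < z0.im := hz0
  set y0 := z0.im with hy0d
  have hball : ∀ z ∈ Metric.ball z0 (y0 / 2), 0 < z.im ∧ ∀ t : ℝ, ‖(t:ℂ) - z0‖ ≤ 2 * ‖(t:ℂ) - z‖ := by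
    intro z hz
    rw [Metric.mem_ball, Complex.dist_eq] at hz
    constructor
    · have h1 := abs_le.1 (Complex.abs_im_le_norm (z - z0))
      rw [sub_im] at h1
      linarith [h1.1]
    · intro t
      have h1 := im_le_norm_sub t z0
      rw [abs_of_pos hz0] at h1
      have h2 : ‖(t:ℂ) - z0‖ ≤ ‖(t:ℂ) - z‖ + ‖z - z0‖ := by
        have := norm_add_le ((t:ℂ) - z) (z - z0); simpa using this
      linarith
  have := hasDerivAt_integral_of_dominated_loc_of_deriv_le (𝕜 := ℂ) (μ := (volume : Measure ℝ))
    (F := fun z t => (π * I : ℂ)⁻¹ * ((t : ℂ) - z)⁻¹ * v t)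
    (F' := fun z t => (π * I : ℂ)⁻¹ * (((t : ℂ) - z) ^ 2)⁻¹ * v t) (x₀ := z0)
    (bound := fun t => (4 / y0) * (pk y0 (z0.re - t) * |v t|)) (s := Metric.ball z0 (y0 / 2))
    (Metric.ball_mem_nhds _ (by linarith)) ?_ (int_ck hv hz0) ?_ ?_ ?_ ?_
  · exact this.2.differentiableAt.differentiableWithinAt
  · filter_upwards [Metric.ball_mem_nhds z0 (by linarith : 0 < y0 / 2)] with z hz
    exact (int_ck hv (hball z hz).1).aestronglyMeasurable
  · refine ((Continuous.aestronglyMeasurable ?_).mul (memLp_ofReal hv).aestronglyMeasurable)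
    refine continuous_const.mul (Continuous.inv₀ (by fun_prop) (fun t => pow_ne_zero 2 (sub_ne_zero_UH hz0 t)))
  · filter_upwards with t z hz
    obtain ⟨h1, h2⟩ := hball z hz
    have h2 := h2 t
    rw [norm_mul, norm_mul, norm_inv, norm_inv, norm_pow, ← mul_assoc, Complex.norm_real, Real.norm_eq_abs]
    refine mul_le_mul_of_nonneg_right ?_ (abs_nonneg _)
    have h3 : 0 < ‖(t:ℂ) - z0‖ := norm_pos_iff.2 (sub_ne_zero_UH hz0 t)
    have h4 : (‖(t:ℂ) - z‖ ^ 2)⁻¹ ≤ 4 * (‖(t:ℂ) - z0‖ ^ 2)⁻¹ := by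
      have h5 : ‖(t:ℂ) - z0‖ ^ 2 ≤ 4 * ‖(t:ℂ) - z‖ ^ 2 := by nlinarith
      have h6 : 0 < ‖(t:ℂ) - z‖ := norm_pos_iff.2 (sub_ne_zero_UH h1 t)
      rw [← div_eq_mul_inv, inv_eq_one_div, div_le_div_iff₀ (by positivity) (by positivity)]
      linarith
    rw [normsq_inv t hz0] at h4
    have h7 : ‖(π * I : ℂ)‖ = π := by simp [abs_of_pos pi_pos]
    rw [h7]
    calc π⁻¹ * (‖(t:ℂ) - z‖ ^ 2)⁻¹ ≤ π⁻¹ * (4 * (π / z0.im * pk z0.im (z0.re - t))) := by gcongr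
      _ = 4 / y0 * pk y0 (z0.re - t) := by rw [← hy0d]; field_simp
  · exact ((memLp_pk hy0 z0.re).integrable_mul hv.abs).const_mul _
  · filter_upwards with t z hz
    have h1 := (hball z hz).1
    have h2 : HasDerivAt (fun z : ℂ => ((t:ℂ) - z)⁻¹) ((((t : ℂ) - z) ^ 2)⁻¹) z := by
      have h3 : HasDerivAt (fun z : ℂ => (t:ℂ) - z) (-1) z := by
        simpa using (hasDerivAt_id z).const_sub (t:ℂ)
      have := h3.fun_inv (sub_ne_zero_UH h1 t)
      simpa using this
    exact ((h2.const_mul _).mul_const _)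

lemma CT_trunc_bound {v : ℝ → ℝ} (hv : MemLp v 2 volume) {R : ℝ} (hR : 0 ≤ R) (hsupp : ∀ t, R < |t| → v t = 0)
    {y : ℝ} (hy : 0 < y) : ∃ C, 0 ≤ C ∧ ∀ z : ℂ, y ≤ z.im → ‖CT v z‖ ≤ C * (1 + ‖z‖)⁻¹ := by
  have hInteg : Integrable v := by
    have h1 : IntegrableOn v (Icc (-R) R) := by
      have : IsFiniteMeasure (volume.restrict (Icc (-R) R)) := ⟨by simp⟩
      exact (hv.restrict (Icc (-R) R)).integrable (by norm_num)
    rw [← integrable_indicator_iff measurableSet_Icc] at h1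
    refine h1.congr (Eventually.of_forall fun t => ?_)
    by_cases ht : t ∈ Icc (-R) R
    · rw [indicator_of_mem ht]
    · rw [indicator_of_notMem ht, hsupp t]
      by_contra hc
      exact ht (abs_le.1 (not_lt.1 hc))
  refine ⟨π⁻¹ * (1 + (1 + R) / y) * ∫ t, |v t|, by positivity, fun z hz => ?_⟩
  unfold CT
  refine (norm_integral_le_integral_norm _).trans ?_
  have : π⁻¹ * (1 + (1 + R) / y) * (∫ t, |v t|) * (1 + ‖z‖)⁻¹ = ∫ t, (π⁻¹ * (1 + (1 + R) / y) * (1 + ‖z‖)⁻¹) * |v t| := by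
    rw [integral_const_mul]; ring
  rw [this]
  have hz0 : 0 < z.im := by linarith
  refine integral_mono (int_ck hv hz0).norm (hInteg.abs.const_mul _) fun t => ?_
  simp only
  have h7 : ‖(π * I : ℂ)‖ = π := by simp [abs_of_pos pi_pos]
  rw [norm_mul, norm_mul, norm_inv, norm_inv, h7, Complex.norm_real, Real.norm_eq_abs]
  by_cases ht : R < |t|
  · simp [hsupp t ht]
  rw [mul_assoc π⁻¹ (1 + (1 + R) / y)]
  gcongr
  have h1 := im_le_norm_sub t z
  rw [abs_of_pos hz0] at h1
  have h2 := one_add_norm_le (z := z) (w := t) (r := y) hy (by rw [norm_sub_rev]; linarith)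
  rw [norm_sub_rev] at h2
  have h3 : 1 + ‖z‖ ≤ ‖(t:ℂ) - z‖ * (1 + (1 + R) / y) := by
    refine h2.trans ?_
    gcongr
    rw [Complex.norm_real, Real.norm_eq_abs]; exact not_lt.1 ht
  have h4 : 0 < ‖(t:ℂ) - z‖ := norm_pos_iff.2 (sub_ne_zero_UH hz0 t)
  rw [← div_eq_mul_inv, inv_eq_one_div, div_le_div_iff₀ h4 (by positivity)]
  linarith

lemma CT_re_sq_le {v : ℝ → ℝ} (hvm : Measurable v) (hv : MemLp v 2 volume) {y : ℝ} (hy : 0 < y) :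
    ∫⁻ x : ℝ, ENNReal.ofReal ((CT v (x + y * I)).re ^ 2) ≤ ∫⁻ t, ‖v t‖ₑ ^ (2:ℝ) := by
  refine le_trans ?_ (lintegral_PE_rpow_le hy hvm.enorm (by norm_num : (1:ℝ) ≤ 2))
  refine lintegral_mono fun x => ?_
  have hz : 0 < ((x:ℂ) + y * I).im := by simpa using hy
  rw [CT_re hv hz]
  have e1 : ((x:ℂ) + y * I).im = y := by simp
  have e2 : ((x:ℂ) + y * I).re = x := by simp
  rw [e1, e2]
  have h1 : ENNReal.ofReal |∫ t, pk y (x - t) * v t| ≤ PE y (fun t => ‖v t‖ₑ) x := by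
    rw [← Real.norm_eq_abs, ofReal_norm]
    refine (enorm_integral_le_lintegral_enorm _).trans (le_of_eq ?_)
    refine lintegral_congr fun t => ?_
    rw [enorm_mul, Real.enorm_eq_ofReal (pk_nonneg hy _)]
  rw [← sq_abs, ← Real.rpow_two, ← ENNReal.ofReal_rpow_of_nonneg (abs_nonneg _) (by norm_num)]
  gcongr

lemma CT_trunc_H2 {v : ℝ → ℝ} (hvm : Measurable v) (hv : MemLp v 2 volume) {R : ℝ} (hR : 0 ≤ R) (hsupp : ∀ t, R < |t| → v t = 0) :
    Hle 2 (CT v) (2 * ∫⁻ t, ‖v t‖ₑ ^ (2:ℝ)) := by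
  intro y hy
  obtain ⟨C, hC0, hC⟩ := CT_trunc_bound hv hR hsupp hy
  have hd := CT_diff hv
  set Φ : ℂ → ℂ := fun z => CT v (z + y * I) ^ 2 with hΦ
  have hb : ∀ z : ℂ, 0 ≤ z.im → ‖Φ z‖ ≤ (C * (1 + y)) ^ 2 * (1 + ‖z‖ ^ 2)⁻¹ := by
    intro z hz
    have h1 := hC (z + y * I) (by simpa using hz)
    have h2 : 1 + ‖z‖ ≤ (1 + ‖z + y * I‖) * (1 + y) := by
      have : ‖z‖ ≤ ‖z + y * I‖ + y := by
        have := norm_sub_le (z + y * I) (y * I)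
        simpa [abs_of_pos hy] using this
      nlinarith [norm_nonneg (z + y * I)]
    have h3 : ‖CT v (z + y * I)‖ ≤ C * (1 + y) * (1 + ‖z‖)⁻¹ := by
      refine h1.trans ?_
      rw [mul_assoc]
      gcongr
      rw [← div_eq_mul_inv, inv_eq_one_div, div_le_div_iff₀ (by positivity) (by positivity)]
      linarith
    rw [hΦ]; simp only
    rw [norm_pow]
    calc _ ≤ (C * (1 + y) * (1 + ‖z‖)⁻¹) ^ 2 := by gcongr
      _ = (C * (1 + y)) ^ 2 * ((1 + ‖z‖) ^ 2)⁻¹ := by rw [mul_pow, inv_pow]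
      _ ≤ _ := by
        gcongr
        nlinarith [norm_nonneg z]
  have hmaps : ∀ z : ℂ, 0 ≤ z.im → z + y * I ∈ UH := by
    intro z hz
    show 0 < (z + y * I).im
    simp; linarith
  have hdΦ : DifferentiableOn ℂ Φ {z | 0 ≤ z.im} := by
    refine DifferentiableOn.pow ?_ 2
    exact hd.comp (by fun_prop) (fun z hz => hmaps z hz)
  have h0 := contour_zero hdΦ hb
  have hΦc : Continuous (fun x : ℝ => Φ x) :=
    hdΦ.continuousOn.comp_continuous (by fun_prop) (fun x => by simp)
  have hΦi : Integrable (fun x : ℝ => Φ x) := by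
    refine Integrable.mono' (integrable_inv_one_add_sq.const_mul ((C * (1 + y)) ^ 2)) hΦc.aestronglyMeasurable ?_
    filter_upwards with x
    have := hb x (by simp)
    rwa [Complex.norm_real, Real.norm_eq_abs, sq_abs] at this
  have h1 : ∫ x : ℝ, (Φ x).re = 0 := by
    have := integral_re hΦi
    simp only [RCLike.re_eq_complex_re] at this
    rw [this, h0]; simp
  have h2 : ∫ x : ℝ, ‖Φ x‖ = ∫ x : ℝ, 2 * (CT v (x + y * I)).re ^ 2 := by
    rw [← add_zero (∫ x : ℝ, ‖Φ x‖), ← h1, ← integral_add hΦi.norm (by exact hΦi.re)]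
    congr 1; ext x
    simp only [hΦ, norm_pow, Complex.sq_norm, normSq_apply]
    simp [sq]; ring
  have h3 : ∫⁻ x : ℝ, ‖CT v (x + y * I)‖ₑ ^ (2:ℝ) = ENNReal.ofReal (∫ x : ℝ, ‖Φ x‖) := by
    rw [ofReal_integral_norm_eq_lintegral_enorm hΦi]
    refine lintegral_congr fun x => ?_
    rw [ENNReal.rpow_two, hΦ]; simp [enorm_pow]
  rw [h3, h2]
  rw [integral_eq_lintegral_of_nonneg_ae (Eventually.of_forall fun x => by positivity) (by
    have : Continuous fun x : ℝ => CT v (x + y * I) :=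
      hd.continuousOn.comp_continuous (by fun_prop) (fun x => by simpa using hy)
    exact (continuous_const.mul ((Complex.continuous_re.comp this).pow 2)).aestronglyMeasurable)]
  refine le_trans ENNReal.ofReal_toReal_le ?_
  calc _ = ∫⁻ x : ℝ, 2 * ENNReal.ofReal ((CT v (x + y * I)).re ^ 2) := by
        refine lintegral_congr fun x => ?_
        rw [ENNReal.ofReal_mul (by norm_num)]; norm_num
    _ = 2 * ∫⁻ x : ℝ, ENNReal.ofReal ((CT v (x + y * I)).re ^ 2) := lintegral_const_mul' _ _ (by norm_num)
    _ ≤ _ := by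
        have := CT_re_sq_le hvm hv hy
        gcongr 2 * ?_

lemma CT_H2 {v : ℝ → ℝ} (hvm : Measurable v) (hv : MemLp v 2 volume) :
    Hle 2 (CT v) (2 * ∫⁻ t, ‖v t‖ₑ ^ (2:ℝ)) := by
  intro y hy
  set vn : ℕ → ℝ → ℝ := fun n => (Icc (-(n:ℝ)) n).indicator v with hvn
  have hvnm : ∀ n, Measurable (vn n) := fun n => hvm.indicator measurableSet_Icc
  have hvnL : ∀ n, MemLp (vn n) 2 volume := fun n => hv.indicator measurableSet_Icc
  have hle : ∀ n t, ‖vn n t‖ ≤ ‖v t‖ := fun n t => norm_indicator_le_norm_self _ _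
  have hb : ∀ n, ∫⁻ x : ℝ, ‖CT (vn n) (x + y * I)‖ₑ ^ (2:ℝ) ≤ 2 * ∫⁻ t, ‖v t‖ₑ ^ (2:ℝ) := by
    intro n
    refine (CT_trunc_H2 (hvnm n) (hvnL n) (R := n) (by positivity) ?_ y hy).trans ?_
    · intro t ht
      apply indicator_of_notMem
      intro h
      exact absurd (abs_le.2 h) (not_le.2 ht)
    · gcongr with t
      exact enorm_le_iff_norm_le.2 (hle n t)
  have hlim : ∀ x : ℝ, Tendsto (fun n => CT (vn n) (x + y * I)) atTop (𝓝 (CT v (x + y * I))) := by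
    intro x
    have hz : 0 < ((x:ℂ) + y * I).im := by simpa using hy
    refine tendsto_integral_of_dominated_convergence _ (fun n => (int_ck (hvnL n) hz).aestronglyMeasurable)
      (int_ck hv hz).norm (fun n => ?_) ?_
    · filter_upwards with t
      rw [norm_mul, norm_mul _ (v t : ℂ)]
      gcongr
      rw [Complex.norm_real, Complex.norm_real]; exact hle n t
    · filter_upwards with t
      refine tendsto_const_nhds.congr' ?_
      filter_upwards [eventually_ge_atTop ⌈|t|⌉₊] with n hn
      have : t ∈ Icc (-(n:ℝ)) n := abs_le.1 ((Nat.le_ceil _).trans (by exact_mod_cast hn))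
      simp only [hvn, indicator_of_mem this]
  have hmeas : ∀ n, Measurable (fun x : ℝ => ‖CT (vn n) (x + y * I)‖ₑ ^ (2:ℝ)) := by
    intro n
    refine (Measurable.enorm ?_).pow_const _
    apply Continuous.measurable
    exact (CT_diff (hvnL n)).continuousOn.comp_continuous (by fun_prop) (fun x => by simpa using hy)
  calc _ = ∫⁻ x : ℝ, liminf (fun n => ‖CT (vn n) (x + y * I)‖ₑ ^ (2:ℝ)) atTop := by
        refine lintegral_congr fun x => ?_
        exact (((ENNReal.continuous_rpow_const.tendsto _).comp ((continuous_enorm.tendsto _).comp (hlim x))).liminf_eq).symm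
    _ ≤ liminf (fun n => ∫⁻ x : ℝ, ‖CT (vn n) (x + y * I)‖ₑ ^ (2:ℝ)) atTop := lintegral_liminf_le hmeas
    _ ≤ _ := by
        refine liminf_le_of_le (by isBoundedDefault) fun b hb' => ?_
        obtain ⟨n, hn⟩ := hb'.exists
        exact hn.trans (hb n)

end HardyEnv

open MeasureTheory Real Complex
open scoped ENNReal NNReal

namespace HardyEnv
open Filter Topology Set

/-- bounded on each half plane -/
def Bd (h : ℂ → ℂ) : Prop := ∀ a : ℝ, 0 < a → ∃ M, ∀ z : ℂ, a ≤ z.im → ‖h z‖ ≤ M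

lemma line_cont {h : ℂ → ℂ} (hd : DifferentiableOn ℂ h UH) {y : ℝ} (hy : 0 < y) :
    Continuous (fun x : ℝ => h (x + y * I)) :=
  hd.continuousOn.comp_continuous (by fun_prop) (fun x => by simpa using hy)

lemma contr {h : ℂ → ℂ} (hd : DifferentiableOn ℂ h UH) (hb : Bd h) {a b : ℝ} (ha : 0 < a) (hab : a ≤ b) :
    ∫⁻ x : ℝ, ‖h (x + b * I)‖ₑ ^ (2:ℝ) ≤ ∫⁻ x : ℝ, ‖h (x + a * I)‖ₑ ^ (2:ℝ) := by
  rcases hab.eq_or_lt with rfl | hab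
  · rfl
  have hy : 0 < b - a := by linarith
  refine le_trans ?_ (lintegral_PE_rpow_le hy (line_cont hd ha).enorm.measurable (by norm_num : (1:ℝ) ≤ 2))
  refine lintegral_mono fun x => ?_
  have h1 := poisson hd hb x a (b - a) ha hy
  rw [add_sub_cancel] at h1
  rw [h1]
  gcongr
  refine (enorm_integral_le_lintegral_enorm _).trans (le_of_eq ?_)
  refine lintegral_congr fun t => ?_
  rw [enorm_mul, ← ofReal_norm (pk (b - a) (x - t) : ℂ), Complex.norm_real, Real.norm_of_nonneg (pk_nonneg hy _)]

lemma sq_integrable {h : ℂ → ℂ} (hd : DifferentiableOn ℂ h UH) {M : ℝ≥0∞} (hM : Hle 2 h M) (hMt : M ≠ ⊤)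
    {y : ℝ} (hy : 0 < y) : Integrable (fun x : ℝ => ‖h (x + y * I)‖ ^ 2) := by
  refine ⟨((line_cont hd hy).norm.pow 2).aestronglyMeasurable, ?_⟩
  refine lt_of_le_of_lt (le_of_eq ?_) ((hM y hy).trans_lt (lt_top_iff_ne_top.2 hMt))
  refine lintegral_congr fun x => ?_
  rw [enorm_pow, enorm_norm, ENNReal.rpow_two]

lemma ofReal_sq_int {h : ℂ → ℂ} (hd : DifferentiableOn ℂ h UH) {M : ℝ≥0∞} (hM : Hle 2 h M) (hMt : M ≠ ⊤)
    {y : ℝ} (hy : 0 < y) : ∫⁻ x : ℝ, ‖h (x + y * I)‖ₑ ^ (2:ℝ) = ENNReal.ofReal (∫ x : ℝ, ‖h (x + y * I)‖ ^ 2) := by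
  rw [ofReal_integral_eq_lintegral_ofReal (sq_integrable hd hM hMt hy) (Eventually.of_forall fun x => by positivity)]
  refine lintegral_congr fun x => ?_
  rw [← ofReal_norm, ENNReal.rpow_two, ENNReal.ofReal_pow (norm_nonneg _)]

lemma inner_shift {h : ℂ → ℂ} (hd : DifferentiableOn ℂ h UH) {M : ℝ≥0∞} (hM : Hle 2 h M) (hMt : M ≠ ⊤)
    {a d : ℝ} (ha : 0 < a) (hdd : 0 < d) :
    ∫ x : ℝ, h (x + (a + d + d : ℝ) * I) * (starRingEnd ℂ) (h (x + a * I)) =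
      ((∫ x : ℝ, ‖h (x + (a + d : ℝ) * I)‖ ^ 2 : ℝ) : ℂ) := by
  have hb : Bd h := fun a ha => bdd_of_Hle (by norm_num) hd hM hMt a ha
  have hc : 0 < a + d := by linarith
  set F : ℝ → ℝ → ℂ := fun x t => (pk d (x - t) : ℂ) * h (t + (a + d : ℝ) * I) * (starRingEnd ℂ) (h (x + a * I)) with hF
  have i1 : Integrable (fun z : ℝ × ℝ => ‖h (z.2 + (a + d : ℝ) * I)‖ ^ 2 * pk d (z.1 - z.2)) (volume.prod volume) := by
    exact (sq_integrable hd hM hMt hc).convolution_integrand (ContinuousLinearMap.mul ℝ ℝ) (integrable_pk hdd)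
  have i2 : Integrable (fun z : ℝ × ℝ => ‖h (z.1 + a * I)‖ ^ 2 * pk d (z.1 - z.2)) (volume.prod volume) := by
    have : Integrable (fun z : ℝ × ℝ => ‖h (z.2 + a * I)‖ ^ 2 * pk d (z.1 - z.2)) (volume.prod volume) :=
      (sq_integrable hd hM hMt ha).convolution_integrand (ContinuousLinearMap.mul ℝ ℝ) (integrable_pk hdd)
    have := this.swap
    refine this.congr (Eventually.of_forall fun z => ?_)
    simp only [Function.comp, Prod.swap, Prod.fst_swap, Prod.snd_swap]
    rw [pk_sub_comm]
  have hFi : Integrable (Function.uncurry F) (volume.prod volume) := by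
    refine (i1.add i2).mono' ?_ ?_
    · apply Continuous.aestronglyMeasurable
      refine Continuous.mul (Continuous.mul ?_ ?_) ?_
      · exact continuous_ofReal.comp ((continuous_pk hdd).comp (by fun_prop))
      · exact (line_cont hd hc).comp continuous_snd
      · exact Complex.continuous_conj.comp ((line_cont hd ha).comp continuous_fst)
    · refine Eventually.of_forall fun z => ?_
      simp only [Function.uncurry, hF, Pi.add_apply]
      rw [norm_mul, norm_mul, RCLike.norm_conj, Complex.norm_real, Real.norm_of_nonneg (pk_nonneg hdd _), ← add_mul,
        mul_assoc, mul_comm]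
      apply mul_le_mul_of_nonneg_right _ (pk_nonneg hdd _)
      set A := ‖h (z.2 + (a + d : ℝ) * I)‖
      set B := ‖h (z.1 + a * I)‖
      nlinarith [sq_nonneg (A - B), sq_nonneg A, sq_nonneg B]
  calc _ = ∫ x, ∫ t, F x t := by
        congr 1; ext x
        rw [poisson hd hb x (a + d) d hc hdd, ← integral_mul_const]
    _ = ∫ t, ∫ x, F x t := integral_integral_swap hFi
    _ = ∫ t : ℝ, ((‖h (t + (a + d : ℝ) * I)‖ ^ 2 : ℝ) : ℂ) := by
        congr 1; ext t
        have e : ∀ x, F x t = h (t + (a + d : ℝ) * I) * (starRingEnd ℂ) ((pk d (t - x) : ℂ) * h (x + a * I)) := by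
          intro x
          simp only [hF]
          rw [map_mul, conj_ofReal, pk_sub_comm]; ring
        simp_rw [e]
        rw [integral_const_mul, integral_conj, ← poisson hd hb t a d ha hdd, mul_conj, Complex.sq_norm]
    _ = _ := integral_ofReal

lemma shift_small {h : ℂ → ℂ} (hd : DifferentiableOn ℂ h UH) {M : ℝ≥0∞} (hM : Hle 2 h M) (hMt : M ≠ ⊤)
    {η : ℝ} (hη : 0 < η) : ∃ ε0 : ℝ, 0 < ε0 ∧ ∀ ε : ℝ, 0 < ε → ε ≤ ε0 →
      Hle 2 (fun z => h z - h (z + ε * I)) (ENNReal.ofReal η) := by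
  have hb : Bd h := fun a ha => bdd_of_Hle (by norm_num) hd hM hMt a ha
  set N : ℝ → ℝ := fun y => ∫ x : ℝ, ‖h (x + y * I)‖ ^ 2 with hN
  have hN0 : ∀ y, 0 ≤ N y := fun y => integral_nonneg fun x => by positivity
  have hNle : ∀ y, 0 < y → N y ≤ M.toReal := by
    intro y hy
    have h1 := hM y hy
    rw [ofReal_sq_int hd hM hMt hy] at h1
    exact (ENNReal.ofReal_le_iff_le_toReal hMt).1 h1
  have hNanti : ∀ a b, 0 < a → a ≤ b → N b ≤ N a := by
    intro a b ha hab
    have h1 := contr hd hb ha hab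
    rw [ofReal_sq_int hd hM hMt ha, ofReal_sq_int hd hM hMt (ha.trans_le hab)] at h1
    exact (ENNReal.ofReal_le_ofReal_iff (hN0 a)).1 h1
  set S := sSup (N '' Ioi 0) with hS
  have hbdd : BddAbove (N '' Ioi 0) := ⟨M.toReal, by rintro _ ⟨y, hy, rfl⟩; exact hNle y hy⟩
  have hNS : ∀ y, 0 < y → N y ≤ S := fun y hy => le_csSup hbdd ⟨y, hy, rfl⟩
  obtain ⟨_, ⟨ε0, hε0, rfl⟩, hlt⟩ := exists_lt_of_lt_csSup (⟨N 1, 1, by simp, rfl⟩ : (N '' Ioi 0).Nonempty)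
    (by linarith : S - η < S)
  have hε0 : 0 < ε0 := hε0
  refine ⟨ε0, hε0, fun ε hε hεε => ?_⟩
  set k : ℂ → ℂ := fun z => h z - h (z + ε * I) with hk
  have hmaps : ∀ z ∈ UH, z + ε * I ∈ UH := by
    intro z hz
    have hz : 0 < z.im := hz
    show 0 < (z + ε * I).im
    simp; linarith
  have hkd : DifferentiableOn ℂ k UH := hd.sub (hd.comp (by fun_prop) hmaps)
  have hkb : Bd k := by
    intro a ha
    obtain ⟨K, hK⟩ := hb a ha
    refine ⟨K + K, fun z hz => (norm_sub_le _ _).trans (add_le_add (hK z hz) (hK _ ?_))⟩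
    simp; linarith
  have key : ∀ a, 0 < a → a ≤ ε / 2 → ∫⁻ x : ℝ, ‖k (x + a * I)‖ₑ ^ (2:ℝ) ≤ ENNReal.ofReal η := by
    intro a ha hae
    have h1 := inner_shift hd hM hMt ha (by linarith : 0 < ε / 2)
    have e1 : a + ε / 2 + ε / 2 = a + ε := by ring
    rw [e1] at h1
    have hae' : 0 < a + ε := by linarith
    have ia := sq_integrable hd hM hMt ha
    have ib := sq_integrable hd hM hMt hae'
    have ic : Integrable (fun x : ℝ => h (x + (a + ε : ℝ) * I) * (starRingEnd ℂ) (h (x + a * I))) := by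
      refine (ia.add ib).mono' ?_ ?_
      · exact ((line_cont hd hae').mul (Complex.continuous_conj.comp (line_cont hd ha))).aestronglyMeasurable
      · refine Eventually.of_forall fun x => ?_
        simp only [Pi.add_apply]
        rw [norm_mul, RCLike.norm_conj]
        set A := ‖h (x + a * I)‖
        set B := ‖h (x + (a + ε : ℝ) * I)‖
        nlinarith [sq_nonneg (A - B), sq_nonneg A, sq_nonneg B]
    have h2 : ∫ x : ℝ, (h (x + (a + ε : ℝ) * I) * (starRingEnd ℂ) (h (x + a * I))).re = N (a + ε / 2) := by
      have := integral_re ic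
      simp only [RCLike.re_eq_complex_re] at this
      rw [this, h1, ofReal_re]
    have hpt : ∀ x : ℝ, ‖k (x + a * I)‖ ^ 2 = ‖h (x + a * I)‖ ^ 2 + ‖h (x + (a + ε : ℝ) * I)‖ ^ 2 -
        2 * (h (x + (a + ε : ℝ) * I) * (starRingEnd ℂ) (h (x + a * I))).re := by
      intro x
      have e2 : (x : ℂ) + a * I + ε * I = x + (a + ε : ℝ) * I := by push_cast; ring
      simp only [hk]
      rw [e2, Complex.sq_norm, Complex.sq_norm, Complex.sq_norm]
      simp only [normSq_apply, mul_re, conj_re, conj_im, sub_re, sub_im]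
      ring
    have h3 : ∫ x : ℝ, ‖k (x + a * I)‖ ^ 2 = N a + N (a + ε) - 2 * N (a + ε / 2) := by
      simp_rw [hpt]
      rw [integral_sub (by exact ia.add ib) (by exact ic.re.const_mul 2), integral_add ia ib, integral_const_mul, h2]
    have hki : Integrable (fun x : ℝ => ‖k (x + a * I)‖ ^ 2) := by
      simp_rw [hpt]
      exact (ia.add ib).sub (ic.re.const_mul 2)
    calc _ = ENNReal.ofReal (∫ x : ℝ, ‖k (x + a * I)‖ ^ 2) := by
          rw [ofReal_integral_eq_lintegral_ofReal hki (Eventually.of_forall fun x => by positivity)]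
          refine lintegral_congr fun x => ?_
          rw [← ofReal_norm, ENNReal.rpow_two, ENNReal.ofReal_pow (norm_nonneg _)]
      _ ≤ _ := by
          apply ENNReal.ofReal_le_ofReal
          rw [h3]
          have j1 := hNS a ha
          have j2 := hNanti (a + ε / 2) (a + ε) (by linarith) (by linarith)
          have j3 := hNanti (a + ε / 2) ε0 (by linarith) (by linarith)
          linarith
  intro y hy
  by_cases hye : y ≤ ε / 2
  · exact key y hy hye
  · exact (contr hkd hkb (by linarith : 0 < ε / 2) (by linarith)).trans (key _ (by linarith) le_rfl)

end HardyEnv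

open MeasureTheory Real Complex
open scoped ENNReal NNReal

namespace HardyEnv
open Filter Topology Set

lemma lint_add_sq {a b : ℝ → ℝ≥0∞} (ha : Measurable a) (hb : Measurable b) :
    ∫⁻ x, (a x + b x) ^ (2:ℝ) ≤ 2 * ((∫⁻ x, a x ^ (2:ℝ)) + ∫⁻ x, b x ^ (2:ℝ)) := by
  rw [← lintegral_add_left (by fun_prop), ← lintegral_const_mul _ (by fun_prop)]
  refine lintegral_mono fun x => ?_
  have := ENNReal.rpow_add_le_mul_rpow_add_rpow (a x) (b x) (p := 2) (by norm_num)
  refine this.trans_eq ?_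
  norm_num

lemma Hle_two_add {f g : ℂ → ℂ} (hf : DifferentiableOn ℂ f UH) (hg : DifferentiableOn ℂ g UH) {M N : ℝ≥0∞}
    (hM : Hle 2 f M) (hN : Hle 2 g N) : Hle 2 (fun z => f z + g z) (2 * (M + N)) := by
  intro y hy
  calc _ ≤ ∫⁻ x : ℝ, (‖f (x + y * I)‖ₑ + ‖g (x + y * I)‖ₑ) ^ (2:ℝ) := by
        refine lintegral_mono fun x => ?_
        gcongr
        exact enorm_add_le _ _
    _ ≤ _ := lint_add_sq (line_cont hf hy).enorm.measurable (line_cont hg hy).enorm.measurable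
    _ ≤ _ := by
        gcongr
        · exact hM y hy
        · exact hN y hy

lemma add_I_ne {z : ℂ} (hz : 0 < z.im) : z + I ≠ 0 := by
  intro h
  have := congrArg Complex.im h
  simp at this
  linarith

lemma aux_diff : DifferentiableOn ℂ (fun z : ℂ => I / (z + I)) UH := by
  intro z hz
  refine DifferentiableAt.differentiableWithinAt ?_
  exact DifferentiableAt.fun_div (by fun_prop) (by fun_prop) (add_I_ne hz)

lemma aux_re {z : ℂ} (hz : 0 < z.im) : 0 < (I / (z + I)).re := by
  rw [Complex.div_re]
  have h0 : 0 < normSq (z + I) := normSq_pos.2 (add_I_ne hz)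
  simp
  positivity

lemma aux_H2 : Hle 2 (fun z : ℂ => I / (z + I)) (ENNReal.ofReal π) := by
  intro y hy
  have hy1 : 0 < y + 1 := by linarith
  calc _ = ∫⁻ x : ℝ, ENNReal.ofReal (π / (y + 1)) * ENNReal.ofReal (pk (y + 1) (x - 0)) := by
        refine lintegral_congr fun x => ?_
        rw [← ENNReal.ofReal_mul (by positivity), ← ofReal_norm, ENNReal.ofReal_rpow_of_nonneg (by positivity) (by norm_num)]
        congr 1
        have h1 : ‖(x:ℂ) + y * I + I‖ ^ 2 = x ^ 2 + (y + 1) ^ 2 := by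
          rw [Complex.sq_norm, normSq_apply]; simp; ring
        rw [norm_div, Complex.norm_I, Real.rpow_two, div_pow, h1, pk, sub_zero]
        field_simp
    _ = ENNReal.ofReal (π / (y + 1)) := by
        rw [lintegral_const_mul' _ _ ENNReal.ofReal_ne_top]
        have := lintegral_pk_sub' hy1 0
        simp_all
    _ ≤ _ := by
        apply ENNReal.ofReal_le_ofReal
        rw [div_le_iff₀ hy1]
        nlinarith [Real.pi_pos]

lemma factor {f : ℂ → ℂ} {p : ℝ} {M : ℝ≥0∞} (hp : 0 < p) (hd : DifferentiableOn ℂ f UH)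
    (hM : Hle p f M) (hMt : M ≠ ⊤) :
    ∃ G H : ℂ → ℂ, ∃ N : ℝ≥0∞, N ≠ ⊤ ∧ DifferentiableOn ℂ G UH ∧ DifferentiableOn ℂ H UH ∧
      Hle 2 G N ∧ Hle 2 H N ∧ (∀ z ∈ UH, 0 < (G z).re) ∧
      (∀ z ∈ UH, f z = G z ^ ((2 / p - 1 : ℝ) : ℂ) * H z) := by
  obtain ⟨u, hum, hu0, hu2, hmaj⟩ := majorant hp hd hM hMt
  have hu2' : ∫⁻ t, ‖u t‖ₑ ^ (2:ℝ) ≤ M := by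
    refine le_trans (le_of_eq (lintegral_congr fun t => ?_)) hu2
    rw [← ofReal_norm, Real.norm_of_nonneg (hu0 t)]
  have huL : MemLp u 2 volume := by
    refine ⟨hum.aestronglyMeasurable, ?_⟩
    rw [eLpNorm_lt_top_iff_lintegral_rpow_enorm_lt_top (by norm_num) (by norm_num)]
    simpa using hu2'.trans_lt hMt.lt_top
  set G : ℂ → ℂ := fun z => CT u z + I / (z + I) with hG
  have hGd : DifferentiableOn ℂ G UH := (CT_diff huL).add aux_diff
  have hGM : Hle 2 G (2 * (2 * M + ENNReal.ofReal π)) :=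
    Hle_two_add (CT_diff huL) aux_diff ((CT_H2 hum huL).mono (by gcongr)) aux_H2
  have hre : ∀ z ∈ UH, ‖f z‖ ^ (p / 2) < (G z).re := by
    intro z hz
    have h1 := hmaj z.re z.im hz
    rw [re_add_im] at h1
    rw [hG]
    simp only [add_re]
    rw [CT_re huL hz]
    linarith [aux_re hz]
  have hpos : ∀ z ∈ UH, 0 < (G z).re := fun z hz => lt_of_le_of_lt (by positivity) (hre z hz)
  have hne : ∀ z ∈ UH, G z ≠ 0 := fun z hz h => by
    have := hpos z hz
    rw [h] at this
    simp at this
  have hGcd : ∀ s : ℂ, DifferentiableOn ℂ (fun z => G z ^ s) UH := fun s =>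
    hGd.cpow (differentiableOn_const _) (fun z hz => Or.inl (hpos z hz))
  set s : ℝ := 2 / p - 1 with hs
  set H : ℂ → ℂ := fun z => G z ^ ((-s : ℝ) : ℂ) * f z with hH
  refine ⟨G, H, _, ?_, hGd, (hGcd _).mul hd, hGM, ?_, hpos, ?_⟩
  · finiteness
  · intro y hy
    refine le_trans (lintegral_mono fun x => ?_) (hGM y hy)
    have hz : (x:ℂ) + y * I ∈ UH := by simpa using hy
    gcongr
    rw [← ofReal_norm, ← ofReal_norm]
    apply ENNReal.ofReal_le_ofReal
    set z := (x:ℂ) + y * I with hzd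
    have hg0 : 0 < ‖G z‖ := norm_pos_iff.2 (hne z hz)
    have h1 : ‖f z‖ ^ (p / 2) ≤ ‖G z‖ := (hre z hz).le.trans (Complex.re_le_norm _)
    have h2 : ‖f z‖ ≤ ‖G z‖ ^ (2 / p) := by
      have := Real.rpow_le_rpow (by positivity) h1 (by positivity : 0 ≤ 2 / p)
      rwa [← Real.rpow_mul (norm_nonneg _), show p / 2 * (2 / p) = 1 by field_simp, Real.rpow_one] at this
    rw [hH]
    simp only []
    rw [norm_mul, norm_cpow_real]
    calc _ ≤ ‖G z‖ ^ (-s) * ‖G z‖ ^ (2 / p) := by gcongr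
      _ = _ := by
        rw [← Real.rpow_add hg0, hs, show -(2 / p - 1) + 2 / p = 1 by ring, Real.rpow_one]
  · intro z hz
    rw [hH]
    simp only []
    rw [← mul_assoc, ← Complex.cpow_add _ _ (hne z hz)]
    simp

lemma holder_p {p : ℝ} (hp0 : 0 < p) (hp1 : p < 1) {a b : ℝ → ℝ≥0∞} (ha : Measurable a) (hb : Measurable b) :
    ∫⁻ x, (a x * b x ^ (2 / p - 1)) ^ p ≤ (∫⁻ x, a x ^ (2:ℝ)) ^ (p / 2) * (∫⁻ x, b x ^ (2:ℝ)) ^ (1 - p / 2) := by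
  have := ENNReal.lintegral_mul_norm_pow_le (μ := (volume : Measure ℝ)) (f := fun x => a x ^ (2:ℝ)) (g := fun x => b x ^ (2:ℝ))
    (by fun_prop) (by fun_prop) (p := p / 2) (q := 1 - p / 2) (by linarith) (by linarith) (by ring)
  refine le_trans (le_of_eq (lintegral_congr fun x => ?_)) this
  rw [ENNReal.mul_rpow_of_nonneg _ _ hp0.le, ← ENNReal.rpow_mul, ← ENNReal.rpow_mul, ← ENNReal.rpow_mul]
  congr 2
  · ring
  · field_simp

lemma cpow_diff {s : ℝ} (hs : 1 ≤ s) {a b : ℂ} (ha : 0 < a.re) (hb : 0 < b.re) :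
    ‖a ^ (s:ℂ) - b ^ (s:ℂ)‖ ≤ s * (‖a‖ + ‖b‖) ^ (s - 1) * ‖a - b‖ := by
  set S : Set ℂ := {z | 0 < z.re} ∩ Metric.closedBall 0 (‖a‖ + ‖b‖) with hS
  have hconv : Convex ℝ S := (convex_halfSpace_re_gt 0).inter (convex_closedBall _ _)
  refine Convex.norm_image_sub_le_of_norm_hasDerivWithin_le (𝕜 := ℂ) (s := S) (f := fun z => z ^ (s:ℂ))
    (f' := fun z => (s:ℂ) * z ^ ((s:ℂ) - 1)) ?_ ?_ hconv ?_ ?_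
  · intro z hz
    have := (hasDerivAt_id z).cpow_const (c := (s:ℂ)) (Or.inl hz.1)
    simpa using this.hasDerivWithinAt
  · intro z hz
    have h2 := hz.2
    rw [mem_closedBall_zero_iff] at h2
    rw [norm_mul, show (s:ℂ) - 1 = ((s - 1 : ℝ) : ℂ) by push_cast; ring, norm_cpow_real, Complex.norm_real, Real.norm_of_nonneg (by linarith)]
    gcongr
  · exact ⟨hb, by rw [mem_closedBall_zero_iff]; linarith [norm_nonneg a]⟩
  · exact ⟨ha, by rw [mem_closedBall_zero_iff]; linarith [norm_nonneg b]⟩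

end HardyEnv

open MeasureTheory Real Complex
open scoped ENNReal NNReal

namespace HardyEnv
open Filter Topology Set

lemma choose_small {D : ℝ≥0∞} (hD : D ≠ ⊤) {q η : ℝ} (hq : 0 < q) (hη : 0 < η) :
    ∃ t : ℝ, 0 < t ∧ ENNReal.ofReal t ^ q * D ≤ ENNReal.ofReal η := by
  have hD0 : 0 ≤ D.toReal := ENNReal.toReal_nonneg
  refine ⟨(η / (D.toReal + 1)) ^ q⁻¹, by positivity, ?_⟩
  rw [ENNReal.ofReal_rpow_of_nonneg (by positivity) hq.le, ← Real.rpow_mul (by positivity), inv_mul_cancel₀ hq.ne', Real.rpow_one,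
    ← ENNReal.ofReal_toReal hD, ← ENNReal.ofReal_mul (by positivity)]
  apply ENNReal.ofReal_le_ofReal
  rw [ENNReal.toReal_ofReal hD0, div_mul_eq_mul_div, div_le_iff₀ (by positivity)]
  nlinarith

lemma line_shift (x y ε : ℝ) : (x:ℂ) + y * I + ε * I = x + ((y + ε : ℝ) : ℂ) * I := by
  push_cast; ring

lemma shift_mem {z : ℂ} (hz : z ∈ UH) {ε : ℝ} (hε : 0 ≤ ε) : z + ε * I ∈ UH := by
  have : 0 < z.im := hz
  show 0 < (z + ε * I).im
  simp
  linarith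

lemma shift_Hle {q : ℝ} {f : ℂ → ℂ} {M : ℝ≥0∞} (hM : Hle q f M) {ε : ℝ} (hε : 0 ≤ ε) :
    Hle q (fun z => f (z + ε * I)) M := by
  intro y hy
  simp only [line_shift]
  exact hM (y + ε) (by linarith)

lemma shift_diff {f : ℂ → ℂ} (hd : DifferentiableOn ℂ f UH) {ε : ℝ} (hε : 0 ≤ ε) :
    DifferentiableOn ℂ (fun z => f (z + ε * I)) UH :=
  hd.comp (by fun_prop) (fun z hz => shift_mem hz hε)

lemma approx1 {f : ℂ → ℂ} {p : ℝ} {M : ℝ≥0∞} (hp0 : 0 < p) (hp1 : p < 1) (hd : DifferentiableOn ℂ f UH)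
    (hM : Hle p f M) (hMt : M ≠ ⊤) {η : ℝ} (hη : 0 < η) :
    ∃ ε0 : ℝ, 0 < ε0 ∧ ∀ ε : ℝ, 0 < ε → ε ≤ ε0 → Hle p (fun z => f z - f (z + ε * I)) (ENNReal.ofReal η) := by
  obtain ⟨G, H, N, hN, hGd, hHd, hG, hH, hpos, hfac⟩ := factor hp0 hd hM hMt
  set s : ℝ := 2 / p - 1 with hs
  have hs1 : 1 ≤ s := by
    have : 2 ≤ 2 / p := by rw [le_div_iff₀ hp0]; linarith
    rw [hs]; linarith
  have hs0 : 0 ≤ s := by linarith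
  set D : ℝ≥0∞ := ENNReal.ofReal (1 + s) ^ p * (2 * (2 * (N + N) + N)) ^ (1 - p / 2) with hD
  have hDt : D ≠ ⊤ := by
    rw [hD]
    refine ENNReal.mul_ne_top (ENNReal.rpow_ne_top_of_nonneg hp0.le (by finiteness)) (ENNReal.rpow_ne_top_of_nonneg (by linarith) (by finiteness))
  obtain ⟨t, ht, htD⟩ := choose_small hDt (q := p / 2) (by positivity) hη
  obtain ⟨e1, he1, h1⟩ := shift_small hGd hG hN (η := t / 4) (by positivity)
  obtain ⟨e2, he2, h2⟩ := shift_small hHd hH hN (η := t / 4) (by positivity)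
  refine ⟨min e1 e2, lt_min he1 he2, fun ε hε hεle => ?_⟩
  have hGs := shift_diff hGd hε.le
  have hHs := shift_diff hHd hε.le
  have k1 := h1 ε hε (hεle.trans (min_le_left _ _))
  have k2 := h2 ε hε (hεle.trans (min_le_right _ _))
  intro y hy
  have cG := line_cont hGd hy
  have cH := line_cont hHd hy
  have cGs := line_cont hGs hy
  have cHs := line_cont hHs hy
  set a : ℝ → ℝ≥0∞ := fun x => ‖H (x + y * I) - H (x + y * I + ε * I)‖ₑ + ‖G (x + y * I) - G (x + y * I + ε * I)‖ₑ with ha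
  set b : ℝ → ℝ≥0∞ := fun x => (‖G (x + y * I)‖ₑ + ‖G (x + y * I + ε * I)‖ₑ) + ‖H (x + y * I + ε * I)‖ₑ with hb
  have mG := cG.enorm.measurable
  have mGs := cGs.enorm.measurable
  have mHs := cHs.enorm.measurable
  have mdH := (cH.sub cHs).enorm.measurable
  have mdG := (cG.sub cGs).enorm.measurable
  have ha2 : ∫⁻ x, a x ^ (2:ℝ) ≤ ENNReal.ofReal t := by
    refine (lint_add_sq mdH mdG).trans ?_
    calc _ ≤ 2 * (ENNReal.ofReal (t / 4) + ENNReal.ofReal (t / 4)) := by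
          gcongr 2 * (?_ + ?_)
          · exact k2 y hy
          · exact k1 y hy
      _ = _ := by
          rw [← ENNReal.ofReal_add (by positivity) (by positivity), show (2:ℝ≥0∞) = ENNReal.ofReal 2 by simp, ← ENNReal.ofReal_mul (by norm_num)]
          congr 1; ring
  have hb2 : ∫⁻ x, b x ^ (2:ℝ) ≤ 2 * (2 * (N + N) + N) := by
    refine (lint_add_sq (mG.add mGs) mHs).trans ?_
    gcongr 2 * (?_ + ?_)
    · refine (lint_add_sq mG mGs).trans ?_
      gcongr 2 * (?_ + ?_)
      · exact hG y hy
      · exact shift_Hle hG hε.le y hy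
    · exact shift_Hle hH hε.le y hy
  calc _ ≤ ∫⁻ x : ℝ, ENNReal.ofReal (1 + s) ^ p * (a x * b x ^ s) ^ p := by
        refine lintegral_mono fun x => ?_
        rw [← ENNReal.mul_rpow_of_nonneg _ _ hp0.le]
        gcongr
        have hz : (x:ℂ) + y * I ∈ UH := by simpa using hy
        set z := (x:ℂ) + y * I with hzd
        have hz' := shift_mem hz hε.le
        show ‖f z - f (z + ε * I)‖ₑ ≤ _
        rw [hfac z hz, hfac _ hz']
        simp only [ha, hb, ← ofReal_norm]
        rw [← hzd]
        have e0 := cpow_diff hs1 (hpos z hz) (hpos _ hz')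
        rw [← ENNReal.ofReal_add (by positivity) (by positivity), ← ENNReal.ofReal_add (by positivity) (by positivity),
          ← ENNReal.ofReal_add (by positivity) (by positivity), ENNReal.ofReal_rpow_of_nonneg (by positivity) hs0,
          ← ENNReal.ofReal_mul (by positivity), ← ENNReal.ofReal_mul (by positivity)]
        apply ENNReal.ofReal_le_ofReal
        set g := G z
        set g' := G (z + ε * I)
        set h := H z
        set h' := H (z + ε * I)
        set bb := ‖g‖ + ‖g'‖ + ‖h'‖ with hbb
        have hb0 : 0 ≤ bb := by positivity
        have e1 : ‖g ^ (s:ℂ) * (h - h')‖ ≤ bb ^ s * ‖h - h'‖ := by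
          rw [norm_mul, norm_cpow_real]
          gcongr
          rw [hbb]
          linarith [norm_nonneg g', norm_nonneg h']
        have e2 : ‖(g ^ (s:ℂ) - g' ^ (s:ℂ)) * h'‖ ≤ s * bb ^ s * ‖g - g'‖ := by
          rw [norm_mul]
          have q1 : (‖g‖ + ‖g'‖) ^ (s - 1) ≤ bb ^ (s - 1) :=
            Real.rpow_le_rpow (by positivity) (by rw [hbb]; linarith [norm_nonneg h']) (by linarith)
          have q2 : ‖h'‖ ≤ bb := by rw [hbb]; linarith [norm_nonneg g, norm_nonneg g']
          have q3 : bb ^ s = bb ^ (s - 1) * bb := by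
            rw [← Real.rpow_add_one' hb0 (by linarith)]
            ring_nf
          calc _ ≤ (s * bb ^ (s - 1) * ‖g - g'‖) * bb := by
                refine mul_le_mul (e0.trans ?_) q2 (norm_nonneg _) (by positivity)
                gcongr
            _ = _ := by rw [q3]; ring
        calc _ = ‖g ^ (s:ℂ) * (h - h') + (g ^ (s:ℂ) - g' ^ (s:ℂ)) * h'‖ := by congr 1; ring
          _ ≤ bb ^ s * ‖h - h'‖ + s * bb ^ s * ‖g - g'‖ := (norm_add_le _ _).trans (add_le_add e1 e2)
          _ ≤ _ := by
            have r1 : 0 ≤ bb ^ s := by positivity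
            have r2 : 0 ≤ bb ^ s * ‖g - g'‖ := by positivity
            have r3 : 0 ≤ s * (bb ^ s * ‖h - h'‖) := by positivity
            nlinarith
    _ = ENNReal.ofReal (1 + s) ^ p * ∫⁻ x : ℝ, (a x * b x ^ s) ^ p :=
        lintegral_const_mul' _ _ (ENNReal.rpow_ne_top_of_nonneg hp0.le (by finiteness))
    _ ≤ ENNReal.ofReal (1 + s) ^ p * ((ENNReal.ofReal t) ^ (p / 2) * (2 * (2 * (N + N) + N)) ^ (1 - p / 2)) := by
        gcongr _ * ?_
        refine (holder_p hp0 hp1 (mdH.add mdG) ((mG.add mGs).add mHs)).trans ?_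
        have : 0 ≤ 1 - p / 2 := by linarith
        gcongr ?_ ^ (p / 2) * ?_ ^ (1 - p / 2)
        · exact ha2
        · exact hb2
    _ = ENNReal.ofReal t ^ (p / 2) * D := by rw [hD]; ring
    _ ≤ _ := htD

noncomputable def psi (K : ℕ) (δ : ℝ) (z : ℂ) : ℂ := ((1 - I * δ * z) ^ K)⁻¹

lemma psi_base {δ : ℝ} (hδ : 0 ≤ δ) {z : ℂ} (hz : 0 ≤ z.im) : 1 + δ ^ 2 * ‖z‖ ^ 2 ≤ ‖1 - I * δ * z‖ ^ 2 := by
  rw [Complex.sq_norm, Complex.sq_norm, normSq_apply, normSq_apply]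
  simp
  nlinarith [mul_nonneg hδ hz]

lemma psi_base_one {δ : ℝ} (hδ : 0 ≤ δ) {z : ℂ} (hz : 0 ≤ z.im) : 1 ≤ ‖1 - I * δ * z‖ := by
  have := psi_base hδ hz
  have h2 : 0 ≤ δ ^ 2 * ‖z‖ ^ 2 := by positivity
  nlinarith [norm_nonneg (1 - I * δ * z)]

lemma psi_le_one (K : ℕ) {δ : ℝ} (hδ : 0 ≤ δ) {z : ℂ} (hz : 0 ≤ z.im) : ‖psi K δ z‖ ≤ 1 := by
  rw [psi, norm_inv, norm_pow]
  exact inv_le_one_of_one_le₀ (one_le_pow₀ (psi_base_one hδ hz))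

lemma psi_decay (K : ℕ) {δ : ℝ} (hδ : 0 < δ) {z : ℂ} (hz : 0 ≤ z.im) :
    ‖psi K δ z‖ ≤ (1 + 1 / δ) ^ K * ((1 + ‖z‖) ^ K)⁻¹ := by
  rw [psi, norm_inv, norm_pow]
  have h1 := psi_base_one hδ.le hz
  have h2 := psi_base hδ.le hz
  have h3 : δ * ‖z‖ ≤ ‖1 - I * δ * z‖ := by
    refine le_of_sq_le_sq ?_ (norm_nonneg _)
    rw [mul_pow]; linarith
  have h4 : 1 + ‖z‖ ≤ (1 + 1 / δ) * ‖1 - I * δ * z‖ := by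
    have : ‖z‖ ≤ 1 / δ * ‖1 - I * δ * z‖ := by
      rw [one_div, inv_mul_eq_div, le_div_iff₀ hδ]; linarith
    linarith
  have h5 : (1 + ‖z‖) ^ K ≤ (1 + 1 / δ) ^ K * ‖1 - I * δ * z‖ ^ K := by
    rw [← mul_pow]
    gcongr
  rw [← div_eq_mul_inv, inv_eq_one_div, div_le_div_iff₀ (by positivity) (by positivity)]
  linarith

lemma psi_diff (K : ℕ) {δ : ℝ} (hδ : 0 ≤ δ) : DifferentiableOn ℂ (psi K δ) UH := by
  intro z hz
  refine DifferentiableAt.differentiableWithinAt ?_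
  unfold psi
  refine DifferentiableAt.fun_inv (by fun_prop) ?_
  have := psi_base_one hδ (le_of_lt hz)
  exact pow_ne_zero _ (norm_pos_iff.1 (by linarith))

lemma psi_tendsto (K : ℕ) (z : ℂ) : Tendsto (fun n : ℕ => psi K (1 / ((n:ℝ) + 1)) z) atTop (𝓝 1) := by
  have h1 : Tendsto (fun n : ℕ => ((1 / ((n:ℝ) + 1) : ℝ) : ℂ)) atTop (𝓝 0) := by
    have := (Complex.continuous_ofReal.tendsto 0).comp (tendsto_one_div_add_atTop_nhds_zero_nat (𝕜 := ℝ))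
    simpa only [Complex.ofReal_zero, Function.comp_def] using this
  have h2 : Tendsto (fun n : ℕ => (1 - I * ((1 / ((n:ℝ) + 1) : ℝ) : ℂ) * z)) atTop (𝓝 (1 - I * 0 * z)) :=
    ((h1.const_mul I).mul_const z).const_sub 1
  have h3 := (h2.pow K).inv₀ (by simp)
  simpa [psi] using h3

lemma approx2 {f : ℂ → ℂ} {p : ℝ} {M : ℝ≥0∞} (hp0 : 0 < p) (hp1 : p < 1) (hd : DifferentiableOn ℂ f UH)
    (hM : Hle p f M) (hMt : M ≠ ⊤) (K : ℕ) {ε : ℝ} (hε : 0 < ε) {η : ℝ} (hη : 0 < η) :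
    ∃ δ : ℝ, 0 < δ ∧ Hle p (fun z => f (z + ε * I + ε * I) * (1 - psi K δ (z + ε * I))) (ENNReal.ofReal η) := by
  obtain ⟨G, H, N, hN, hGd, hHd, hG, hH, hpos, hfac⟩ := factor hp0 hd hM hMt
  set s : ℝ := 2 / p - 1 with hs
  set D : ℝ≥0∞ := N ^ (1 - p / 2) with hD
  have hDt : D ≠ ⊤ := ENNReal.rpow_ne_top_of_nonneg (by linarith) hN
  obtain ⟨t, ht, htD⟩ := choose_small hDt (q := p / 2) (by positivity) hη
  have hHb : Bd H := fun a ha => bdd_of_Hle (by norm_num) hHd hH hN a ha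
  set h : ℝ → ℂ → ℂ := fun δ z => H (z + ε * I) * (1 - psi K δ z) with hh
  have hhd : ∀ δ, 0 ≤ δ → DifferentiableOn ℂ (h δ) UH := fun δ hδ =>
    (shift_diff hHd hε.le).mul ((differentiableOn_const _).sub (psi_diff K hδ))
  have h1psi : ∀ δ, 0 ≤ δ → ∀ z : ℂ, 0 ≤ z.im → ‖1 - psi K δ z‖ ≤ 2 := fun δ hδ z hz => by
    refine (norm_sub_le _ _).trans ?_
    have := psi_le_one K hδ hz
    rw [norm_one]; linarith
  have hhb : ∀ δ, 0 ≤ δ → Bd (h δ) := by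
    intro δ hδ a ha
    obtain ⟨m, hm⟩ := hHb a ha
    refine ⟨m * 2, fun z hz => ?_⟩
    rw [hh]
    simp only []
    rw [norm_mul]
    have e1 : ‖H (z + ε * I)‖ ≤ m := hm _ (by simp; linarith)
    exact mul_le_mul e1 (h1psi δ hδ z (by linarith)) (norm_nonneg _) ((norm_nonneg _).trans e1)
  have hlim : Tendsto (fun n : ℕ => ∫⁻ x : ℝ, ‖h (1 / ((n:ℝ) + 1)) (x + ε * I)‖ₑ ^ (2:ℝ)) atTop (𝓝 0) := by
    have := tendsto_lintegral_of_dominated_convergence (μ := (volume : Measure ℝ))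
      (F := fun (n : ℕ) (x : ℝ) => ‖h (1 / ((n:ℝ) + 1)) (x + ε * I)‖ₑ ^ (2:ℝ)) (f := fun _ => 0)
      (fun x : ℝ => (2:ℝ≥0∞) ^ (2:ℝ) * ‖H (x + ε * I + ε * I)‖ₑ ^ (2:ℝ)) ?_ ?_ ?_ ?_
    · simpa using this
    · intro n
      have := (line_cont (hhd (1 / ((n:ℝ) + 1)) (by positivity)) hε).enorm.measurable
      fun_prop
    · intro n
      refine Eventually.of_forall fun x => ?_
      simp only []
      rw [← ENNReal.mul_rpow_of_nonneg _ _ (by norm_num : (0:ℝ) ≤ 2)]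
      gcongr
      rw [hh]
      simp only []
      rw [enorm_mul, mul_comm]
      gcongr
      rw [← ofReal_norm, show (2:ℝ≥0∞) = ENNReal.ofReal 2 by simp]
      exact ENNReal.ofReal_le_ofReal (h1psi _ (by positivity) _ (by simp; linarith))
    · rw [lintegral_const_mul' _ _ (by norm_num)]
      refine ENNReal.mul_ne_top (by norm_num) (ne_top_of_le_ne_top hN ?_)
      exact shift_Hle hH hε.le ε hε
    · refine Eventually.of_forall fun x => ?_
      have e1 : Tendsto (fun n : ℕ => h (1 / ((n:ℝ) + 1)) (x + ε * I)) atTop (𝓝 (H (x + ε * I + ε * I) * (1 - 1))) :=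
        ((psi_tendsto K _).const_sub 1).const_mul _
      have e2 := (ENNReal.continuous_rpow_const (y := 2)).tendsto _ |>.comp e1.enorm
      simpa [Function.comp_def] using e2
  obtain ⟨n, hn⟩ := (hlim.eventually (ge_mem_nhds (ENNReal.ofReal_pos.2 ht))).exists
  set δ : ℝ := 1 / ((n:ℝ) + 1) with hδ
  have hδ0 : 0 < δ := by positivity
  refine ⟨δ, hδ0, ?_⟩
  intro y hy
  have mH := (line_cont (shift_diff (hhd δ hδ0.le) hε.le) hy).enorm.measurable
  have mG := (line_cont (shift_diff (shift_diff hGd hε.le) hε.le) hy).enorm.measurable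
  calc _ ≤ ∫⁻ x : ℝ, (‖h δ (x + y * I + ε * I)‖ₑ * ‖G (x + y * I + ε * I + ε * I)‖ₑ ^ s) ^ p := by
        refine lintegral_mono fun x => ?_
        gcongr
        have hz : (x:ℂ) + y * I ∈ UH := by simpa using hy
        simp only []
        rw [hfac _ (shift_mem (shift_mem hz hε.le) hε.le)]
        simp only [hh]
        rw [enorm_mul, enorm_mul, enorm_mul]
        have : ‖G (↑x + ↑y * I + ↑ε * I + ↑ε * I) ^ (s:ℂ)‖ₑ = ‖G (↑x + ↑y * I + ↑ε * I + ↑ε * I)‖ₑ ^ s := by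
          rw [← ofReal_norm, norm_cpow_real, ← ofReal_norm, ENNReal.ofReal_rpow_of_pos]
          have := hpos _ (shift_mem (shift_mem hz hε.le) hε.le)
          exact lt_of_lt_of_le this (Complex.re_le_norm _)
        rw [this]
        apply le_of_eq
        ring
    _ ≤ _ := holder_p hp0 hp1 mH mG
    _ ≤ (ENNReal.ofReal t) ^ (p / 2) * N ^ (1 - p / 2) := by
        have : 0 ≤ 1 - p / 2 := by linarith
        gcongr ?_ ^ (p / 2) * ?_ ^ (1 - p / 2)
        · refine le_trans ?_ hn
          have := contr (hhd δ hδ0.le) (hhb δ hδ0.le) hε (show ε ≤ y + ε by linarith)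
          simp only [line_shift]
          exact this
        · exact shift_Hle (shift_Hle hG hε.le) hε.le y hy
    _ ≤ _ := htD

end HardyEnv

open MeasureTheory Real Complex
open scoped ENNReal NNReal

namespace HardyEnv
open Filter Topology Set

lemma int_complex_UH {Φ : ℂ → ℂ} (hΦ : IntegrableOn Φ UH) :
    ∫ w in UH, Φ w = ∫ v in Ioi (0:ℝ), ∫ t : ℝ, Φ (t + v * I) := by
  rw [← integral_indicator isOpen_UH.measurableSet, ← (volume_preserving_equiv_real_prod.symm).integral_comp
    measurableEquivRealProd.symm.measurableEmbedding, Measure.volume_eq_prod, integral_prod_symm]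
  · rw [← integral_indicator measurableSet_Ioi]
    refine integral_congr_ae (Eventually.of_forall fun v => ?_)
    have e : ∀ t : ℝ, measurableEquivRealProd.symm (t, v) = t + v * I := fun t => by
      apply Complex.ext <;> simp [measurableEquivRealProd_symm_apply]
    simp only [e]
    by_cases hv : 0 < v
    · rw [indicator_of_mem (show v ∈ Ioi 0 from hv)]
      refine integral_congr_ae (Eventually.of_forall fun t => ?_)
      have : (t:ℂ) + v * I ∈ UH := by simpa using hv
      simp only []
      rw [indicator_of_mem this]
    · rw [indicator_of_notMem (show v ∉ Ioi 0 from hv)]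
      rw [← integral_zero ℝ ℂ (μ := volume)]
      refine integral_congr_ae (Eventually.of_forall fun t => ?_)
      have : (t:ℂ) + v * I ∉ UH := by simpa using hv
      simp only []
      rw [indicator_of_notMem this]
  · rw [← Measure.volume_eq_prod]
    have := (volume_preserving_equiv_real_prod.symm).integrable_comp_emb
      measurableEquivRealProd.symm.measurableEmbedding (g := UH.indicator Φ)
    exact this.2 ((integrable_indicator_iff isOpen_UH.measurableSet).2 hΦ)

lemma norm_le_of_im {z : ℂ} {b : ℝ} (h : b ≤ z.im) : b ≤ ‖z‖ := h.trans ((le_abs_self _).trans (abs_im_le_norm z))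

lemma line_cauchy {F : ℂ → ℂ} {C : ℝ} (hd : DifferentiableOn ℂ F UH)
    (hb : ∀ z ∈ UH, ‖F z‖ ≤ C * (1 + ‖z‖ ^ 2)⁻¹) {z : ℂ} {v0 : ℝ} (hv0 : 0 < v0) (hz : v0 < z.im) :
    ∫ t : ℝ, F (t + v0 * I) * (z - (t + v0 * I))⁻¹ = -(2 * π * I) * F z := by
  have hC : 0 ≤ C := by
    have := hb I (by simp)
    have h2 := (norm_nonneg _).trans this
    simp at h2
    linarith
  set x := z.re with hx
  set b := z.im - v0 with hbd
  have hb0 : 0 < b := by rw [hbd]; linarith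
  have hzx : z = x + (v0 + b : ℝ) * I := by
    apply Complex.ext <;> simp [hx, hbd]
  have hBd : ∀ a : ℝ, 0 < a → ∃ M, ∀ z : ℂ, a ≤ z.im → ‖F z‖ ≤ M := by
    intro a ha
    refine ⟨C, fun z hz => (hb z (lt_of_lt_of_le ha hz)).trans ?_⟩
    have : (1 + ‖z‖ ^ 2)⁻¹ ≤ 1 := inv_le_one_of_one_le₀ (by nlinarith [sq_nonneg ‖z‖])
    nlinarith
  have hP := poisson hd hBd x v0 b hv0 hb0
  rw [← hzx] at hP
  set Φ : ℂ → ℂ := fun ζ => F (ζ + v0 * I) * (x - ζ - b * I)⁻¹ with hΦ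
  have hmem : ∀ ζ : ℂ, 0 ≤ ζ.im → ζ + v0 * I ∈ UH := fun ζ hζ => by
    show 0 < (ζ + v0 * I).im
    simp; linarith
  have hlow : ∀ ζ : ℂ, 0 ≤ ζ.im → b ≤ ‖x - ζ - b * I‖ := fun ζ hζ => by
    rw [← norm_neg]
    refine norm_le_of_im ?_
    simp; linarith
  have hΦd : DifferentiableOn ℂ Φ {z | 0 ≤ z.im} := by
    refine DifferentiableOn.mul (hd.comp (by fun_prop) (fun ζ hζ => hmem ζ hζ)) ?_
    refine DifferentiableOn.inv (by fun_prop) (fun ζ hζ => ?_)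
    exact norm_pos_iff.1 (lt_of_lt_of_le hb0 (hlow ζ hζ))
  have hΦb : ∀ ζ : ℂ, 0 ≤ ζ.im → ‖Φ ζ‖ ≤ C * b⁻¹ * (1 + ‖ζ‖ ^ 2)⁻¹ := by
    intro ζ hζ
    rw [hΦ]
    simp only []
    rw [norm_mul, norm_inv]
    have h1 := hb _ (hmem ζ hζ)
    have h2 : ‖ζ‖ ^ 2 ≤ ‖ζ + v0 * I‖ ^ 2 := by
      rw [Complex.sq_norm, Complex.sq_norm, normSq_apply, normSq_apply]
      simp
      nlinarith
    calc _ ≤ (C * (1 + ‖ζ‖ ^ 2)⁻¹) * b⁻¹ := by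
          refine mul_le_mul (h1.trans ?_) ?_ (by positivity) (by positivity)
          · gcongr
          · exact inv_anti₀ hb0 (hlow ζ hζ)
      _ = _ := by ring
  have h0 := contour_zero hΦd hΦb
  have hΦi : Integrable (fun t : ℝ => Φ t) := by
    have := line_integrable (a := 0) hΦd.continuousOn (fun x => by simp) (fun z hz => hΦb z hz)
    simpa using this
  have hFi : Integrable (fun t : ℝ => F (t + v0 * I)) :=
    line_integrable (S := UH) hd.continuousOn (fun x => by simpa using hv0) hb
  have hPi : Integrable (fun t : ℝ => (pk b (x - t) : ℂ) * F (t + v0 * I)) := by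
    refine hFi.bdd_mul (c := 1 / b) ?_ (Eventually.of_forall fun t => ?_)
    · have := continuous_pk hb0
      exact (Continuous.comp continuous_ofReal (by fun_prop)).aestronglyMeasurable
    · rw [Complex.norm_real, Real.norm_of_nonneg (pk_nonneg hb0 _)]
      exact pk_le hb0 _
  have e : ∀ t : ℝ, F (t + v0 * I) * (z - (t + v0 * I))⁻¹ = Φ t - (2 * π * I) * ((pk b (x - t) : ℂ) * F (t + v0 * I)) := by
    intro t
    have hm : (x:ℂ) - t - b * I ≠ 0 := norm_pos_iff.1 (lt_of_lt_of_le hb0 (hlow t (by simp)))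
    have hp : (x:ℂ) - t + b * I ≠ 0 := by
      have : b ≤ ‖(x:ℂ) - t + b * I‖ := norm_le_of_im (by simp)
      exact norm_pos_iff.1 (lt_of_lt_of_le hb0 this)
    have hzz : z - (t + v0 * I) = (x:ℂ) - t + b * I := by rw [hzx]; push_cast; ring
    have hpi : (π:ℂ) ≠ 0 := by exact_mod_cast Real.pi_ne_zero
    rw [hzz, pk_complex _ _ hb0, hΦ]
    simp only []
    rw [show ((x - t : ℝ) : ℂ) = (x:ℂ) - t by push_cast; ring]
    have hPQ : 2 * (b:ℂ) * I = ((x:ℂ) - t + b * I) - ((x:ℂ) - t - b * I) := by ring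
    generalize (x:ℂ) - t + b * I = P at *
    generalize (x:ℂ) - t - b * I = Q at *
    have key : P⁻¹ = Q⁻¹ - (2 * π * I) * ((π : ℂ)⁻¹ * b / (Q * P)) := by
      field_simp
      linear_combination hPQ
    rw [key]
    ring
  rw [integral_congr_ae (Eventually.of_forall e), integral_sub hΦi (hPi.const_mul _), h0, integral_const_mul, ← hP]
  ring

lemma v_bound {a : ℂ} {b : ℝ} (hb : 0 < b) (hab : b ≤ a.im) (m : ℕ) {v : ℝ} (hv : 0 ≤ v) :
    ‖(v:ℂ) ^ m * ((a + 2 * I * v) ^ (m + 2))⁻¹‖ ≤ π / b * pk b v := by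
  have h1 : b + 2 * v ≤ ‖a + 2 * I * v‖ := norm_le_of_im (by simp; linarith)
  rw [norm_mul, norm_pow, norm_inv, norm_pow, Complex.norm_real, Real.norm_of_nonneg hv]
  have h0 : 0 < ‖a + 2 * I * v‖ := by linarith
  have h2 : v ^ m ≤ ‖a + 2 * I * v‖ ^ m := by gcongr; linarith
  have h3 : v ^ 2 + b ^ 2 ≤ ‖a + 2 * I * v‖ ^ 2 := by nlinarith
  have h4 : π / b * pk b v = (v ^ 2 + b ^ 2)⁻¹ := by
    rw [pk]; field_simp
  rw [h4, pow_add, mul_inv, ← mul_assoc]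
  calc _ ≤ 1 * (v ^ 2 + b ^ 2)⁻¹ := by
        refine mul_le_mul ?_ (inv_anti₀ (by positivity) h3) (by positivity) zero_le_one
        rw [← div_eq_mul_inv, div_le_one (by positivity)]
        exact h2
    _ = _ := one_mul _

lemma base_ne {a : ℂ} (ha : 0 < a.im) {v : ℝ} (hv : 0 ≤ v) : a + 2 * I * v ≠ 0 := by
  have h1 : a.im + 2 * v ≤ ‖a + 2 * I * v‖ := norm_le_of_im (by simp)
  exact norm_pos_iff.1 (by linarith)

lemma v_int {a : ℂ} (ha : 0 < a.im) (m : ℕ) :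
    ∫ v in Ioi (0:ℝ), (v:ℂ) ^ m * ((a + 2 * I * v) ^ (m + 2))⁻¹ = ((2 * I) ^ (m + 1) * (m + 1))⁻¹ * a⁻¹ := by
  have ha0 : a ≠ 0 := fun h => by rw [h] at ha; simp at ha
  have hi : IntegrableOn (fun v : ℝ => (v:ℂ) ^ m * ((a + 2 * I * v) ^ (m + 2))⁻¹) (Ioi 0) := by
    refine Integrable.mono' ((integrable_pk ha).const_mul (π / a.im)).integrableOn ?_ ?_
    · have : Measurable (fun v : ℝ => (v:ℂ) ^ m * ((a + 2 * I * v) ^ (m + 2))⁻¹) := by fun_prop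
      exact this.aestronglyMeasurable
    · refine (ae_restrict_iff' measurableSet_Ioi).2 (Eventually.of_forall fun v hv => ?_)
      exact v_bound ha le_rfl m (le_of_lt hv)
  have hm : (m:ℂ) + 1 ≠ 0 := by exact_mod_cast Nat.succ_ne_zero m
  have key := integral_Ioi_of_hasDerivAt_of_tendsto' (a := 0) (E := ℂ)
    (f := fun v : ℝ => ((m + 1 : ℂ) * a)⁻¹ * ((v:ℂ) * (a + 2 * I * v)⁻¹) ^ (m + 1))
    (f' := fun v : ℝ => (v:ℂ) ^ m * ((a + 2 * I * v) ^ (m + 2))⁻¹)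
    (m := ((m + 1 : ℂ) * a)⁻¹ * ((2 * I)⁻¹) ^ (m + 1)) ?_ hi ?_
  · rw [key]
    simp
    field_simp
    rw [← mul_pow, show -(I / 2) * (I * 2) = 1 by linear_combination -I_mul_I, one_pow]
  · intro v hv
    have hne := base_ne ha (show 0 ≤ v from hv)
    have h1 : HasDerivAt (fun v : ℝ => (v:ℂ)) 1 v := ofRealCLM.hasDerivAt
    have h2 : HasDerivAt (fun v : ℝ => a + 2 * I * (v:ℂ)) (2 * I * 1) v := (h1.const_mul (2 * I)).const_add a
    have h3 := (((h1.mul (h2.inv hne)).pow (m + 1)).const_mul ((m + 1 : ℂ) * a)⁻¹)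
    refine h3.congr_deriv ?_
    simp only [Pi.mul_apply, Pi.inv_apply]
    simp only [Nat.add_sub_cancel, Nat.cast_add, Nat.cast_one]
    have haP : a = (a + 2 * I * v) - 2 * I * v := by ring
    generalize a + 2 * I * v = P at *
    have h4 : 1 * P⁻¹ + (v:ℂ) * (-(2 * I * 1) / P ^ 2) = a * (P ^ 2)⁻¹ := by
      rw [haP]
      field_simp
      ring
    rw [h4, mul_pow, inv_pow, pow_add]
    field_simp
  · refine Tendsto.const_mul _ (Tendsto.pow ?_ _)
    have e : ∀ᶠ v : ℝ in atTop, ((v:ℂ) * (a + 2 * I * v)⁻¹) = (a * ((v⁻¹ : ℝ) : ℂ) + 2 * I)⁻¹ := by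
      filter_upwards [eventually_gt_atTop 0] with v hv
      have hv' : (v:ℂ) ≠ 0 := by exact_mod_cast hv.ne'
      have hne := base_ne ha hv.le
      have : a * ((v⁻¹ : ℝ) : ℂ) + 2 * I = (a + 2 * I * v) * (v:ℂ)⁻¹ := by
        push_cast
        field_simp
      rw [this, mul_inv, inv_inv, mul_comm]
    refine Tendsto.congr' (EventuallyEq.symm e) ?_
    have h1 : Tendsto (fun v : ℝ => ((v⁻¹ : ℝ) : ℂ)) atTop (𝓝 ((0:ℝ):ℂ)) :=
      (Complex.continuous_ofReal.tendsto 0).comp tendsto_inv_atTop_zero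
    have h2 := ((h1.const_mul a).add_const (2 * I)).inv₀ (by simp)
    simpa using h2

lemma line_shift_kernel {F : ℂ → ℂ} {C : ℝ} (hd : DifferentiableOn ℂ F UH)
    (hb : ∀ z ∈ UH, ‖F z‖ ≤ C * (1 + ‖z‖ ^ 2)⁻¹) {q : ℂ} {N : ℕ} {v w : ℝ} (hv : 0 < v) (hvw : v ≤ w) (hq : w < q.im) :
    ∫ t : ℝ, F (t + v * I) * ((q - (t + v * I)) ^ N)⁻¹ = ∫ t : ℝ, F (t + w * I) * ((q - (t + w * I)) ^ N)⁻¹ := by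
  have hr : 0 < q.im - w := by linarith
  have hlow : ∀ ζ : ℂ, ζ.im ≤ w → q.im - w ≤ ‖q - ζ‖ := fun ζ hζ => norm_le_of_im (by simp; linarith)
  refine contour_shift (Φ := fun ζ => F ζ * ((q - ζ) ^ N)⁻¹) (C := C * ((q.im - w) ^ N)⁻¹) hvw ?_ ?_
  · refine DifferentiableOn.mul (hd.mono fun ζ hζ => lt_of_lt_of_le hv hζ.1) ?_
    refine DifferentiableOn.inv (by fun_prop) (fun ζ hζ => pow_ne_zero _ ?_)
    exact norm_pos_iff.1 (lt_of_lt_of_le hr (hlow ζ hζ.2))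
  · intro ζ h1 h2
    have h3 := hb ζ (lt_of_lt_of_le hv h1)
    rw [norm_mul, norm_inv, norm_pow]
    calc _ ≤ (C * (1 + ‖ζ‖ ^ 2)⁻¹) * ((q.im - w) ^ N)⁻¹ := by
          refine mul_le_mul h3 (inv_anti₀ (by positivity) ?_) (by positivity) ((norm_nonneg _).trans h3)
          exact pow_le_pow_left₀ hr.le (hlow ζ h2) N
      _ = _ := by ring

lemma repro {F : ℂ → ℂ} {C : ℝ} (hd : DifferentiableOn ℂ F UH)
    (hb : ∀ z ∈ UH, ‖F z‖ ≤ C * (1 + ‖z‖ ^ 2)⁻¹) (m : ℕ) {z : ℂ} (hz : z ∈ UH)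
    (hInteg : IntegrableOn (fun w => F w * (w.im:ℂ) ^ m * ((z - (starRingEnd ℂ) w) ^ (m + 2))⁻¹) UH) :
    ∫ w in UH, F w * (w.im:ℂ) ^ m * ((z - (starRingEnd ℂ) w) ^ (m + 2))⁻¹ =
      ((2 * I) ^ (m + 1) * (m + 1))⁻¹ * (-(2 * π * I)) * F z := by
  have hz0 : 0 < z.im := hz
  set v0 := z.im / 2 with hv0d
  have hv0 : 0 < v0 := by positivity
  have hv0z : v0 < z.im := by rw [hv0d]; linarith
  have hC : 0 ≤ C := by
    have := hb I (by simp)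
    have h2 := (norm_nonneg _).trans this
    simp at h2
    linarith
  rw [int_complex_UH hInteg]
  have hFi : Integrable (fun t : ℝ => F (t + v0 * I)) :=
    line_integrable (S := UH) hd.continuousOn (fun x => by simpa using hv0) hb
  set g : ℝ → ℝ → ℂ := fun v t => ((v:ℂ) ^ m * ((z - (t + v0 * I) + 2 * I * v) ^ (m + 2))⁻¹) * F (t + v0 * I) with hg
  have e1 : ∀ v ∈ Ioi (0:ℝ), ∫ t : ℝ, F (t + v * I) * (((t:ℂ) + v * I).im:ℂ) ^ m * ((z - (starRingEnd ℂ) (t + v * I)) ^ (m + 2))⁻¹ =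
      ∫ t : ℝ, g v t := by
    intro v hv
    have hv' : 0 < v := hv
    set q : ℂ := z + 2 * I * v with hq
    have hqim : q.im = z.im + 2 * v := by simp [hq]
    have e2 : ∫ t : ℝ, F (t + v * I) * ((q - (t + v * I)) ^ (m + 2))⁻¹ = ∫ t : ℝ, F (t + v0 * I) * ((q - (t + v0 * I)) ^ (m + 2))⁻¹ := by
      rcases le_total v v0 with h | h
      · exact line_shift_kernel hd hb hv' h (by rw [hqim]; linarith)
      · exact (line_shift_kernel hd hb hv0 h (by rw [hqim]; linarith)).symm
    calc _ = ∫ t : ℝ, (v:ℂ) ^ m * (F (t + v * I) * ((q - (t + v * I)) ^ (m + 2))⁻¹) := by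
          refine integral_congr_ae (Eventually.of_forall fun t => ?_)
          simp only [hq]
          have : z - (starRingEnd ℂ) (t + v * I) = z + 2 * I * v - (t + v * I) := by
            simp; ring
          rw [this]
          simp
          ring
      _ = _ := by
          rw [integral_const_mul, e2, ← integral_const_mul]
          refine integral_congr_ae (Eventually.of_forall fun t => ?_)
          simp only [hq, hg]
          have : z + 2 * I * v - (t + v0 * I) = z - (t + v0 * I) + 2 * I * v := by ring
          rw [this]
          ring
  rw [setIntegral_congr_fun measurableSet_Ioi e1]
  have him : ∀ t : ℝ, (z - (t + v0 * I)).im = v0 := fun t => by simp [hv0d]; ring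
  rw [integral_integral_swap]
  · have e3 : ∀ t : ℝ, ∫ v in Ioi (0:ℝ), g v t = ((2 * I) ^ (m + 1) * (m + 1))⁻¹ * (F (t + v0 * I) * (z - (t + v0 * I))⁻¹) := by
      intro t
      simp only [hg]
      rw [integral_mul_const, v_int (by rw [him]; exact hv0)]
      ring
    rw [integral_congr_ae (Eventually.of_forall e3), integral_const_mul, line_cauchy hd hb hv0 hv0z]
    ring
  · have hmF := (line_cont hd hv0).measurable
    refine Integrable.mono' (g := fun q : ℝ × ℝ => (π / v0 * pk v0 q.1) * ‖F (q.2 + v0 * I)‖) ?_ ?_ ?_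
    · exact ((integrable_pk hv0).const_mul (π / v0)).integrableOn.mul_prod hFi.norm
    · refine Measurable.aestronglyMeasurable ?_
      simp only [hg, Function.uncurry_def]
      refine Measurable.mul ?_ (hmF.comp measurable_snd)
      fun_prop
    · have h1 : ∀ᵐ v ∂(volume.restrict (Ioi (0:ℝ))), 0 < v :=
        (ae_restrict_iff' measurableSet_Ioi).2 (Eventually.of_forall fun v hv => hv)
      have h2 := (Measure.quasiMeasurePreserving_fst (μ := volume.restrict (Ioi (0:ℝ))) (ν := (volume : Measure ℝ))).ae h1
      filter_upwards [h2] with q hq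
      simp only [hg, Function.uncurry_def]
      rw [norm_mul]
      gcongr
      exact v_bound hv0 (by rw [him]) m hq.le

end HardyEnv

open MeasureTheory Real Complex
open scoped ENNReal NNReal

namespace HardyEnv
open Filter Topology Set
open scoped Pointwise

/-- `f` lies in every dilate of the convex hull with factor larger than `r` -/
def QQ (p : ℝ) (f : ℂ → ℂ) (r : ℝ) : Prop := 0 ≤ r ∧ ∀ s, r < s → f ∈ s • convexHull ℝ (BB p)

lemma QQ.gauge_le {p : ℝ} {f : ℂ → ℂ} {r : ℝ} (h : QQ p f r) : gauge (convexHull ℝ (BB p)) f ≤ r := by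
  refine le_of_forall_gt_imp_ge_of_dense fun s hs => ?_
  exact gauge_le_of_mem (h.1.trans hs.le) (h.2 s hs)

lemma QQ.mono {p : ℝ} {f : ℂ → ℂ} {r s : ℝ} (h : QQ p f r) (hs : r ≤ s) : QQ p f s :=
  ⟨h.1.trans hs, fun t ht => h.2 t (lt_of_le_of_lt hs ht)⟩

lemma QQ.add {p : ℝ} {f g : ℂ → ℂ} {r s : ℝ} (hf : QQ p f r) (hg : QQ p g s) : QQ p (f + g) (r + s) := by
  refine ⟨add_nonneg hf.1 hg.1, fun u hu => ?_⟩
  have h1 := hf.2 (r + (u - r - s) / 2) (by linarith)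
  have h2 := hg.2 (s + (u - r - s) / 2) (by linarith)
  have e : u = (r + (u - r - s) / 2) + (s + (u - r - s) / 2) := by ring
  rw [e, (convex_convexHull ℝ (BB p)).add_smul (by linarith [hf.1]) (by linarith [hg.1])]
  exact Set.add_mem_add h1 h2

lemma QQ_of_Hle {p : ℝ} (hp : 0 < p) {f : ℂ → ℂ} (hd : DifferentiableOn ℂ f UH) {r : ℝ} (hr : 0 ≤ r)
    (h : Hle p f (ENNReal.ofReal (r ^ p))) : QQ p f r := by
  refine ⟨hr, fun s hs => ?_⟩
  have := mem_smul_BB hp hd (lt_of_le_of_lt hr hs) (h.mono (ENNReal.ofReal_le_ofReal (Real.rpow_le_rpow hr hs.le hp.le)))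
  exact Set.smul_set_mono (subset_convexHull ℝ _) this

lemma QQ_zero {p : ℝ} (hp : 0 < p) : QQ p 0 0 := by
  refine QQ_of_Hle hp (by exact differentiableOn_const (c := (0:ℂ))) le_rfl ?_
  intro y hy
  simp [ENNReal.zero_rpow_of_pos hp]

lemma QQ_sum {p : ℝ} (hp : 0 < p) {ι : Type*} (t : Finset ι) (F : ι → ℂ → ℂ) (r : ι → ℝ) (h : ∀ i ∈ t, QQ p (F i) (r i)) :
    QQ p (∑ i ∈ t, F i) (∑ i ∈ t, r i) := by
  classical
  induction t using Finset.induction_on with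
  | empty => simpa using QQ_zero hp
  | insert a t ha ih =>
    rw [Finset.sum_insert ha, Finset.sum_insert ha]
    exact (h a (Finset.mem_insert_self _ _)).add (ih fun i hi => h i (Finset.mem_insert_of_mem hi))

noncomputable def kk (N : ℕ) (w z : ℂ) : ℂ := ((z - (starRingEnd ℂ) w) ^ N)⁻¹

lemma kk_low {w z : ℂ} (hz : z ∈ UH) : w.im ≤ ‖z - (starRingEnd ℂ) w‖ := by
  have : 0 < z.im := hz
  exact norm_le_of_im (by simp; linarith)

lemma kk_diff (N : ℕ) {w : ℂ} (hw : w ∈ UH) : DifferentiableOn ℂ (kk N w) UH := by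
  intro z hz
  have hw' : 0 < w.im := hw
  refine DifferentiableAt.differentiableWithinAt ?_
  unfold kk
  refine DifferentiableAt.fun_inv (by fun_prop) (pow_ne_zero _ ?_)
  exact norm_pos_iff.1 (lt_of_lt_of_le hw' (kk_low hz))

lemma kk_Hle {p : ℝ} {N : ℕ} (hN : 2 ≤ N * p) {w : ℂ} (hw : w ∈ UH) :
    Hle p (kk N w) (ENNReal.ofReal (π * w.im ^ (1 - N * p))) := by
  intro y hy
  have hw' : 0 < w.im := hw
  set h := y + w.im with hh
  have hh0 : 0 < h := by positivity
  calc _ ≤ ∫⁻ x : ℝ, ENNReal.ofReal (π * h ^ (1 - N * p)) * ENNReal.ofReal (pk h (x - w.re)) := by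
        refine lintegral_mono fun x => ?_
        have hn : ‖(x:ℂ) + y * I - (starRingEnd ℂ) w‖ ^ 2 = (x - w.re) ^ 2 + h ^ 2 := by
          rw [Complex.sq_norm, normSq_apply, hh]; simp; ring
        have hlow : h ≤ ‖(x:ℂ) + y * I - (starRingEnd ℂ) w‖ := norm_le_of_im (by simp [hh])
        set d := ‖(x:ℂ) + y * I - (starRingEnd ℂ) w‖ with hd
        have hd0 : 0 < d := lt_of_lt_of_le hh0 hlow
        have e1 : ‖kk N w (x + y * I)‖ₑ ^ p = ENNReal.ofReal (d ^ (-(N * p))) := by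
          rw [← ofReal_norm, kk, norm_inv, norm_pow, ← hd, ENNReal.ofReal_rpow_of_pos (by positivity),
            ← Real.rpow_natCast, ← Real.rpow_neg hd0.le, ← Real.rpow_mul hd0.le]
          congr 2; ring
        rw [e1, ← ENNReal.ofReal_mul (by positivity)]
        apply ENNReal.ofReal_le_ofReal
        have e2 : pk h (x - w.re) = π⁻¹ * h * d ^ (-2:ℝ) := by
          rw [pk, ← hn, Real.rpow_neg hd0.le, Real.rpow_two]; ring
        rw [e2]
        have e3 : π * h ^ (1 - N * p) * (π⁻¹ * h * d ^ (-2:ℝ)) = h ^ (2 - N * p) * d ^ (-2:ℝ) := by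
          rw [show (2 - N * p) = (1 - N * p) + 1 by ring, Real.rpow_add_one hh0.ne']
          field_simp
        rw [e3, show -(N * p) = (2 - N * p) + (-2:ℝ) by ring, Real.rpow_add hd0]
        gcongr ?_ * _
        exact Real.rpow_le_rpow_of_nonpos hh0 hlow (by linarith)
    _ = ENNReal.ofReal (π * h ^ (1 - N * p)) := by
        rw [lintegral_const_mul' _ _ ENNReal.ofReal_ne_top]
        have := lintegral_pk_sub' hh0 w.re
        simp_all
    _ ≤ _ := by
        apply ENNReal.ofReal_le_ofReal
        gcongr π * ?_
        exact Real.rpow_le_rpow_of_nonpos hw' (by linarith) (by linarith)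

lemma QQ_ckk {p : ℝ} (hp : 0 < p) {N : ℕ} (hN : 2 ≤ N * p) {w : ℂ} (hw : w ∈ UH) (c : ℂ) :
    QQ p (c • kk N w) (π ^ (1 / p) * (‖c‖ * w.im ^ (1 / p - N))) := by
  have hw' : 0 < w.im := hw
  refine QQ_of_Hle hp ((kk_diff N hw).const_smul c) (by positivity) ?_
  refine (Hle_smul hp (kk_Hle hN hw) c).mono (le_of_eq ?_)
  rw [← ofReal_norm, ENNReal.ofReal_rpow_of_nonneg (norm_nonneg _) hp.le, ← ENNReal.ofReal_mul (by positivity)]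
  congr 1
  rw [Real.mul_rpow (by positivity) (by positivity), Real.mul_rpow (by positivity) (by positivity),
    ← Real.rpow_mul Real.pi_pos.le, ← Real.rpow_mul hw'.le]
  rw [show 1 / p * p = 1 by field_simp, show (1 / p - N) * p = 1 - N * p by field_simp, Real.rpow_one]
  ring

lemma simple_int {𝕜 : Type*} [RCLike 𝕜] {μ : Measure ℂ} {g : ℂ → 𝕜} (s : SimpleFunc ℂ ℂ) (φ : ℂ → 𝕜)
    (hi : Integrable (fun w => g w * φ (s w)) μ) :
    ∫ w, g w * φ (s w) ∂μ = ∑ c ∈ s.range, (∫ w in s ⁻¹' {c}, g w ∂μ) * φ c := by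
  classical
  have hU : (⋃ c ∈ s.range, s ⁻¹' {c}) = univ := by
    ext w
    simp
  rw [← setIntegral_univ, ← hU, integral_biUnion_finset]
  · refine Finset.sum_congr rfl fun c hc => ?_
    rw [← integral_mul_const]
    refine setIntegral_congr_fun (s.measurableSet_fiber c) fun w hw => ?_
    have : s w = c := hw
    simp only [this]
  · exact fun c _ => s.measurableSet_fiber c
  · intro a _ b _ hab
    exact Disjoint.preimage _ (by simpa using hab)
  · exact fun c _ => hi.integrableOn

lemma norm_pow_sub_pow_le' {a b : ℂ} {R : ℝ} (ha : ‖a‖ ≤ R) (hb : ‖b‖ ≤ R) (n : ℕ) :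
    ‖a ^ (n + 1) - b ^ (n + 1)‖ ≤ (n + 1) * R ^ n * ‖a - b‖ := by
  have hR : 0 ≤ R := (norm_nonneg _).trans ha
  induction n with
  | zero => simp
  | succ n ih =>
    have e : a ^ (n + 1 + 1) - b ^ (n + 1 + 1) = a * (a ^ (n + 1) - b ^ (n + 1)) + b ^ (n + 1) * (a - b) := by ring
    rw [e]
    refine (norm_add_le _ _).trans ?_
    rw [norm_mul, norm_mul, norm_pow]
    have h1 : ‖a‖ * ‖a ^ (n + 1) - b ^ (n + 1)‖ ≤ R * ((n + 1) * R ^ n * ‖a - b‖) := by gcongr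
    have h2 : ‖b‖ ^ (n + 1) * ‖a - b‖ ≤ R ^ (n + 1) * ‖a - b‖ := by gcongr
    refine (add_le_add h1 h2).trans (le_of_eq ?_)
    push_cast
    ring

lemma kk_ratio {ε : ℝ} (hε : 0 < ε) {w z : ℂ} (hw : w ∈ UH) (hz : z ∈ UH) {W : ℝ} (hW : ‖w‖ ≤ 1 + 2 * W) (hW0 : 0 ≤ W) :
    ‖(z + I) * (z - (starRingEnd ℂ) (w + ε * I))⁻¹‖ ≤ (2 + 2 / ε) * (1 + W) := by
  have hw' : 0 < w.im := hw
  have h1 : ε ≤ ‖z - (starRingEnd ℂ) (w + ε * I)‖ := by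
    refine le_trans ?_ (kk_low hz)
    simp; linarith
  set d := z - (starRingEnd ℂ) (w + ε * I) with hd
  have hd0 : 0 < ‖d‖ := lt_of_lt_of_le hε h1
  rw [norm_mul, norm_inv, ← div_eq_mul_inv, div_le_iff₀ hd0]
  have e : z + I = d + (I + (starRingEnd ℂ) w - ε * I) := by
    rw [hd]; simp; ring
  have h2 : ‖I + (starRingEnd ℂ) w - ε * I‖ ≤ 1 + ‖w‖ + ε := by
    refine (norm_sub_le _ _).trans (add_le_add ((norm_add_le _ _).trans ?_) ?_)
    · simp
    · simp [abs_of_pos hε]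
  have h3 : ‖z + I‖ ≤ ‖d‖ + (2 + 2 * W + ε) := by
    rw [e]; refine (norm_add_le _ _).trans ?_; linarith
  have h4 : 2 + 2 * W + ε ≤ ((2 + 2 * W) / ε + 1) * ‖d‖ := by
    have : 2 + 2 * W + ε = ((2 + 2 * W) / ε + 1) * ε := by field_simp
    rw [this]
    gcongr
  have h5 : (2 + 2 / ε) * (1 + W) * ‖d‖ = ‖d‖ + ((2 + 2 * W) / ε + 1) * ‖d‖ + 2 * W * ‖d‖ := by
    field_simp; ring
  rw [h5]
  have : 0 ≤ 2 * W * ‖d‖ := by positivity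
  linarith

lemma kk_diff_bound {ε : ℝ} (hε : 0 < ε) {w w' z : ℂ} (hw : w ∈ UH) (hw' : w' ∈ UH) (hz : z ∈ UH) (hW : ‖w'‖ ≤ 1 + 2 * ‖w‖) (N : ℕ) :
    ‖kk (N + 1) (w + ε * I) z - kk (N + 1) (w' + ε * I) z‖ ≤
      ‖kk (N + 1) I z‖ * ((N + 1) * ((2 + 2 / ε) * (1 + ‖w‖)) ^ (N + 1) / ε * ‖w - w'‖) := by
  have hr1 := kk_ratio hε hw hz (W := ‖w‖) (by linarith [norm_nonneg w]) (norm_nonneg w)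
  have hr2 := kk_ratio hε hw' hz hW (norm_nonneg w)
  set R := (2 + 2 / ε) * (1 + ‖w‖) with hR
  have hzI : z + I ≠ 0 := add_I_ne hz
  have low : ∀ u ∈ UH, ε ≤ ‖z - (starRingEnd ℂ) (u + ε * I)‖ := fun u hu => by
    have : 0 < u.im := hu
    refine le_trans ?_ (kk_low hz)
    simp; linarith
  have l1 := low w hw
  have l2 := low w' hw'
  have hdd : (z - (starRingEnd ℂ) (w' + ε * I)) - (z - (starRingEnd ℂ) (w + ε * I)) = (starRingEnd ℂ) (w - w') := by
    simp
  have n1 : z - (starRingEnd ℂ) (w + ε * I) ≠ 0 := norm_pos_iff.1 (lt_of_lt_of_le hε l1)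
  have n2 : z - (starRingEnd ℂ) (w' + ε * I) ≠ 0 := norm_pos_iff.1 (lt_of_lt_of_le hε l2)
  have hkI : kk (N + 1) I z = ((z + I) ^ (N + 1))⁻¹ := by simp [kk]
  have e : kk (N + 1) (w + ε * I) z - kk (N + 1) (w' + ε * I) z = kk (N + 1) I z *
      (((z + I) * (z - (starRingEnd ℂ) (w + ε * I))⁻¹) ^ (N + 1) - ((z + I) * (z - (starRingEnd ℂ) (w' + ε * I))⁻¹) ^ (N + 1)) := by
    rw [hkI, kk, kk, mul_pow, mul_pow, ← mul_sub, ← mul_assoc, inv_mul_cancel₀ (pow_ne_zero _ hzI), one_mul, inv_pow, inv_pow]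
  rw [e, norm_mul]
  gcongr
  refine (norm_pow_sub_pow_le' hr1 hr2 N).trans ?_
  have h3 : ‖(z + I) * (z - (starRingEnd ℂ) (w + ε * I))⁻¹ - (z + I) * (z - (starRingEnd ℂ) (w' + ε * I))⁻¹‖ ≤ R * (ε⁻¹ * ‖w - w'‖) := by
    have : (z + I) * (z - (starRingEnd ℂ) (w + ε * I))⁻¹ - (z + I) * (z - (starRingEnd ℂ) (w' + ε * I))⁻¹ =
        ((z + I) * (z - (starRingEnd ℂ) (w + ε * I))⁻¹) * ((z - (starRingEnd ℂ) (w' + ε * I))⁻¹ * (starRingEnd ℂ) (w - w')) := by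
      rw [← hdd]
      generalize z - (starRingEnd ℂ) (w + ε * I) = a at *
      generalize z - (starRingEnd ℂ) (w' + ε * I) = b at *
      field_simp
    rw [this, norm_mul]
    refine mul_le_mul hr1 ?_ (norm_nonneg _) ((norm_nonneg _).trans hr1)
    rw [norm_mul, norm_inv, RCLike.norm_conj]
    gcongr
  have hR0 : 0 ≤ R := (norm_nonneg _).trans hr1
  calc _ ≤ (N + 1) * R ^ N * (R * (ε⁻¹ * ‖w - w'‖)) := by gcongr
    _ = _ := by rw [pow_succ]; field_simp

end HardyEnv

open MeasureTheory Real Complex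
open scoped ENNReal NNReal

namespace HardyEnv
open Filter Topology Set
open scoped Pointwise

lemma meas_kk (N : ℕ) (z : ℂ) : Measurable (fun w => kk N w z) := by
  unfold kk
  have : Measurable (fun w : ℂ => (starRingEnd ℂ) w) := Complex.continuous_conj.measurable
  fun_prop

lemma kk_le {N : ℕ} {ε : ℝ} (hε : 0 < ε) {w z : ℂ} (hw : w ∈ UH) (hz : z ∈ UH) : ‖kk N (w + ε * I) z‖ ≤ (ε ^ N)⁻¹ := by
  have hw' : 0 < w.im := hw
  rw [kk, norm_inv, norm_pow]
  refine inv_anti₀ (by positivity) (pow_le_pow_left₀ hε.le ?_ _)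
  refine le_trans ?_ (kk_low hz)
  simp; linarith

lemma disc {p : ℝ} (hp : 0 < p) {N : ℕ} (hN : 2 ≤ ((N + 1 : ℕ) : ℝ) * p) {ε : ℝ} (hε : 0 < ε) {g : ℂ → ℂ}
    (hgm : AEStronglyMeasurable g (volume.restrict UH))
    (hgi : IntegrableOn (fun w => ‖g w‖ * (1 + ‖w‖) ^ (N + 2)) UH) {η : ℝ} (hη : 0 < η) :
    ∃ S : ℂ → ℂ, DifferentiableOn ℂ S UH ∧
      QQ p S (π ^ (1 / p) * (∫ w in UH, ‖g w‖ * (w.im + ε) ^ (1 / p - (N + 1 : ℕ))) + η) ∧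
      ∀ z ∈ UH, ‖(∫ w in UH, g w * kk (N + 1) (w + ε * I) z) - S z‖ ≤ η * ‖kk (N + 1) I z‖ := by
  have hIUH : I ∈ UH := by simp
  set s : ℕ → SimpleFunc ℂ ℂ := fun n => SimpleFunc.approxOn id measurable_id UH I hIUH n with hs
  set μ : Measure ℂ := volume.restrict UH with hμ
  have hsmem : ∀ n w, s n w ∈ UH := fun n w => SimpleFunc.approxOn_mem _ _ _ _
  have hstend : ∀ w ∈ UH, Tendsto (fun n => s n w) atTop (𝓝 w) := fun w hw =>
    SimpleFunc.tendsto_approxOn measurable_id hIUH (subset_closure hw)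
  have hsdist : ∀ n w, ‖w - s n w‖ ≤ 1 + ‖w‖ := fun n w => by
    have h1 := SimpleFunc.edist_approxOn_le measurable_id hIUH w n
    rw [edist_dist, edist_dist] at h1
    have h2 := (ENNReal.ofReal_le_ofReal_iff dist_nonneg).1 h1
    rw [Complex.dist_eq, Complex.dist_eq] at h2
    rw [norm_sub_rev]
    refine h2.trans ((norm_sub_le _ _).trans ?_)
    simp
  have hsnorm : ∀ n w, ‖s n w‖ ≤ 1 + 2 * ‖w‖ := fun n w => by
    have h1 := norm_sub_norm_le (s n w) w
    have h2 := hsdist n w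
    rw [norm_sub_rev] at h2
    linarith
  have hae : ∀ {P : ℂ → Prop}, (∀ w ∈ UH, P w) → ∀ᵐ w ∂μ, P w := fun {P} h =>
    (ae_restrict_iff' isOpen_UH.measurableSet).2 (Eventually.of_forall h)
  have hgi0 : Integrable g μ := by
    refine Integrable.mono' hgi hgm (Eventually.of_forall fun w => ?_)
    have : 1 ≤ (1 + ‖w‖) ^ (N + 2) := one_le_pow₀ (by linarith [norm_nonneg w])
    nlinarith [norm_nonneg (g w)]
  set e : ℝ := 1 / p - (N + 1 : ℕ) with he
  have he0 : e ≤ 0 := by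
    rw [he, sub_nonpos, div_le_iff₀ hp]
    linarith
  -- norms
  have hmeasS : ∀ n, Measurable (s n) := fun n => (s n).measurable
  have hA : ∀ n w, w ∈ UH → ‖‖g w‖ * ((s n w).im + ε) ^ e‖ ≤ ‖g w‖ * ε ^ e := by
    intro n w hw
    have h0 : 0 < (s n w).im := hsmem n w
    rw [Real.norm_of_nonneg (by positivity)]
    exact mul_le_mul_of_nonneg_left (Real.rpow_le_rpow_of_nonpos hε (le_add_of_nonneg_left h0.le) he0) (norm_nonneg _)
  have hAm : ∀ n, AEStronglyMeasurable (fun w => ‖g w‖ * ((s n w).im + ε) ^ e) μ := by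
    intro n
    refine hgm.norm.mul (Measurable.aestronglyMeasurable ?_)
    have := hmeasS n
    have h2 : Measurable (fun w => (s n w).im) := Complex.measurable_im.comp this
    fun_prop
  have hAint : ∀ n, Integrable (fun w => ‖g w‖ * ((s n w).im + ε) ^ e) μ := fun n =>
    Integrable.mono' (hgi0.norm.mul_const _) (hAm n) (hae (hA n))
  have hAlim : Tendsto (fun n => ∫ w, ‖g w‖ * ((s n w).im + ε) ^ e ∂μ) atTop (𝓝 (∫ w, ‖g w‖ * (w.im + ε) ^ e ∂μ)) := by
    refine tendsto_integral_of_dominated_convergence (fun w => ‖g w‖ * ε ^ e) hAm (hgi0.norm.mul_const _)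
      (fun n => hae (hA n)) (hae fun w hw => ?_)
    have hw' : 0 < w.im := hw
    refine Tendsto.const_mul _ (Tendsto.rpow_const ?_ (Or.inl (by positivity)))
    exact ((Complex.continuous_im.tendsto w).comp (hstend w hw)).add_const ε
  -- errors
  set R : ℂ → ℝ := fun w => (N + 1) * ((2 + 2 / ε) * (1 + ‖w‖)) ^ (N + 1) / ε with hR
  have hR0 : ∀ w, 0 ≤ R w := fun w => by rw [hR]; positivity
  have hRm : Continuous R := by rw [hR]; fun_prop
  have hBd : ∀ n w, ‖‖g w‖ * (R w * ‖w - s n w‖)‖ ≤ (N + 1) * (2 + 2 / ε) ^ (N + 1) / ε * (‖g w‖ * (1 + ‖w‖) ^ (N + 2)) := by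
    intro n w
    rw [Real.norm_of_nonneg (mul_nonneg (norm_nonneg _) (mul_nonneg (hR0 w) (norm_nonneg _)))]
    calc _ ≤ ‖g w‖ * (R w * (1 + ‖w‖)) := by
          gcongr
          exact hsdist n w
      _ = _ := by rw [hR]; simp only []; rw [mul_pow]; ring
  have hBm : ∀ n, AEStronglyMeasurable (fun w => ‖g w‖ * (R w * ‖w - s n w‖)) μ := by
    intro n
    refine hgm.norm.mul (Measurable.aestronglyMeasurable ?_)
    have h1 := hmeasS n
    have h2 := hRm.measurable
    fun_prop
  have hBint : ∀ n, Integrable (fun w => ‖g w‖ * (R w * ‖w - s n w‖)) μ := fun n =>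
    Integrable.mono' (Integrable.const_mul hgi _) (hBm n) (Eventually.of_forall (hBd n))
  have hBlim : Tendsto (fun n => ∫ w, ‖g w‖ * (R w * ‖w - s n w‖) ∂μ) atTop (𝓝 0) := by
    have := tendsto_integral_of_dominated_convergence (μ := μ) (f := fun _ => (0:ℝ)) _ hBm (Integrable.const_mul hgi _)
      (fun n => Eventually.of_forall (hBd n)) (hae fun w hw => ?_)
    · simpa using this
    · have h1 : Tendsto (fun n => ‖w - s n w‖) atTop (𝓝 ‖w - w‖) := ((hstend w hw).const_sub w).norm
      have h2 := (h1.const_mul (R w)).const_mul ‖g w‖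
      simpa using h2
  obtain ⟨n, hn1, hn2⟩ := ((hAlim.eventually (gt_mem_nhds (lt_add_of_pos_right _ (show 0 < η / π ^ (1 / p) by positivity)))).and
    (hBlim.eventually (ge_mem_nhds hη))).exists
  have hkint : ∀ z ∈ UH, Integrable (fun w => g w * kk (N + 1) (s n w + ε * I) z) μ := by
    intro z hz
    refine hgi0.mul_bdd (c := (ε ^ (N + 1))⁻¹) ?_ (Eventually.of_forall fun w => kk_le hε (hsmem n w) hz)
    have h1 := hmeasS n
    exact ((meas_kk (N + 1) z).comp (by fun_prop)).aestronglyMeasurable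
  have hkint0 : ∀ z ∈ UH, Integrable (fun w => g w * kk (N + 1) (w + ε * I) z) μ := by
    intro z hz
    refine hgi0.mul_bdd (c := (ε ^ (N + 1))⁻¹) ?_ (hae fun w hw => kk_le hε hw hz)
    exact ((meas_kk (N + 1) z).comp (by fun_prop)).aestronglyMeasurable
  have hran : ∀ c ∈ (s n).range, c ∈ UH := by
    intro c hc
    obtain ⟨w, rfl⟩ := SimpleFunc.mem_range.1 hc
    exact hsmem n w
  refine ⟨∑ c ∈ (s n).range, (∫ w in s n ⁻¹' {c}, g w ∂μ) • kk (N + 1) (c + ε * I), ?_, ?_, ?_⟩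
  · refine DifferentiableOn.sum fun c hc => ?_
    exact (kk_diff _ (shift_mem (hran c hc) hε.le)).const_smul _
  · refine QQ.mono (QQ_sum hp _ _ _ (fun c hc => QQ_ckk hp hN (shift_mem (hran c hc) hε.le) _)) ?_
    rw [← Finset.mul_sum]
    have h1 : ∑ c ∈ (s n).range, ‖∫ w in s n ⁻¹' {c}, g w ∂μ‖ * (c + ε * I).im ^ e ≤
        ∫ w, ‖g w‖ * ((s n w).im + ε) ^ e ∂μ := by
      rw [simple_int (𝕜 := ℝ) (s n) (fun c => (c.im + ε) ^ e) (hAint n)]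
      refine Finset.sum_le_sum fun c hc => ?_
      have hc0 : 0 < c.im := hran c hc
      rw [show (c + ε * I).im = c.im + ε by simp]
      gcongr
      exact norm_integral_le_integral_norm _
    calc _ ≤ π ^ (1 / p) * ((∫ w, ‖g w‖ * (w.im + ε) ^ e ∂μ) + η / π ^ (1 / p)) := by
          gcongr
          exact h1.trans hn1.le
      _ = _ := by
          rw [mul_add, mul_div_cancel₀]
          positivity
  · intro z hz
    have e1 : (∑ c ∈ (s n).range, (∫ w in s n ⁻¹' {c}, g w ∂μ) • kk (N + 1) (c + ε * I)) z = ∫ w, g w * kk (N + 1) (s n w + ε * I) z ∂μ := by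
      rw [simple_int (𝕜 := ℂ) (s n) (fun c => kk (N + 1) (c + ε * I) z) (hkint z hz), Finset.sum_apply]
      rfl
    rw [e1, ← integral_sub (hkint0 z hz) (hkint z hz)]
    calc _ ≤ ∫ w, (‖g w‖ * (R w * ‖w - s n w‖)) * ‖kk (N + 1) I z‖ ∂μ := by
          refine norm_integral_le_of_norm_le ((hBint n).mul_const _) (hae fun w hw => ?_)
          rw [← mul_sub, norm_mul]
          have := kk_diff_bound hε hw (hsmem n w) hz (hsnorm n w) N
          rw [mul_assoc]
          exact mul_le_mul_of_nonneg_left (this.trans_eq (mul_comm _ _)) (norm_nonneg _)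
      _ = (∫ w, ‖g w‖ * (R w * ‖w - s n w‖) ∂μ) * ‖kk (N + 1) I z‖ := integral_mul_const _ _
      _ ≤ _ := by gcongr

end HardyEnv

open MeasureTheory Real Complex
open scoped ENNReal NNReal

namespace HardyEnv
open Filter Topology Set
open scoped Pointwise

lemma shift_NA {f : ℂ → ℂ} (p : ℝ) {ε : ℝ} (hε : 0 ≤ ε) :
    ∫⁻ w in UH, ‖f (w + ε * I)‖ₑ * ENNReal.ofReal ((w.im + ε) ^ (1 / p - 2)) ≤ NA p f := by
  unfold NA
  rw [← lintegral_indicator isOpen_UH.measurableSet, ← lintegral_indicator isOpen_UH.measurableSet,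
    ← lintegral_add_right_eq_self (UH.indicator fun z => ‖f z‖ₑ * ENNReal.ofReal (z.im ^ (1 / p - 2))) ((ε:ℂ) * I)]
  refine lintegral_mono fun w => ?_
  by_cases hw : w ∈ UH
  · rw [indicator_of_mem hw, indicator_of_mem (shift_mem hw hε)]
    simp
  · rw [indicator_of_notMem hw]
    exact zero_le

noncomputable def kap (m : ℕ) : ℂ := ((2 * I) ^ (m + 1) * (m + 1))⁻¹ * (-(2 * π * I))

lemma kap_ne (m : ℕ) : kap m ≠ 0 := by
  have h1 : (π : ℂ) ≠ 0 := by exact_mod_cast Real.pi_ne_zero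
  have h2 : (m + 1 : ℂ) ≠ 0 := by exact_mod_cast Nat.succ_ne_zero m
  unfold kap
  refine mul_ne_zero (inv_ne_zero (mul_ne_zero (pow_ne_zero _ ?_) h2)) ?_
  · simp
  · simp [h1]

lemma QQ_err {p : ℝ} (hp : 0 < p) {N : ℕ} (hN : 2 ≤ N * p) {D : ℂ → ℂ} (hd : DifferentiableOn ℂ D UH) {η : ℝ} (hη : 0 < η)
    (h : ∀ z ∈ UH, ‖D z‖ ≤ η * ‖kk N I z‖) : QQ p D (η * π ^ (1 / p)) := by
  have hI : I ∈ UH := by simp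
  refine QQ_of_Hle hp hd (by positivity) ?_
  have h1 := Hle_smul hp (kk_Hle hN hI) (η : ℂ)
  intro y hy
  refine le_trans (lintegral_mono fun x => ?_) ((h1 y hy).trans_eq ?_)
  · refine ENNReal.rpow_le_rpow ?_ hp.le
    rw [← ofReal_norm, ← ofReal_norm]
    refine ENNReal.ofReal_le_ofReal ((h _ (by simpa using hy)).trans_eq ?_)
    rw [Pi.smul_apply, norm_smul, Complex.norm_real, Real.norm_of_nonneg hη.le]
  · rw [← ofReal_norm, ENNReal.ofReal_rpow_of_nonneg (norm_nonneg _) hp.le, ← ENNReal.ofReal_mul (by positivity),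
      Complex.norm_real, Real.norm_of_nonneg hη.le, Real.mul_rpow hη.le (by positivity), ← Real.rpow_mul (by positivity),
      one_div, inv_mul_cancel₀ hp.ne']
    simp

lemma lower {p : ℝ} (hp0 : 0 < p) (hp1 : p < 1) {m : ℕ} (hm : 2 ≤ (m : ℝ) * p) {f : ℂ → ℂ} (hd : DifferentiableOn ℂ f UH)
    {M : ℝ≥0∞} (hM : Hle p f M) (hMt : M ≠ ⊤) (hNA : NA p f ≠ ⊤) :
    gauge (convexHull ℝ (BB p)) f ≤ π ^ (1 / p) * ‖(kap m)⁻¹‖ * (NA p f).toReal := by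
  have hN2 : 2 ≤ ((m + 1 + 1 : ℕ) : ℝ) * p := by push_cast; nlinarith
  have key : ∀ η : ℝ, 0 < η → QQ p f (π ^ (1 / p) * ‖(kap m)⁻¹‖ * (NA p f).toReal + η * (3 + π ^ (1 / p))) := by
    intro η hη
    have hηp : 0 < η ^ p := by positivity
    obtain ⟨ε0, hε0, h1⟩ := approx1 hp0 hp1 hd hM hMt hηp
    set ε := ε0 / 2 with hεd
    have hε : 0 < ε := by positivity
    have h1' := h1 (2 * ε) (by positivity) (by linarith)
    have esh : ∀ z : ℂ, z + ((2 * ε : ℝ) : ℂ) * I = z + ε * I + ε * I := fun z => by push_cast; ring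
    simp only [esh] at h1'
    set K : ℕ := m + (m + 1 + 2) + 3 with hK
    obtain ⟨δ, hδ, h2⟩ := approx2 hp0 hp1 hd hM hMt K hε hηp
    have hd1 : DifferentiableOn ℂ (fun z => f (z + ε * I)) UH := shift_diff hd hε.le
    have hd2 : DifferentiableOn ℂ (fun z => f (z + ε * I + ε * I)) UH := shift_diff hd1 hε.le
    have hpsi := psi_diff K hδ.le
    have hpsi1 : DifferentiableOn ℂ (fun z => psi K δ (z + ε * I)) UH := shift_diff hpsi hε.le
    set F : ℂ → ℂ := fun w => f (w + ε * I) * psi K δ w with hF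
    have hFd : DifferentiableOn ℂ F UH := hd1.mul hpsi
    obtain ⟨A, hA⟩ := bdd_of_Hle hp0 hd hM hMt ε hε
    have hA0 : 0 ≤ A := (norm_nonneg _).trans (hA (ε * I) (by simp))
    set C0 : ℝ := A * (1 + 1 / δ) ^ K with hC0
    have hC00 : 0 ≤ C0 := by positivity
    have hFb : ∀ w ∈ UH, ‖F w‖ ≤ C0 * ((1 + ‖w‖) ^ K)⁻¹ := by
      intro w hw
      have hw' : 0 < w.im := hw
      rw [hF, hC0, mul_assoc]
      simp only [norm_mul]
      exact mul_le_mul (hA _ (by simp; linarith)) (psi_decay K hδ hw'.le) (norm_nonneg _) hA0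
    have hFb2 : ∀ w ∈ UH, ‖F w‖ ≤ C0 * (1 + ‖w‖ ^ 2)⁻¹ := by
      intro w hw
      refine (hFb w hw).trans (mul_le_mul_of_nonneg_left (inv_anti₀ (by positivity) ?_) hC00)
      have a : (1 + ‖w‖) ^ 2 ≤ (1 + ‖w‖) ^ K := pow_le_pow_right₀ (by linarith [norm_nonneg w]) (by omega)
      nlinarith [norm_nonneg w]
    set g : ℂ → ℂ := fun w => (kap m)⁻¹ * (F w * (w.im : ℂ) ^ m) with hg
    have hcont : ContinuousOn g UH := by
      refine continuousOn_const.mul (hFd.continuousOn.mul (Continuous.continuousOn ?_))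
      exact (Complex.continuous_ofReal.comp Complex.continuous_im).pow m
    have hgm : AEStronglyMeasurable g (volume.restrict UH) := hcont.aestronglyMeasurable isOpen_UH.measurableSet
    have him : ∀ w ∈ UH, ‖(w.im : ℂ) ^ m‖ = w.im ^ m := by
      intro w hw
      have hw' : 0 < w.im := hw
      rw [norm_pow, Complex.norm_real, Real.norm_of_nonneg hw'.le]
    have hgi : IntegrableOn (fun w => ‖g w‖ * (1 + ‖w‖) ^ (m + 1 + 2)) UH := by
      have hInteg : Integrable (fun w : ℂ => (‖(kap m)⁻¹‖ * C0) * (1 + ‖w‖) ^ (-(3:ℝ))) volume :=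
        (integrable_one_add_norm (by rw [Complex.finrank_real_complex]; norm_num)).const_mul _
      refine Integrable.mono' hInteg.integrableOn ?_ ?_
      · exact hgm.norm.mul (Continuous.aestronglyMeasurable (by fun_prop))
      · refine (ae_restrict_iff' isOpen_UH.measurableSet).2 (Eventually.of_forall fun w hw => ?_)
        have hw' : 0 < w.im := hw
        have hp1 : 0 < 1 + ‖w‖ := by positivity
        rw [Real.norm_of_nonneg (by positivity)]
        simp only [hg, norm_mul, him w hw]
        have i1 : w.im ^ m ≤ (1 + ‖w‖) ^ m := by
          refine pow_le_pow_left₀ hw'.le ?_ _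
          have := Complex.abs_im_le_norm w
          rw [abs_of_pos hw'] at this
          linarith
        calc _ ≤ ‖(kap m)⁻¹‖ * ((C0 * ((1 + ‖w‖) ^ K)⁻¹) * (1 + ‖w‖) ^ m) * (1 + ‖w‖) ^ (m + 1 + 2) := by
              gcongr
              exact hFb w hw
          _ = _ := by
              rw [Real.rpow_neg hp1.le, show (3:ℝ) = ((3:ℕ):ℝ) by norm_num, Real.rpow_natCast, hK,
                pow_add _ (m + (m + 1 + 2)) 3, pow_add _ m (m + 1 + 2)]
              field_simp
    obtain ⟨S, hSd, hSQ, hSe⟩ := disc hp0 (N := m + 1) hN2 hε hgm hgi hη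
    have hT : ∀ z ∈ UH, (∫ w in UH, g w * kk (m + 1 + 1) (w + ε * I) z) = F (z + ε * I) := by
      intro z hz
      have hgi0 : IntegrableOn g UH := by
        refine Integrable.mono' hgi hgm (Eventually.of_forall fun w => ?_)
        have : 1 ≤ (1 + ‖w‖) ^ (m + 1 + 2) := one_le_pow₀ (by linarith [norm_nonneg w])
        nlinarith [norm_nonneg (g w)]
      have hi : IntegrableOn (fun w => g w * kk (m + 1 + 1) (w + ε * I) z) UH := by
        refine hgi0.mul_bdd (c := (ε ^ (m + 1 + 1))⁻¹) ?_
          ((ae_restrict_iff' isOpen_UH.measurableSet).2 (Eventually.of_forall fun w hw => kk_le hε hw hz))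
        exact ((meas_kk (m + 1 + 1) z).comp (by fun_prop)).aestronglyMeasurable
      have e : ∀ w, g w * kk (m + 1 + 1) (w + ε * I) z =
          (kap m)⁻¹ * (F w * (w.im : ℂ) ^ m * (((z + ε * I) - (starRingEnd ℂ) w) ^ (m + 2))⁻¹) := by
        intro w
        simp only [hg, kk]
        rw [show z - (starRingEnd ℂ) (w + ε * I) = (z + ε * I) - (starRingEnd ℂ) w by simp; ring]
        ring
      have hi2 : IntegrableOn (fun w => F w * (w.im : ℂ) ^ m * (((z + ε * I) - (starRingEnd ℂ) w) ^ (m + 2))⁻¹) UH := by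
        refine (Integrable.const_mul hi (kap m)).congr (Eventually.of_forall fun w => ?_)
        simp only [e]
        rw [mul_inv_cancel_left₀ (kap_ne m)]
      have := repro hFd hFb2 m (shift_mem hz hε.le) hi2
      simp only [e]
      rw [integral_const_mul, this, ← kap, inv_mul_cancel_left₀ (kap_ne m)]
    have hbound : ∫ w in UH, ‖g w‖ * (w.im + ε) ^ (1 / p - (m + 1 + 1 : ℕ)) ≤ ‖(kap m)⁻¹‖ * (NA p f).toReal := by
      have hle : ∀ w ∈ UH, ‖g w‖ * (w.im + ε) ^ (1 / p - (m + 1 + 1 : ℕ)) ≤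
          ‖(kap m)⁻¹‖ * (‖f (w + ε * I)‖ * (w.im + ε) ^ (1 / p - 2)) := by
        intro w hw
        have hw' : 0 < w.im := hw
        have hv : 0 < w.im + ε := by positivity
        simp only [hg, norm_mul, him w hw, hF]
        have e : (w.im + ε) ^ (1 / p - 2) = (w.im + ε) ^ m * (w.im + ε) ^ (1 / p - (m + 1 + 1 : ℕ)) := by
          rw [← Real.rpow_natCast, ← Real.rpow_add hv]
          congr 1
          push_cast; ring
        rw [e]
        calc _ ≤ ‖(kap m)⁻¹‖ * (‖f (w + ε * I)‖ * 1 * (w.im + ε) ^ m) * (w.im + ε) ^ (1 / p - (m + 1 + 1 : ℕ)) := by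
              gcongr
              · exact psi_le_one K hδ.le hw'.le
              · linarith
          _ = _ := by ring
      rw [integral_eq_lintegral_of_nonneg_ae]
      · have : ∫⁻ w in UH, ENNReal.ofReal (‖g w‖ * (w.im + ε) ^ (1 / p - (m + 1 + 1 : ℕ))) ≤ ENNReal.ofReal ‖(kap m)⁻¹‖ * NA p f := by
          refine le_trans ?_ (mul_le_mul_right (shift_NA (f := f) p hε.le) _)
          rw [← lintegral_const_mul' _ _ ENNReal.ofReal_ne_top]
          refine setLIntegral_mono' isOpen_UH.measurableSet fun w hw => ?_
          refine (ENNReal.ofReal_le_ofReal (hle w hw)).trans_eq ?_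
          rw [ENNReal.ofReal_mul (norm_nonneg _), ENNReal.ofReal_mul (norm_nonneg _), ofReal_norm (f _)]
        refine (ENNReal.toReal_mono (ENNReal.mul_ne_top ENNReal.ofReal_ne_top hNA) this).trans_eq ?_
        rw [ENNReal.toReal_mul, ENNReal.toReal_ofReal (norm_nonneg _)]
      · refine (ae_restrict_iff' isOpen_UH.measurableSet).2 (Eventually.of_forall fun w hw => ?_)
        have hw' : 0 < w.im := hw
        show (0:ℝ) ≤ _
        positivity
      · exact hgm.norm.mul (((Complex.measurable_im.add_const ε).pow_const _).aestronglyMeasurable)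
    have q1 : QQ p (fun z => f z - f (z + ε * I + ε * I)) η := QQ_of_Hle hp0 (hd.sub hd2) hη.le h1'
    have q2 : QQ p (fun z => f (z + ε * I + ε * I) * (1 - psi K δ (z + ε * I))) η :=
      QQ_of_Hle hp0 (hd2.mul (hpsi1.const_sub 1)) hη.le h2
    have q3 : QQ p (fun z => F (z + ε * I) - S z) (η * π ^ (1 / p)) := by
      refine QQ_err hp0 hN2 ((shift_diff hFd hε.le).sub hSd) hη fun z hz => ?_
      have := hSe z hz
      rwa [hT z hz] at this
    have q := ((q1.add q2).add q3).add hSQ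
    have ef : f = (fun z => f z - f (z + ε * I + ε * I)) + (fun z => f (z + ε * I + ε * I) * (1 - psi K δ (z + ε * I))) +
        (fun z => F (z + ε * I) - S z) + S := by
      funext z
      simp only [Pi.add_apply, hF]
      ring
    rw [← ef] at q
    refine q.mono ?_
    have hpi : 0 ≤ π ^ (1 / p) := by positivity
    have := mul_le_mul_of_nonneg_left hbound hpi
    linarith
  refine le_of_forall_pos_le_add fun t ht => ?_
  have hc : 0 < 3 + π ^ (1 / p) := by positivity
  refine (key (t / (3 + π ^ (1 / p))) (by positivity)).gauge_le.trans_eq ?_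
  rw [div_mul_cancel₀ _ hc.ne']

end HardyEnv


open MeasureTheory Real Complex
open scoped ENNReal NNReal

/-- **Banach envelope of `Hᵖ(ℂ₊)`, dense-subspace form.** For `0 < p < 1` and
`α = 1/p - 2`, the Minkowski functional of the convex hull of the unit ball of
`Hᵖ(ℂ₊)` is equivalent, on `Hᵖ(ℂ₊)`, to the `A^{1,α}(ℂ₊)`-norm. -/
theorem hardy_halfplane_envelope (p : ℝ) (hp0 : 0 < p) (hp1 : p < 1)
    (B : Set (ℂ → ℂ))
    (hB : B = {f : ℂ → ℂ | DifferentiableOn ℂ f {z : ℂ | 0 < z.im} ∧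
      (⨆ (y : ℝ) (_ : 0 < y), ∫⁻ x : ℝ, (‖f (x + y * Complex.I)‖₊ : ℝ≥0∞) ^ p) ≤ 1}) :
    ∃ c C : ℝ, 0 < c ∧ 0 < C ∧ ∀ f : ℂ → ℂ,
      DifferentiableOn ℂ f {z : ℂ | 0 < z.im} →
      (⨆ (y : ℝ) (_ : 0 < y), ∫⁻ x : ℝ, (‖f (x + y * Complex.I)‖₊ : ℝ≥0∞) ^ p) < ⊤ →
      ENNReal.ofReal (c * gauge (convexHull ℝ B) f) ≤
        (∫⁻ z in {z : ℂ | 0 < z.im},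
          (‖f z‖₊ : ℝ≥0∞) * ENNReal.ofReal (z.im ^ (1 / p - 2))) ∧
      (∫⁻ z in {z : ℂ | 0 < z.im},
          (‖f z‖₊ : ℝ≥0∞) * ENNReal.ofReal (z.im ^ (1 / p - 2))) ≤
        ENNReal.ofReal (C * gauge (convexHull ℝ B) f) := by
  obtain ⟨m, hm⟩ := exists_nat_ge (2 / p)
  have hm' : 2 ≤ (m : ℝ) * p := by rwa [div_le_iff₀ hp0] at hm
  have hBB : B = HardyEnv.BB p := by
    rw [hB]
    ext f
    refine and_congr Iff.rfl ?_
    exact iSup₂_le_iff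
  set A : ℝ≥0∞ := 2 ^ (2 / p - 1) * ENNReal.ofReal (1 / (2 / p / 2 - 1) + 2) with hA
  have hAt : A ≠ ⊤ := by
    have h1 : (1:ℝ) ≤ 1 / p := by rw [le_div_iff₀ hp0]; linarith
    refine ENNReal.mul_ne_top (ENNReal.rpow_ne_top_of_nonneg ?_ (by norm_num)) ENNReal.ofReal_ne_top
    have : 2 / p = 2 * (1 / p) := by ring
    linarith
  set C1 : ℝ := π ^ (1 / p) * ‖(HardyEnv.kap m)⁻¹‖ with hC1
  have hC1p : 0 < C1 := by
    have := norm_pos_iff.2 (inv_ne_zero (HardyEnv.kap_ne m))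
    positivity
  refine ⟨C1⁻¹, A.toReal + 1, by positivity, by positivity, fun f hd hM => ?_⟩
  have hH : HardyEnv.Hle p f (⨆ (y : ℝ) (_ : 0 < y), ∫⁻ x : ℝ, (‖f (x + y * Complex.I)‖₊ : ℝ≥0∞) ^ p) := fun y hy =>
    le_iSup₂ (f := fun (y : ℝ) (_ : 0 < y) => ∫⁻ x : ℝ, (‖f (x + y * Complex.I)‖₊ : ℝ≥0∞) ^ p) y hy
  rw [hBB]
  constructor
  · show _ ≤ HardyEnv.NA p f
    by_cases hNA : HardyEnv.NA p f = ⊤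
    · rw [hNA]; exact le_top
    · have h := HardyEnv.lower hp0 hp1 hm' hd hH hM.ne hNA
      refine (ENNReal.ofReal_le_ofReal (q := (HardyEnv.NA p f).toReal) ?_).trans_eq (ENNReal.ofReal_toReal hNA)
      rw [inv_mul_le_iff₀ hC1p]
      exact h
  · refine HardyEnv.upper_gauge hp0 (by positivity) (fun g hg => ?_) hd hM.ne hH
    refine (HardyEnv.NA_le_of_Hle hp0 hp1 hg.1 hg.2).trans ?_
    rw [← hA, ← ENNReal.ofReal_toReal hAt]
    refine ENNReal.ofReal_le_ofReal ?_
    rw [ENNReal.toReal_ofReal ENNReal.toReal_nonneg]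
    linarith
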